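/- arXiv:1804.06036 — 3 statements merged into one kernel-verified Lean document; each statement's English description precedes it below -/
import Mathlib

section
/- Every loopless multigraph with maximum degree at most 3 is incidence 6-choosable; that is, for every loopless multigraph G in which every vertex has degree at most 3, the incidence choice number satisfies ch_i(G) ≤ 6. -/
/-- A loopless multigraph: a vertex type `V`, an edge type `E`, and a map assigning to each
edge its pair of (distinct) endpoints. -/
structure Multigraph (V E : Type*) where
  ends : E → Sym2 V
  loopless : ∀ e, ¬ (ends e).IsDiag

namespace Multigraph

variable {V E : Type*}

/-- The degree of a vertex: the number of edges incident with it. -/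
noncomputable def degree (G : Multigraph V E) (v : V) : ℕ := {e : E | v ∈ G.ends e}.ncard

/-- `(v, e)` is an incidence of `G` when `v` is an endpoint of `e`. -/
def IsInc (G : Multigraph V E) (v : V) (e : E) : Prop := v ∈ G.ends e

/-- Two incidences `(v, e)` and `(w, f)` are adjacent if `v = w`, or `e = f`, or the edge `e`
joins `v` and `w`, or the edge `f` joins `v` and `w`. -/
def IncAdj (G : Multigraph V E) (v : V) (e : E) (w : V) (f : E) : Prop :=
  v = w ∨ e = f ∨ G.ends e = s(v, w) ∨ G.ends f = s(v, w)

/-- `φ` is an incidence coloring of `G` choosing colors from the list assignment `L`. -/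
def IsIncListColoring (G : Multigraph V E) (L : V × E → Finset ℕ) (φ : V × E → ℕ) : Prop :=
  (∀ v e, G.IsInc v e → φ (v, e) ∈ L (v, e)) ∧
  (∀ v e w f, G.IsInc v e → G.IsInc w f → (v, e) ≠ (w, f) → G.IncAdj v e w f →
    φ (v, e) ≠ φ (w, f))

/-- `G` is incidence `k`-choosable: for every assignment of lists of `k` colors to the
incidences of `G` there is an incidence coloring choosing colors from the lists. -/
def IncChoosable (G : Multigraph V E) (k : ℕ) : Prop :=
  ∀ L : V × E → Finset ℕ, (∀ v e, G.IsInc v e → (L (v, e)).card = k) →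
    ∃ φ, G.IsIncListColoring L φ

/-- The incidence choice number of `G`: the least `k` such that `G` is incidence
`k`-choosable. -/
noncomputable def incChoiceNumber (G : Multigraph V E) : ℕ := sInf {k | G.IncChoosable k}

end Multigraph

namespace IncAux

theorem pick (A : Finset ℕ) (l : List ℕ) (h : l.length < A.card) : ∃ z ∈ A, z ∉ l := by
  obtain ⟨z, hz, hz'⟩ := Finset.exists_mem_notMem_of_card_lt_card
    (lt_of_le_of_lt (List.toFinset_card_le l) h)
  exact ⟨z, hz, by simpa using hz'⟩

theorem card_sdiff_list (A : Finset ℕ) (l : List ℕ) :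
    A.card ≤ (A \ l.toFinset).card + l.length := by
  have h1 := Finset.le_card_sdiff l.toFinset A
  have h2 := List.toFinset_card_le l
  omega

/-- Four sets of a clique plus two outer sets. -/
theorem lemA (P P' H1 H2 H3 H4 : Finset ℕ) (hP : 3 ≤ P.card) (hP' : 3 ≤ P'.card)
    (h1 : 5 ≤ H1.card) (h2 : 5 ≤ H2.card) (h3 : 5 ≤ H3.card) (h4 : 5 ≤ H4.card) :
    ∃ p ∈ P, ∃ p' ∈ P', ∃ a ∈ H1, ∃ b ∈ H2, ∃ c ∈ H3, ∃ d ∈ H4,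
      a ≠ b ∧ a ≠ c ∧ a ≠ d ∧ b ≠ c ∧ b ≠ d ∧ c ≠ d ∧ a ≠ p ∧ b ≠ p ∧ c ≠ p ∧ d ≠ p ∧
      a ≠ p' ∧ b ≠ p' ∧ c ≠ p' ∧ d ≠ p' := by
  have key : ∃ p ∈ P, ∃ p' ∈ P', 4 ≤ (H1 \ [p, p'].toFinset).card := by
    by_cases hd : Disjoint P P'
    · by_cases hs : P ∪ P' ⊆ H1
      · have hc := Finset.card_le_card hs
        rw [Finset.card_union_of_disjoint hd] at hc
        obtain ⟨p, hp⟩ := Finset.card_pos.mp (show 0 < P.card by omega)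
        obtain ⟨p', hp'⟩ := Finset.card_pos.mp (show 0 < P'.card by omega)
        have := card_sdiff_list H1 [p, p']
        simp only [List.length] at this
        exact ⟨p, hp, p', hp', by omega⟩
      · rw [Finset.not_subset] at hs
        obtain ⟨z, hz, hz1⟩ := hs
        rcases Finset.mem_union.mp hz with hz | hz
        · obtain ⟨p', hp'⟩ := Finset.card_pos.mp (show 0 < P'.card by omega)
          have := card_sdiff_list H1 [p']
          have e : H1 \ [z, p'].toFinset = H1 \ [p'].toFinset := by
            ext t; simp; grind
          simp only [List.length] at this
          exact ⟨z, hz, p', hp', by rw [e]; omega⟩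
        · obtain ⟨p', hp'⟩ := Finset.card_pos.mp (show 0 < P.card by omega)
          have := card_sdiff_list H1 [p']
          have e : H1 \ [p', z].toFinset = H1 \ [p'].toFinset := by
            ext t; simp; grind
          simp only [List.length] at this
          exact ⟨p', hp', z, hz, by rw [e]; omega⟩
    · rw [Finset.not_disjoint_iff] at hd
      obtain ⟨c, hc, hc'⟩ := hd
      have := card_sdiff_list H1 [c]
      have e : H1 \ [c, c].toFinset = H1 \ [c].toFinset := by
        ext t; simp
      simp only [List.length] at this
      exact ⟨c, hc, c, hc', by rw [e]; omega⟩
  obtain ⟨p, hp, p', hp', h⟩ := key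
  obtain ⟨b, hb, hb'⟩ := pick H2 [p, p'] (by simp; omega)
  obtain ⟨c, hc, hc'⟩ := pick H3 [p, p', b] (by simp; omega)
  obtain ⟨d, hd, hd'⟩ := pick H4 [p, p', b, c] (by simp; omega)
  obtain ⟨a, ha, ha'⟩ := pick (H1 \ [p, p'].toFinset) [b, c, d] (by simp only [List.length]; omega)
  refine ⟨p, hp, p', hp', a, ?_, b, hb, c, hc, d, hd, ?_⟩
  · simp at ha; exact ha.1
  · simp at ha ha' hb' hc' hd'
    grind

/-- conclusion of the star lemma -/
def StarOK (P1 P2 P3 Q1 Q2 Q3 : Finset ℕ) : Prop :=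
  ∃ p1 ∈ P1, ∃ p2 ∈ P2, ∃ p3 ∈ P3, ∃ q1 ∈ Q1, ∃ q2 ∈ Q2, ∃ q3 ∈ Q3,
    p1 ≠ p2 ∧ p1 ≠ p3 ∧ p2 ≠ p3 ∧ p1 ≠ q1 ∧ p1 ≠ q2 ∧ p1 ≠ q3 ∧
    p2 ≠ q1 ∧ p2 ≠ q2 ∧ p2 ≠ q3 ∧ p3 ≠ q1 ∧ p3 ≠ q2 ∧ p3 ≠ q3

theorem star_two (P1 P2 P3 : Finset ℕ) (h1 : 4 ≤ P1.card) (h2 : 4 ≤ P2.card) (h3 : 4 ≤ P3.card)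
    (a : ℕ) (ha1 : a ∈ P1) (ha2 : a ∉ P2) (c d : ℕ) :
    ∃ p1 ∈ P1, ∃ p2 ∈ P2, ∃ p3 ∈ P3, p1 ≠ p2 ∧ p1 ≠ p3 ∧ p2 ≠ p3 ∧
      p1 ≠ c ∧ p1 ≠ d ∧ p2 ≠ c ∧ p2 ≠ d ∧ p3 ≠ c ∧ p3 ≠ d := by
  by_cases hac : a = c ∨ a = d
  · have : ∃ z, z = c ∨ z = d := ⟨c, Or.inl rfl⟩
    obtain ⟨z, hz⟩ : ∃ z, ∀ t ∈ P2, (t = c ∨ t = d) → t = z := by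
      rcases hac with h | h
      · exact ⟨d, by grind⟩
      · exact ⟨c, by grind⟩
    obtain ⟨p1, hp1, hp1'⟩ := pick P1 [c, d] (by simp; omega)
    obtain ⟨p3, hp3, hp3'⟩ := pick P3 [c, d, p1] (by simp; omega)
    obtain ⟨p2, hp2, hp2'⟩ := pick P2 [z, p1, p3] (by simp; omega)
    refine ⟨p1, hp1, p2, hp2, p3, hp3, ?_⟩
    simp at hp1' hp2' hp3'
    grind
  · obtain ⟨p3, hp3, hp3'⟩ := pick P3 [c, d, a] (by simp; omega)
    obtain ⟨p2, hp2, hp2'⟩ := pick P2 [c, d, p3] (by simp; omega)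
    refine ⟨a, ha1, p2, hp2, p3, hp3, ?_⟩
    simp at hp2' hp3'
    grind

theorem star_fin (P1 P2 P3 Q1 Q2 Q3 : Finset ℕ) (h2 : 4 ≤ P2.card)
    (a : ℕ) (ha1 : a ∈ P1) (ha2 : a ∉ P2) (U : Finset ℕ) (hU : U.card = 3)
    (hUP : U ⊆ P3) (haU : a ∉ U)
    (q1 q2 q3 : ℕ) (hq1 : q1 ∈ Q1) (hq2 : q2 ∈ Q2) (hq3 : q3 ∈ Q3) (n1 : q1 ≠ a) (n2 : q2 ≠ a)
    (n3 : q3 ≠ a) (w : q1 ∉ U ∨ q2 ∉ U ∨ q3 ∉ U) (w' : q1 ∉ P2 ∨ q2 ∉ P2 ∨ q3 ∉ P2) :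
    StarOK P1 P2 P3 Q1 Q2 Q3 := by
  obtain ⟨y, z, hyz⟩ : ∃ y z, ∀ t ∈ U, (t = q1 ∨ t = q2 ∨ t = q3) → t = y ∨ t = z := by
    rcases w with w | w | w
    · exact ⟨q2, q3, by grind⟩
    · exact ⟨q1, q3, by grind⟩
    · exact ⟨q1, q2, by grind⟩
  obtain ⟨y', z', hyz'⟩ : ∃ y z, ∀ t ∈ P2, (t = q1 ∨ t = q2 ∨ t = q3) → t = y ∨ t = z := by
    rcases w' with w | w | w
    · exact ⟨q2, q3, by grind⟩
    · exact ⟨q1, q3, by grind⟩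
    · exact ⟨q1, q2, by grind⟩
  obtain ⟨p3, hp3, hp3'⟩ := pick U [y, z] (by simp; omega)
  obtain ⟨p2, hp2, hp2'⟩ := pick P2 [y', z', p3] (by simp; omega)
  refine ⟨a, ha1, p2, hp2, p3, hUP hp3, q1, hq1, q2, hq2, q3, hq3, ?_⟩
  simp at hp2' hp3'
  grind

theorem ex_out (A B U : Finset ℕ) (a w : ℕ) (hA : A.card = 2) (hB : B.card = 2)
    (hAB : Disjoint A B) (hU : U.card = 3) (hw : w ∈ U) (hwA : w ∉ A) (hwB : w ∉ B) :
    (∃ z ∈ A, z ≠ a ∧ z ∉ U) ∨ (∃ z ∈ B, z ≠ a ∧ z ∉ U) := by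
  have h1 : (U.erase w).card = 2 := by rw [Finset.card_erase_of_mem hw, hU]
  have h2 : ((A ∪ B).erase a).card ≥ 3 := by
    have := Finset.pred_card_le_card_erase (s := A ∪ B) (a := a)
    rw [Finset.card_union_of_disjoint hAB] at this
    omega
  obtain ⟨z, hz, hz'⟩ := Finset.exists_mem_notMem_of_card_lt_card
    (show (U.erase w).card < ((A ∪ B).erase a).card by omega)
  simp only [Finset.mem_erase, Finset.mem_union] at hz hz'
  grind

theorem star_disj (P1 P2 P3 Q1 Q2 Q3 : Finset ℕ) (h2 : P2.card = 4)
    (h3 : 4 ≤ P3.card) (hq1 : Q1.card = 2) (hq2 : Q2.card = 2) (hq3 : Q3.card = 2)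
    (d12 : Disjoint Q1 Q2) (d13 : Disjoint Q1 Q3) (d23 : Disjoint Q2 Q3)
    (a : ℕ) (ha1 : a ∈ P1) (ha2 : a ∉ P2) :
    StarOK P1 P2 P3 Q1 Q2 Q3 := by
  obtain ⟨U, hUs, hU⟩ := Finset.exists_subset_card_eq
    (show 3 ≤ (P3.erase a).card by
      have := Finset.pred_card_le_card_erase (s := P3) (a := a); omega)
  have hUP : U ⊆ P3 := hUs.trans (Finset.erase_subset _ _)
  have haU : a ∉ U := fun h => by simpa using hUs h
  obtain ⟨r1, hr1, n1⟩ := pick Q1 [a] (by simp; omega)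
  obtain ⟨r2, hr2, n2⟩ := pick Q2 [a] (by simp; omega)
  obtain ⟨r3, hr3, n3⟩ := pick Q3 [a] (by simp; omega)
  simp at n1 n2 n3
  have hc : ((Q1 ∪ Q2 ∪ Q3).erase a).card ≥ 5 := by
    have := Finset.pred_card_le_card_erase (s := Q1 ∪ Q2 ∪ Q3) (a := a)
    rw [Finset.card_union_of_disjoint (by rw [Finset.disjoint_union_left]; exact ⟨d13, d23⟩),
      Finset.card_union_of_disjoint d12] at this
    omega
  obtain ⟨w, hw, hwP⟩ := Finset.exists_mem_notMem_of_card_lt_card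
    (show P2.card < ((Q1 ∪ Q2 ∪ Q3).erase a).card by omega)
  simp only [Finset.mem_erase, Finset.mem_union] at hw
  obtain ⟨hwa, hw⟩ := hw
  have F := star_fin P1 P2 P3 Q1 Q2 Q3 (by omega) a ha1 ha2 U hU hUP haU
  have D12 := Finset.disjoint_left.mp d12
  have D13 := Finset.disjoint_left.mp d13
  have D23 := Finset.disjoint_left.mp d23
  rcases hw with (hw | hw) | hw
  · by_cases hwU : w ∈ U
    · rcases ex_out Q2 Q3 U a w hq2 hq3 d23 hU hwU (D12 hw) (D13 hw) with
        ⟨z, hz, hza, hzU⟩ | ⟨z, hz, hza, hzU⟩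
      · exact F w z r3 hw hz hr3 hwa hza n3 (by tauto) (by tauto)
      · exact F w r2 z hw hr2 hz hwa n2 hza (by tauto) (by tauto)
    · exact F w r2 r3 hw hr2 hr3 hwa n2 n3 (by tauto) (by tauto)
  · by_cases hwU : w ∈ U
    · rcases ex_out Q1 Q3 U a w hq1 hq3 d13 hU hwU (fun h => D12 h hw) (D23 hw) with
        ⟨z, hz, hza, hzU⟩ | ⟨z, hz, hza, hzU⟩
      · exact F z w r3 hz hw hr3 hza hwa n3 (by tauto) (by tauto)
      · exact F r1 w z hr1 hw hz n1 hwa hza (by tauto) (by tauto)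
    · exact F r1 w r3 hr1 hw hr3 n1 hwa n3 (by tauto) (by tauto)
  · by_cases hwU : w ∈ U
    · rcases ex_out Q1 Q2 U a w hq1 hq2 d12 hU hwU (fun h => D13 h hw) (fun h => D23 h hw) with
        ⟨z, hz, hza, hzU⟩ | ⟨z, hz, hza, hzU⟩
      · exact F z r2 w hz hr2 hw hza n2 hwa (by tauto) (by tauto)
      · exact F r1 z w hr1 hz hw n1 hza hwa (by tauto) (by tauto)
    · exact F r1 r2 w hr1 hr2 hw n1 n2 hwa (by tauto) (by tauto)

theorem star_core (P1 P2 P3 Q1 Q2 Q3 : Finset ℕ) (h1 : 4 ≤ P1.card) (h2 : 4 ≤ P2.card)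
    (h3 : 4 ≤ P3.card) (hq1 : 2 ≤ Q1.card) (hq2 : 2 ≤ Q2.card) (hq3 : 2 ≤ Q3.card)
    (a : ℕ) (ha1 : a ∈ P1) (ha2 : a ∉ P2) :
    StarOK P1 P2 P3 Q1 Q2 Q3 := by
  have T := star_two P1 P2 P3 h1 h2 h3 a ha1 ha2
  obtain ⟨r1, hr1⟩ := Finset.card_pos.mp (show 0 < Q1.card by omega)
  obtain ⟨r2, hr2⟩ := Finset.card_pos.mp (show 0 < Q2.card by omega)
  obtain ⟨r3, hr3⟩ := Finset.card_pos.mp (show 0 < Q3.card by omega)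
  by_cases d12 : Disjoint Q1 Q2
  · by_cases d13 : Disjoint Q1 Q3
    · by_cases d23 : Disjoint Q2 Q3
      · obtain ⟨P2', s2, c2⟩ := Finset.exists_subset_card_eq h2
        obtain ⟨Q1', t1, c1⟩ := Finset.exists_subset_card_eq hq1
        obtain ⟨Q2', t2, e2⟩ := Finset.exists_subset_card_eq hq2
        obtain ⟨Q3', t3, e3⟩ := Finset.exists_subset_card_eq hq3
        obtain ⟨p1, m1, p2, m2, p3, m3, q1, l1, q2, l2, q3, l3, H⟩ :=
          star_disj P1 P2' P3 Q1' Q2' Q3' c2 h3 c1 e2 e3 (d12.mono t1 t2) (d13.mono t1 t3)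
            (d23.mono t2 t3) a ha1 (fun h => ha2 (s2 h))
        exact ⟨p1, m1, p2, s2 m2, p3, m3, q1, t1 l1, q2, t2 l2, q3, t3 l3, H⟩
      · obtain ⟨c, hc, hc'⟩ := Finset.not_disjoint_iff.mp d23
        obtain ⟨p1, m1, p2, m2, p3, m3, H⟩ := T c r1
        exact ⟨p1, m1, p2, m2, p3, m3, r1, hr1, c, hc, c, hc', by tauto⟩
    · obtain ⟨c, hc, hc'⟩ := Finset.not_disjoint_iff.mp d13
      obtain ⟨p1, m1, p2, m2, p3, m3, H⟩ := T c r2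
      exact ⟨p1, m1, p2, m2, p3, m3, c, hc, r2, hr2, c, hc', by tauto⟩
  · obtain ⟨c, hc, hc'⟩ := Finset.not_disjoint_iff.mp d12
    obtain ⟨p1, m1, p2, m2, p3, m3, H⟩ := T c r3
    exact ⟨p1, m1, p2, m2, p3, m3, c, hc, c, hc', r3, hr3, by tauto⟩

theorem star (P1 P2 P3 Q1 Q2 Q3 : Finset ℕ) (h1 : 4 ≤ P1.card) (h2 : 4 ≤ P2.card)
    (h3 : 4 ≤ P3.card) (hq1 : 2 ≤ Q1.card) (hq2 : 2 ≤ Q2.card) (hq3 : 2 ≤ Q3.card)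
    (h : P1 ≠ P2 ∨ 5 ≤ P2.card) : StarOK P1 P2 P3 Q1 Q2 Q3 := by
  by_cases hs : P1 ⊆ P2
  · by_cases hs' : P2 ⊆ P1
    · have he : P1 = P2 := hs.antisymm hs'
      have h5 : 5 ≤ P2.card := by tauto
      obtain ⟨a, ha⟩ := Finset.card_pos.mp (show 0 < P1.card by omega)
      obtain ⟨p1, m1, p2, m2, H⟩ := star_core P1 (P2.erase a) P3 Q1 Q2 Q3 h1
        (by have := Finset.pred_card_le_card_erase (s := P2) (a := a); omega) h3 hq1 hq2 hq3
        a ha (by simp)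
      exact ⟨p1, m1, p2, Finset.mem_of_mem_erase m2, H⟩
    · obtain ⟨a, ha, ha'⟩ := Finset.not_subset.mp hs'
      obtain ⟨p2, m2, p1, m1, p3, m3, q2, l2, q1, l1, q3, l3, H⟩ :=
        star_core P2 P1 P3 Q2 Q1 Q3 h2 h1 h3 hq2 hq1 hq3 a ha ha'
      exact ⟨p1, m1, p2, m2, p3, m3, q1, l1, q2, l2, q3, l3, by
        simp only [ne_eq] at H ⊢; rw [eq_comm (a := p1) (b := p2)]; tauto⟩
  · obtain ⟨a, ha, ha'⟩ := Finset.not_subset.mp hs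
    exact star_core P1 P2 P3 Q1 Q2 Q3 h1 h2 h3 hq1 hq2 hq3 a ha ha'

/-- choosing a color so that a later residual list differs from `P` -/
theorem choose_z (R P A : Finset ℕ) (k : ℕ) (hk : 1 ≤ k) (hR : 4 + k ≤ R.card) (hA : k < A.card) :
    ∃ z ∈ A, ∀ X : Finset ℕ, X.card + 1 ≤ k → R \ insert z X ≠ P ∨ 5 ≤ P.card := by
  by_cases hc : (R \ P).card ≤ k
  · obtain ⟨z, hz, hz'⟩ := Finset.exists_mem_notMem_of_card_lt_card
      (show (R \ P).card < A.card by omega)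
    refine ⟨z, hz, fun X hX => ?_⟩
    by_cases he : R \ insert z X = P
    · right
      have hzR : z ∉ R := by
        intro h
        apply hz'
        rw [Finset.mem_sdiff]
        refine ⟨h, ?_⟩
        rw [← he]; simp
      have : R \ insert z X = R \ X := by ext t; simp; grind
      rw [← he, this]
      have := Finset.le_card_sdiff X R
      omega
    · exact Or.inl he
  · obtain ⟨z, hz⟩ := Finset.card_pos.mp (show 0 < A.card by omega)
    refine ⟨z, hz, fun X hX => Or.inl fun he => hc ?_⟩
    have : R \ P ⊆ insert z X := by
      intro t; rw [← he]; simp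
    have := Finset.card_le_card this
    have := Finset.card_insert_le z X
    omega

end IncAux

namespace IncAux

open Multigraph

variable {V E : Type*}

/-- partial coloring on the edges in `C` -/
def Col (G : Multigraph V E) (L : V × E → Finset ℕ) (C : Finset E) (φ : V × E → ℕ) : Prop :=
  (∀ v e, e ∈ C → v ∈ G.ends e → φ (v, e) ∈ L (v, e)) ∧
  (∀ v e w f, e ∈ C → f ∈ C → v ∈ G.ends e → w ∈ G.ends f → (v, e) ≠ (w, f) →
    G.IncAdj v e w f → φ (v, e) ≠ φ (w, f))

open Classical in
/-- edges of `C` at `v` -/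
noncomputable def del (G : Multigraph V E) (C : Finset E) (v : V) : Finset E :=
  C.filter (fun e => v ∈ G.ends e)

open Classical in
/-- forbidden colors -/
noncomputable def N (G : Multigraph V E) (C : Finset E) (φ : V × E → ℕ) (v w : V) : Finset ℕ :=
  ((del G C v).biUnion (fun f => (G.ends f).toFinset.image (fun x => φ (x, f)))) ∪
    (del G C w).image (fun f => φ (w, f))

/-- available colors -/
noncomputable def av (G : Multigraph V E) (L : V × E → Finset ℕ) (C : Finset E) (φ : V × E → ℕ)
    (v w : V) (e : E) : Finset ℕ := L (v, e) \ N G C φ v w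

theorem mem_del {G : Multigraph V E} {C : Finset E} {v : V} {e : E} :
    e ∈ del G C v ↔ e ∈ C ∧ v ∈ G.ends e := by simp [del]

theorem mem_N {G : Multigraph V E} {C : Finset E} {φ : V × E → ℕ} {v w : V} {c : ℕ} :
    c ∈ N G C φ v w ↔ (∃ f x, f ∈ C ∧ v ∈ G.ends f ∧ x ∈ G.ends f ∧ φ (x, f) = c) ∨
      (∃ f, f ∈ C ∧ w ∈ G.ends f ∧ φ (w, f) = c) := by
  simp only [N, Finset.mem_union, Finset.mem_biUnion, Finset.mem_image, mem_del,
    Sym2.mem_toFinset]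
  constructor
  · rintro (⟨f, ⟨h1, h2⟩, x, h3, h4⟩ | ⟨f, ⟨h1, h2⟩, h3⟩)
    · exact Or.inl ⟨f, x, h1, h2, h3, h4⟩
    · exact Or.inr ⟨f, h1, h2, h3⟩
  · rintro (⟨f, x, h1, h2, h3, h4⟩ | ⟨f, h1, h2, h3⟩)
    · exact Or.inl ⟨f, ⟨h1, h2⟩, x, h3, h4⟩
    · exact Or.inr ⟨f, ⟨h1, h2⟩, h3⟩

theorem toFin_card [DecidableEq V] (z : Sym2 V) : z.toFinset.card ≤ 2 := by
  rw [Sym2.card_toFinset]; split_ifs <;> omega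

theorem N_card (G : Multigraph V E) (C : Finset E) (φ : V × E → ℕ) (v w : V) :
    (N G C φ v w).card ≤ 2 * (del G C v).card + (del G C w).card := by
  classical
  unfold N
  refine (Finset.card_union_le _ _).trans (add_le_add ?_ Finset.card_image_le)
  rw [mul_comm]
  exact Finset.card_biUnion_le_card_mul _ _ _ fun f _ => Finset.card_image_le.trans (toFin_card _)

theorem av_card (G : Multigraph V E) (L : V × E → Finset ℕ) (C : Finset E) (φ : V × E → ℕ)
    (v w : V) (e : E) (hL : (L (v, e)).card = 6) :
    6 ≤ (av G L C φ v w e).card + 2 * (del G C v).card + (del G C w).card := by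
  have h1 := N_card G C φ v w
  have h2 := Finset.le_card_sdiff (N G C φ v w) (L (v, e))
  unfold av
  omega

theorem adj_N {G : Multigraph V E} {C : Finset E} {φ : V × E → ℕ} {v w x : V} {e f : E}
    (he : G.ends e = s(v, w)) (heC : e ∉ C) (hf : f ∈ C) (hx : x ∈ G.ends f)
    (h : G.IncAdj v e x f) : φ (x, f) ∈ N G C φ v w := by
  rw [mem_N]
  rcases h with h | h | h | h
  · subst h; exact Or.inl ⟨f, v, hf, hx, hx, rfl⟩
  · subst h; exact absurd hf heC
  · rw [he] at h
    have : w = x := by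
      rw [Sym2.eq_iff] at h
      rcases h with ⟨_, h⟩ | ⟨h, h'⟩
      · exact h
      · rw [← h, ← h']
    subst this
    exact Or.inr ⟨f, hf, hx, rfl⟩
  · exact Or.inl ⟨f, x, hf, by rw [h]; simp, hx, rfl⟩

theorem adj_symm {G : Multigraph V E} {v w : V} {e f : E} (h : G.IncAdj v e w f) :
    G.IncAdj w f v e := by
  unfold IncAdj at *
  rw [Sym2.eq_swap (a := w) (b := v)]
  rcases h with h | h | h | h
  · exact Or.inl h.symm
  · exact Or.inr (Or.inl h.symm)
  · exact Or.inr (Or.inr (Or.inr h))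
  · exact Or.inr (Or.inr (Or.inl h))

/-- compatibility of two colored incidences -/
def Cmp (G : Multigraph V E) (s t : (V × E) × ℕ) : Prop :=
  s.1 ≠ t.1 ∧ (G.IncAdj s.1.1 s.1.2 t.1.1 t.1.2 → s.2 ≠ t.2)

theorem extend {G : Multigraph V E} {L : V × E → Finset ℕ} {C : Finset E} {φ : V × E → ℕ}
    (hC : Col G L C φ) (C' : Finset E) (l : List ((V × E) × ℕ))
    (hl : ∀ t ∈ l, t.1.2 ∉ C ∧
      ∃ w, G.ends t.1.2 = s(t.1.1, w) ∧ t.2 ∈ av G L C φ t.1.1 w t.1.2)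
    (hp : l.Pairwise (Cmp G))
    (hC' : ∀ e ∈ C', e ∈ C ∨ ∀ v ∈ G.ends e, ∃ c, ((v, e), c) ∈ l) :
    ∃ φ', Col G L C' φ' ∧ (∀ t ∈ l, φ' t.1 = t.2) ∧ ∀ v e, e ∈ C → φ' (v, e) = φ (v, e) := by
  classical
  have hpp : ∀ s ∈ l, ∀ t ∈ l, s ≠ t → Cmp G s t := by
    intro s hs t ht hst
    have : Std.Symm (Cmp G) := ⟨fun a b hab =>
      ⟨hab.1.symm, fun h => (hab.2 (adj_symm h)).symm⟩⟩
    exact hp.forall hs ht hst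
  let φ' : V × E → ℕ := fun x => if h : ∃ c, (x, c) ∈ l then h.choose else φ x
  have h1 : ∀ t ∈ l, φ' t.1 = t.2 := by
    intro t ht
    have hex : ∃ c, (t.1, c) ∈ l := ⟨t.2, ht⟩
    have : φ' t.1 = hex.choose := dif_pos hex
    rw [this]
    by_contra hne
    exact (hpp _ hex.choose_spec t ht (fun h => hne (congrArg Prod.snd h))).1 rfl
  have h2 : ∀ v e, e ∈ C → φ' (v, e) = φ (v, e) := by
    intro v e he
    refine dif_neg ?_
    rintro ⟨c, hc⟩
    exact (hl _ hc).1 he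
  refine ⟨φ', ⟨?_, ?_⟩, h1, h2⟩
  · intro v e he hv
    by_cases heC : e ∈ C
    · rw [h2 v e heC]; exact hC.1 v e heC hv
    · obtain ⟨c, hc⟩ := (hC' e he).resolve_left heC v hv
      rw [h1 _ hc]
      obtain ⟨_, w, _, h⟩ := hl _ hc
      exact (Finset.mem_sdiff.mp h).1
  · intro v e w f he hf hv hw hne hadj
    by_cases heC : e ∈ C
    · by_cases hfC : f ∈ C
      · rw [h2 v e heC, h2 w f hfC]; exact hC.2 v e w f heC hfC hv hw hne hadj
      · obtain ⟨c, hc⟩ := (hC' f hf).resolve_left hfC w hw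
        rw [h1 _ hc, h2 v e heC]
        obtain ⟨_, x, hx, h⟩ := hl _ hc
        intro heq
        apply (Finset.mem_sdiff.mp h).2
        have := adj_N (φ := φ) hx hfC heC hv (adj_symm hadj)
        rw [heq] at this
        exact this
    · obtain ⟨c, hc⟩ := (hC' e he).resolve_left heC v hv
      rw [h1 _ hc]
      by_cases hfC : f ∈ C
      · rw [h2 w f hfC]
        obtain ⟨_, x, hx, h⟩ := hl _ hc
        intro heq
        apply (Finset.mem_sdiff.mp h).2
        have := adj_N (φ := φ) hx heC hfC hw hadj
        rw [← heq] at this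
        exact this
      · obtain ⟨d, hd⟩ := (hC' f hf).resolve_left hfC w hw
        rw [h1 _ hd]
        refine (hpp _ hc _ hd ?_).2 hadj
        intro h
        apply hne
        exact congrArg Prod.fst h

theorem delc [DecidableEq E] {G : Multigraph V E} {S F0 : Finset E} (F : Finset E) {x : V}
    (hF : F ⊆ F0) (hF2 : ∀ f ∈ F, f ∈ S ∧ x ∈ G.ends f) :
    (del G (S \ F0) x).card + F.card ≤ (del G S x).card := by
  have hd : Disjoint (del G (S \ F0) x) F := by
    rw [Finset.disjoint_left]
    intro f hf hfF
    rw [mem_del, Finset.mem_sdiff] at hf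
    exact hf.1.2 (hF hfF)
  rw [← Finset.card_union_of_disjoint hd]
  apply Finset.card_le_card
  intro f hf
  rw [mem_del]
  rcases Finset.mem_union.mp hf with hf | hf
  · rw [mem_del, Finset.mem_sdiff] at hf
    exact ⟨hf.1.1, hf.2⟩
  · exact hF2 f hf

/-- coloring one more edge -/
theorem case_one [DecidableEq E] {G : Multigraph V E} {L : V × E → Finset ℕ} {S : Finset E}
    {φ : V × E → ℕ} {e : E} {u v : V} (hC : Col G L (S \ {e}) φ)
    (he : G.ends e = s(u, v)) (huv : u ≠ v)
    (h1 : 2 ≤ (av G L (S \ {e}) φ u v e).card) (h2 : 1 ≤ (av G L (S \ {e}) φ v u e).card) :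
    ∃ φ', Col G L S φ' := by
  obtain ⟨c, hc⟩ := Finset.card_pos.mp h2
  obtain ⟨d, hd, hdc⟩ := pick _ [c] (show [c].length < _ from h1)
  have he' : G.ends e = s(v, u) := by rw [he, Sym2.eq_swap]
  obtain ⟨φ', h, _⟩ := extend hC S [((u, e), d), ((v, e), c)]
    (by
      simp only [List.forall_mem_cons]
      refine ⟨⟨by simp, v, he, hd⟩, ⟨by simp, u, he', hc⟩, by simp⟩)
    (by
      simp only [List.mem_singleton] at hdc
      simp [Cmp, huv, hdc])
    (by
      intro f hf
      by_cases hfe : f = e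
      · right
        subst hfe
        intro w hw
        rw [he, Sym2.mem_iff] at hw
        rcases hw with rfl | rfl
        · exact ⟨d, by simp⟩
        · exact ⟨c, by simp⟩
      · left; simp [hf, hfe])
  exact ⟨φ', h⟩

theorem star_ext [DecidableEq E] {G : Multigraph V E} {L : V × E → Finset ℕ} {S : Finset E}
    (hL : ∀ v e, v ∈ G.ends e → (L (v, e)).card = 6) (hdeg : ∀ v, (del G S v).card ≤ 3)
    {φ : V × E → ℕ} {f1 f2 f3 : E} {u x1 x2 x3 : V}
    (s1 : f1 ∈ S) (s2 : f2 ∈ S) (s3 : f3 ∈ S) (n12 : f1 ≠ f2) (n13 : f1 ≠ f3) (n23 : f2 ≠ f3)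
    (e1 : G.ends f1 = s(u, x1)) (e2 : G.ends f2 = s(u, x2)) (e3 : G.ends f3 = s(u, x3))
    (m12 : x1 ≠ x2) (m13 : x1 ≠ x3) (m23 : x2 ≠ x3) (u1 : u ≠ x1) (u2 : u ≠ x2) (u3 : u ≠ x3)
    (hC : Col G L (S \ {f1, f2, f3}) φ)
    (hne : av G L (S \ {f1, f2, f3}) φ u x1 f1 ≠ av G L (S \ {f1, f2, f3}) φ u x2 f2 ∨
      5 ≤ (av G L (S \ {f1, f2, f3}) φ u x2 f2).card) :
    ∃ φ', Col G L S φ' := by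
  set C := S \ {f1, f2, f3} with hCdef
  have du : (del G C u).card = 0 := by
    have := delc (G := G) (S := S) (F0 := {f1, f2, f3}) {f1, f2, f3} (x := u) subset_rfl (by
      intro f hf; simp at hf; rcases hf with rfl | rfl | rfl <;> simp [*])
    rw [Finset.card_eq_three.mpr ⟨f1, f2, f3, n12, n13, n23, rfl⟩] at this
    have := hdeg u
    rw [hCdef]
    omega
  have dx : ∀ f x, f ∈ ({f1, f2, f3} : Finset E) → f ∈ S → x ∈ G.ends f →
      (del G C x).card ≤ 2 := by
    intro f x hf hS hx
    have := delc (G := G) (S := S) (F0 := {f1, f2, f3}) {f} (x := x) (by simpa using hf) (by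
      intro f hf; simp at hf; subst hf; exact ⟨hS, hx⟩)
    rw [Finset.card_singleton] at this
    have := hdeg x
    rw [hCdef]
    omega
  have d1 := dx f1 x1 (by simp) s1 (by simp [e1])
  have d2 := dx f2 x2 (by simp) s2 (by simp [e2])
  have d3 := dx f3 x3 (by simp) s3 (by simp [e3])
  have e1' : G.ends f1 = s(x1, u) := by rw [e1, Sym2.eq_swap]
  have e2' : G.ends f2 = s(x2, u) := by rw [e2, Sym2.eq_swap]
  have e3' : G.ends f3 = s(x3, u) := by rw [e3, Sym2.eq_swap]
  have a1 := av_card G L C φ u x1 f1 (hL _ _ (by simp [e1]))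
  have a2 := av_card G L C φ u x2 f2 (hL _ _ (by simp [e2]))
  have a3 := av_card G L C φ u x3 f3 (hL _ _ (by simp [e3]))
  have b1 := av_card G L C φ x1 u f1 (hL _ _ (by simp [e1]))
  have b2 := av_card G L C φ x2 u f2 (hL _ _ (by simp [e2]))
  have b3 := av_card G L C φ x3 u f3 (hL _ _ (by simp [e3]))
  obtain ⟨p1, hp1, p2, hp2, p3, hp3, q1, hq1, q2, hq2, q3, hq3, H⟩ :=
    star (av G L C φ u x1 f1) (av G L C φ u x2 f2) (av G L C φ u x3 f3)
      (av G L C φ x1 u f1) (av G L C φ x2 u f2) (av G L C φ x3 u f3)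
      (by omega) (by omega) (by omega) (by omega) (by omega) (by omega) hne
  obtain ⟨φ', h, _⟩ := extend hC S [((u, f1), p1), ((u, f2), p2), ((u, f3), p3),
      ((x1, f1), q1), ((x2, f2), q2), ((x3, f3), q3)]
    (by
      simp only [List.forall_mem_cons]
      refine ⟨⟨by simp [C], x1, e1, hp1⟩, ⟨by simp [C], x2, e2, hp2⟩, ⟨by simp [C], x3, e3, hp3⟩,
        ⟨by simp [C], u, e1', hq1⟩, ⟨by simp [C], u, e2', hq2⟩, ⟨by simp [C], u, e3', hq3⟩, by simp⟩)
    (by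
      have H' := H
      simp only [List.pairwise_cons, List.forall_mem_cons, Cmp, IncAdj, e1, e2, e3, Sym2.eq_iff]
      simp
      grind)
    (by
      intro f hf
      by_cases hfe : f = f1 ∨ f = f2 ∨ f = f3
      · right
        intro w hw
        rcases hfe with rfl | rfl | rfl
        · rw [e1, Sym2.mem_iff] at hw
          rcases hw with rfl | rfl
          · exact ⟨p1, by simp⟩
          · exact ⟨q1, by simp⟩
        · rw [e2, Sym2.mem_iff] at hw
          rcases hw with rfl | rfl
          · exact ⟨p2, by simp⟩
          · exact ⟨q2, by simp⟩
        · rw [e3, Sym2.mem_iff] at hw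
          rcases hw with rfl | rfl
          · exact ⟨p3, by simp⟩
          · exact ⟨q3, by simp⟩
      · left; simpa [C, hf] using hfe)
  exact ⟨φ', h⟩

end IncAux

namespace IncAux

open Multigraph

variable {V E : Type*}

theorem N_congr {G : Multigraph V E} {C C' : Finset E} {φ φ' : V × E → ℕ} {u x : V}
    (hC : ∀ f, (u ∈ G.ends f ∨ x ∈ G.ends f) → (f ∈ C' ↔ f ∈ C))
    (hφ : ∀ v f, f ∈ C → φ' (v, f) = φ (v, f)) : N G C' φ' u x = N G C φ u x := by
  ext c
  rw [mem_N, mem_N]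
  constructor
  · rintro (⟨f, y, h1, h2, h3, h4⟩ | ⟨f, h1, h2, h3⟩)
    · have := (hC f (Or.inl h2)).1 h1
      exact Or.inl ⟨f, y, this, h2, h3, by rw [← hφ y f this, h4]⟩
    · have := (hC f (Or.inr h2)).1 h1
      exact Or.inr ⟨f, this, h2, by rw [← hφ x f this, h3]⟩
  · rintro (⟨f, y, h1, h2, h3, h4⟩ | ⟨f, h1, h2, h3⟩)
    · exact Or.inl ⟨f, y, (hC f (Or.inl h2)).2 h1, h2, h3, by rw [hφ y f h1, h4]⟩
    · exact Or.inr ⟨f, (hC f (Or.inr h2)).2 h1, h2, by rw [hφ x f h1, h3]⟩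

/-- triangle case -/
theorem tri_ext [DecidableEq E] {G : Multigraph V E} {L : V × E → Finset ℕ} {S : Finset E}
    (hL : ∀ v e, v ∈ G.ends e → (L (v, e)).card = 6) (hdeg : ∀ v, (del G S v).card ≤ 3)
    {φ : V × E → ℕ} {e f k g : E} {u v x y : V}
    (se : e ∈ S) (sf : f ∈ S) (sk : k ∈ S) (sg : g ∈ S)
    (nef : e ≠ f) (nek : e ≠ k) (nfk : f ≠ k) (neg : e ≠ g) (nfg : f ≠ g) (nkg : k ≠ g)
    (ee : G.ends e = s(u, v)) (ef : G.ends f = s(u, x)) (ek : G.ends k = s(u, y))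
    (eg : G.ends g = s(v, x))
    (uv : u ≠ v) (ux : u ≠ x) (uy : u ≠ y) (vx : v ≠ x) (vy : v ≠ y) (xy : x ≠ y)
    (hC : Col G L (S \ {e, f, k, g}) φ) : ∃ φ', Col G L S φ' := by
  have eg' : G.ends g = s(x, v) := by rw [eg, Sym2.eq_swap]
  have hu : (del G (S \ {e, f, k, g}) u).card = 0 := by
    have := delc (G := G) (S := S) (F0 := {e, f, k, g}) {e, f, k} (x := u) (by grind) (by
      intro f hf; simp at hf; rcases hf with rfl | rfl | rfl <;> simp [*])
    rw [Finset.card_eq_three.mpr ⟨e, f, k, nef, nek, nfk, rfl⟩] at this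
    have := hdeg u
    omega
  have hv : (del G (S \ {e, f, k, g}) v).card ≤ 1 := by
    have := delc (G := G) (S := S) (F0 := {e, f, k, g}) {e, g} (x := v) (by grind) (by
      intro f hf; simp at hf; rcases hf with rfl | rfl <;> simp [*])
    rw [Finset.card_pair neg] at this
    have := hdeg v
    omega
  have hx : (del G (S \ {e, f, k, g}) x).card ≤ 1 := by
    have := delc (G := G) (S := S) (F0 := {e, f, k, g}) {f, g} (x := x) (by grind) (by
      intro f hf; simp at hf; rcases hf with rfl | rfl <;> simp [*])
    rw [Finset.card_pair nfg] at this
    have := hdeg x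
    omega
  set C := S \ {e, f, k, g} with hCdef
  have a1 := av_card G L C φ v x g (hL _ _ (by simp [eg]))
  have a2 := av_card G L C φ x v g (hL _ _ (by simp [eg]))
  have a3 := av_card G L C φ u v e (hL _ _ (by simp [ee]))
  obtain ⟨z, hz, hzX⟩ := choose_z (av G L C φ u v e) (av G L C φ u y k) (av G L C φ v x g) 1
    le_rfl (by omega) (by omega)
  obtain ⟨t, ht, htz⟩ := pick (av G L C φ x v g) [z] (by simp; omega)
  simp only [List.mem_singleton] at htz
  obtain ⟨φ', h, h1, h2⟩ := extend hC (S \ {e, k, f}) [((v, g), z), ((x, g), t)]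
    (by
      simp only [List.forall_mem_cons]
      refine ⟨⟨by simp [C], x, eg, hz⟩, ⟨by simp [C], v, eg', ht⟩, by simp⟩)
    (by simp [Cmp, vx, Ne.symm htz])
    (by
      intro j hj
      by_cases hjg : j = g
      · right
        subst hjg
        intro w hw
        rw [eg, Sym2.mem_iff] at hw
        rcases hw with rfl | rfl
        · exact ⟨z, by simp⟩
        · exact ⟨t, by simp⟩
      · left; simp [C] at hj ⊢; tauto)
  have hvg : φ' (v, g) = z := h1 ((v, g), z) (by simp)
  refine star_ext hL hdeg se sk sf nek nef nfk.symm ee ek ef vy vx xy.symm uv uy ux h ?_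
  have r1 : av G L (S \ {e, k, f}) φ' u y k = av G L C φ u y k := by
    unfold av
    rw [N_congr (C := C) (φ := φ) ?_ h2]
    intro j hj
    have hjg : j ≠ g := by
      rintro rfl
      rw [eg, Sym2.mem_iff, Sym2.mem_iff] at hj
      grind
    simp [C]; tauto
  have r2 : av G L (S \ {e, k, f}) φ' u v e = av G L C φ u v e \ insert z ∅ := by
    ext c
    unfold av
    rw [Finset.mem_sdiff, Finset.mem_sdiff, Finset.mem_sdiff, mem_N, mem_N, Finset.mem_insert]
    simp only [Finset.notMem_empty, or_false]
    have : ∀ j, j ∈ S \ {e, k, f} ↔ j ∈ C ∨ j = g := by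
      intro j; simp [C]; grind
    simp only [this]
    constructor
    · rintro ⟨hc, hn⟩
      push Not at hn
      refine ⟨⟨hc, ?_⟩, ?_⟩
      · rintro (⟨j, w, q1, q2, q3, q4⟩ | ⟨j, q1, q2, q3⟩)
        · exact hn.1 j w (Or.inl q1) q2 q3 (by rw [h2 _ _ q1, q4])
        · exact hn.2 j (Or.inl q1) q2 (by rw [h2 _ _ q1, q3])
      · rintro rfl
        exact hn.2 g (Or.inr rfl) (by simp [eg]) hvg
    · rintro ⟨⟨hc, hn⟩, hcz⟩
      push Not at hn
      refine ⟨hc, ?_⟩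
      rintro (⟨j, w, q1, q2, q3, q4⟩ | ⟨j, q1, q2, q3⟩)
      · rcases q1 with q1 | rfl
        · exact hn.1 j w q1 q2 q3 (by rw [← h2 _ _ q1, q4])
        · rw [eg, Sym2.mem_iff] at q2; tauto
      · rcases q1 with q1 | rfl
        · exact hn.2 j q1 q2 (by rw [← h2 _ _ q1, q3])
        · exact hcz (by rw [← q3, hvg])
  rw [r1, r2]
  exact hzX ∅ (by simp)

/-- generic case -/
theorem gen_ext [DecidableEq E] {G : Multigraph V E} {L : V × E → Finset ℕ} {S : Finset E}
    (hL : ∀ v e, v ∈ G.ends e → (L (v, e)).card = 6) (hdeg : ∀ v, (del G S v).card ≤ 3)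
    {φ : V × E → ℕ} {e f k g j : E} {u v x y a b : V}
    (se : e ∈ S) (sf : f ∈ S) (sk : k ∈ S) (sg : g ∈ S) (sj : j ∈ S)
    (nef : e ≠ f) (nek : e ≠ k) (nfk : f ≠ k) (neg : e ≠ g) (nfg : f ≠ g) (nkg : k ≠ g)
    (nej : e ≠ j) (nfj : f ≠ j) (nkj : k ≠ j) (ngj : g ≠ j)
    (ee : G.ends e = s(u, v)) (ef : G.ends f = s(u, x)) (ek : G.ends k = s(u, y))
    (eg : G.ends g = s(v, a)) (ej : G.ends j = s(v, b))
    (uv : u ≠ v) (ux : u ≠ x) (uy : u ≠ y) (vx : v ≠ x) (vy : v ≠ y) (xy : x ≠ y)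
    (va : v ≠ a) (vb : v ≠ b) (ab : a ≠ b) (ua : u ≠ a) (ub : u ≠ b)
    (xa : x ≠ a) (xb : x ≠ b)
    (hC : Col G L (S \ {e, f, k, g, j}) φ) : ∃ φ', Col G L S φ' := by
  have eg' : G.ends g = s(a, v) := by rw [eg, Sym2.eq_swap]
  have ej' : G.ends j = s(b, v) := by rw [ej, Sym2.eq_swap]
  have hu : (del G (S \ {e, f, k, g, j}) u).card = 0 := by
    have := delc (G := G) (S := S) (F0 := {e, f, k, g, j}) {e, f, k} (x := u) (by grind) (by
      intro f hf; simp at hf; rcases hf with rfl | rfl | rfl <;> simp [*])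
    rw [Finset.card_eq_three.mpr ⟨e, f, k, nef, nek, nfk, rfl⟩] at this
    have := hdeg u
    omega
  have hv : (del G (S \ {e, f, k, g, j}) v).card = 0 := by
    have := delc (G := G) (S := S) (F0 := {e, f, k, g, j}) {e, g, j} (x := v) (by grind) (by
      intro f hf; simp at hf; rcases hf with rfl | rfl | rfl <;> simp [*])
    rw [Finset.card_eq_three.mpr ⟨e, g, j, neg, nej, ngj, rfl⟩] at this
    have := hdeg v
    omega
  have ha : (del G (S \ {e, f, k, g, j}) a).card ≤ 2 := by
    have := delc (G := G) (S := S) (F0 := {e, f, k, g, j}) {g} (x := a) (by grind) (by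
      intro f hf; simp at hf; subst hf; simp [*])
    rw [Finset.card_singleton] at this
    have := hdeg a
    omega
  have hb : (del G (S \ {e, f, k, g, j}) b).card ≤ 2 := by
    have := delc (G := G) (S := S) (F0 := {e, f, k, g, j}) {j} (x := b) (by grind) (by
      intro f hf; simp at hf; subst hf; simp [*])
    rw [Finset.card_singleton] at this
    have := hdeg b
    omega
  set C := S \ {e, f, k, g, j} with hCdef
  have a1 := av_card G L C φ v a g (hL _ _ (by simp [eg]))
  have a2 := av_card G L C φ a v g (hL _ _ (by simp [eg]))
  have a3 := av_card G L C φ v b j (hL _ _ (by simp [ej]))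
  have a4 := av_card G L C φ b v j (hL _ _ (by simp [ej]))
  have a5 := av_card G L C φ u v e (hL _ _ (by simp [ee]))
  obtain ⟨z, hz, hzX⟩ := choose_z (av G L C φ u v e) (av G L C φ u x f) (av G L C φ v a g) 2
    (by omega) (by omega) (by omega)
  obtain ⟨q, hq, hqz⟩ := pick (av G L C φ a v g) [z] (by simp; omega)
  obtain ⟨q', hq', hqz'⟩ := pick (av G L C φ b v j) [z] (by simp; omega)
  obtain ⟨p, hp, hpz⟩ := pick (av G L C φ v b j) [z, q, q'] (by simp; omega)
  simp at hqz hqz' hpz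
  obtain ⟨φ', h, h1, h2⟩ := extend hC (S \ {e, f, k})
    [((v, g), z), ((a, g), q), ((v, j), p), ((b, j), q')]
    (by
      simp only [List.forall_mem_cons]
      refine ⟨⟨by simp [C], a, eg, hz⟩, ⟨by simp [C], v, eg', hq⟩,
        ⟨by simp [C], b, ej, hp⟩, ⟨by simp [C], v, ej', hq'⟩, by simp⟩)
    (by
      simp only [List.pairwise_cons, List.forall_mem_cons, Cmp, IncAdj, eg, ej, Sym2.eq_iff]
      simp
      grind)
    (by
      intro i hi
      by_cases hjg : i = g
      · right
        subst hjg
        intro w hw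
        rw [eg, Sym2.mem_iff] at hw
        rcases hw with rfl | rfl
        · exact ⟨z, by simp⟩
        · exact ⟨q, by simp⟩
      · by_cases hjj : i = j
        · right
          subst hjj
          intro w hw
          rw [ej, Sym2.mem_iff] at hw
          rcases hw with rfl | rfl
          · exact ⟨p, by simp⟩
          · exact ⟨q', by simp⟩
        · left; simp [C] at hi ⊢; tauto)
  have hvg : φ' (v, g) = z := h1 ((v, g), z) (by simp)
  have hvj : φ' (v, j) = p := h1 ((v, j), p) (by simp)
  refine star_ext hL hdeg se sf sk nef nek nfk ee ef ek vx vy xy uv ux uy h ?_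
  have r1 : av G L (S \ {e, f, k}) φ' u x f = av G L C φ u x f := by
    unfold av
    rw [N_congr (C := C) (φ := φ) ?_ h2]
    intro i hi
    have hjg : i ≠ g := by
      rintro rfl
      rw [eg, Sym2.mem_iff, Sym2.mem_iff] at hi
      grind
    have hjj : i ≠ j := by
      rintro rfl
      rw [ej, Sym2.mem_iff, Sym2.mem_iff] at hi
      grind
    simp [C]; tauto
  have r2 : av G L (S \ {e, f, k}) φ' u v e = av G L C φ u v e \ insert z {p} := by
    ext c
    unfold av
    rw [Finset.mem_sdiff, Finset.mem_sdiff, Finset.mem_sdiff, mem_N, mem_N, Finset.mem_insert,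
      Finset.mem_singleton]
    have : ∀ i, i ∈ S \ {e, f, k} ↔ i ∈ C ∨ i = g ∨ i = j := by
      intro i; simp [C]; grind
    simp only [this]
    constructor
    · rintro ⟨hc, hn⟩
      push Not at hn
      refine ⟨⟨hc, ?_⟩, ?_⟩
      · rintro (⟨j, w, q1, q2, q3, q4⟩ | ⟨j, q1, q2, q3⟩)
        · exact hn.1 j w (Or.inl q1) q2 q3 (by rw [h2 _ _ q1, q4])
        · exact hn.2 j (Or.inl q1) q2 (by rw [h2 _ _ q1, q3])
      · rintro (rfl | rfl)
        · exact hn.2 g (Or.inr (Or.inl rfl)) (by simp [eg]) hvg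
        · exact hn.2 j (Or.inr (Or.inr rfl)) (by simp [ej]) hvj
    · rintro ⟨⟨hc, hn⟩, hcz⟩
      push Not at hn
      refine ⟨hc, ?_⟩
      rintro (⟨i, w, q1, q2, q3, q4⟩ | ⟨i, q1, q2, q3⟩)
      · rcases q1 with q1 | rfl | rfl
        · exact hn.1 i w q1 q2 q3 (by rw [← h2 _ _ q1, q4])
        · rw [eg, Sym2.mem_iff] at q2; tauto
        · rw [ej, Sym2.mem_iff] at q2; tauto
      · rcases q1 with q1 | rfl | rfl
        · exact hn.2 i q1 q2 (by rw [← h2 _ _ q1, q3])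
        · exact hcz (by rw [← q3, hvg]; simp)
        · exact hcz (by rw [← q3, hvj]; simp)
  rw [r1, r2]
  exact hzX {p} (by simp)

/-- parallel edges -/
theorem par_ext [DecidableEq E] {G : Multigraph V E} {L : V × E → Finset ℕ} {S : Finset E}
    (hL : ∀ v e, v ∈ G.ends e → (L (v, e)).card = 6) (hdeg : ∀ v, (del G S v).card ≤ 3)
    {φ : V × E → ℕ} {e f g j : E} {u v x y : V}
    (se : e ∈ S) (sf : f ∈ S) (sg : g ∈ S) (sj : j ∈ S)
    (nef : e ≠ f) (neg : e ≠ g) (nfg : f ≠ g)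
    (nej : e ≠ j) (nfj : f ≠ j) (ngj : g ≠ j)
    (ee : G.ends e = s(u, v)) (ef : G.ends f = s(u, v))
    (eg : G.ends g = s(u, x)) (ej : G.ends j = s(v, y))
    (uv : u ≠ v) (ux : u ≠ x) (vx : v ≠ x) (uy : u ≠ y) (vy : v ≠ y)
    (hC : Col G L (S \ {e, f, g, j}) φ) : ∃ φ', Col G L S φ' := by
  have ee' : G.ends e = s(v, u) := by rw [ee, Sym2.eq_swap]
  have ef' : G.ends f = s(v, u) := by rw [ef, Sym2.eq_swap]
  have eg' : G.ends g = s(x, u) := by rw [eg, Sym2.eq_swap]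
  have ej' : G.ends j = s(y, v) := by rw [ej, Sym2.eq_swap]
  have hu : (del G (S \ {e, f, g, j}) u).card = 0 := by
    have := delc (G := G) (S := S) (F0 := {e, f, g, j}) {e, f, g} (x := u) (by grind) (by
      intro f hf; simp at hf; rcases hf with rfl | rfl | rfl <;> simp [*])
    rw [Finset.card_eq_three.mpr ⟨e, f, g, nef, neg, nfg, rfl⟩] at this
    have := hdeg u
    omega
  have hv : (del G (S \ {e, f, g, j}) v).card = 0 := by
    have := delc (G := G) (S := S) (F0 := {e, f, g, j}) {e, f, j} (x := v) (by grind) (by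
      intro f hf; simp at hf; rcases hf with rfl | rfl | rfl <;> simp [*])
    rw [Finset.card_eq_three.mpr ⟨e, f, j, nef, nej, nfj, rfl⟩] at this
    have := hdeg v
    omega
  have hx : (del G (S \ {e, f, g, j}) x).card ≤ 2 := by
    have := delc (G := G) (S := S) (F0 := {e, f, g, j}) {g} (x := x) (by grind) (by
      intro f hf; simp at hf; subst hf; simp [*])
    rw [Finset.card_singleton] at this
    have := hdeg x
    omega
  have hy : (del G (S \ {e, f, g, j}) y).card ≤ 2 := by
    have := delc (G := G) (S := S) (F0 := {e, f, g, j}) {j} (x := y) (by grind) (by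
      intro f hf; simp at hf; subst hf; simp [*])
    rw [Finset.card_singleton] at this
    have := hdeg y
    omega
  have hxy : x = y → (del G (S \ {e, f, g, j}) x).card ≤ 1 ∧
      (del G (S \ {e, f, g, j}) y).card ≤ 1 := by
    rintro rfl
    have := delc (G := G) (S := S) (F0 := {e, f, g, j}) {g, j} (x := x) (by grind) (by
      intro f hf; simp at hf; rcases hf with rfl | rfl <;> simp [*])
    rw [Finset.card_pair ngj] at this
    have := hdeg x
    omega
  set C := S \ {e, f, g, j} with hCdef
  have a1 := av_card G L C φ u x g (hL _ _ (by simp [eg]))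
  have a2 := av_card G L C φ x u g (hL _ _ (by simp [eg]))
  have a3 := av_card G L C φ v y j (hL _ _ (by simp [ej]))
  have a4 := av_card G L C φ y v j (hL _ _ (by simp [ej]))
  have b1 := av_card G L C φ u v e (hL _ _ (by simp [ee]))
  have b2 := av_card G L C φ v u e (hL _ _ (by simp [ee]))
  have b3 := av_card G L C φ u v f (hL _ _ (by simp [ef]))
  have b4 := av_card G L C φ v u f (hL _ _ (by simp [ef]))
  obtain ⟨q, hq⟩ := Finset.card_pos.mp (show 0 < (av G L C φ x u g).card by omega)
  obtain ⟨r, hr, hrq⟩ := pick (av G L C φ y v j) [q] (by simp; omega)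
  simp only [List.mem_singleton] at hrq
  obtain ⟨P, hP, hPc, hPq, hPr⟩ : ∃ P ⊆ av G L C φ u x g, 3 ≤ P.card ∧ q ∉ P ∧
      (x = y → r ∉ P) := by
    by_cases h : x = y
    · refine ⟨av G L C φ u x g \ [q, r].toFinset, Finset.sdiff_subset, ?_, by simp, by simp⟩
      have := card_sdiff_list (av G L C φ u x g) [q, r]
      have := hxy h
      simp only [List.length] at *
      omega
    · refine ⟨av G L C φ u x g \ [q].toFinset, Finset.sdiff_subset, ?_, by simp, by tauto⟩
      have := card_sdiff_list (av G L C φ u x g) [q]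
      simp only [List.length] at *
      omega
  obtain ⟨P', hP', hPc', hPq', hPr'⟩ : ∃ P ⊆ av G L C φ v y j, 3 ≤ P.card ∧ r ∉ P ∧
      (x = y → q ∉ P) := by
    by_cases h : x = y
    · refine ⟨av G L C φ v y j \ [q, r].toFinset, Finset.sdiff_subset, ?_, by simp, by simp⟩
      have := card_sdiff_list (av G L C φ v y j) [q, r]
      have := hxy h
      simp only [List.length] at *
      omega
    · refine ⟨av G L C φ v y j \ [r].toFinset, Finset.sdiff_subset, ?_, by simp, by tauto⟩
      have := card_sdiff_list (av G L C φ v y j) [r]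
      simp only [List.length] at *
      omega
  have c1 := card_sdiff_list (av G L C φ u v e) [q]
  have c2 := card_sdiff_list (av G L C φ v u e) [r]
  have c3 := card_sdiff_list (av G L C φ u v f) [q]
  have c4 := card_sdiff_list (av G L C φ v u f) [r]
  obtain ⟨p, hp, p', hp', h1, hh1, h2, hh2, h3, hh3, h4, hh4, H⟩ := lemA P P'
    (av G L C φ u v e \ [q].toFinset) (av G L C φ v u e \ [r].toFinset)
    (av G L C φ u v f \ [q].toFinset) (av G L C φ v u f \ [r].toFinset)
    hPc hPc' (by simp only [List.length] at *; omega) (by simp only [List.length] at *; omega)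
    (by simp only [List.length] at *; omega) (by simp only [List.length] at *; omega)
  simp only [List.toFinset_cons, List.toFinset_nil, Finset.mem_sdiff, Finset.mem_insert,
    Finset.notMem_empty, or_false] at hh1 hh2 hh3 hh4
  have t1 : p ≠ q := fun h => hPq (h ▸ hp)
  have t2 : p' ≠ r := fun h => hPq' (h ▸ hp')
  have t3 : x = y → p ≠ r := fun hx h => hPr hx (h ▸ hp)
  have t4 : x = y → p' ≠ q := fun hx h => hPr' hx (h ▸ hp')
  obtain ⟨k1, hh1⟩ := hh1
  obtain ⟨k2, hh2⟩ := hh2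
  obtain ⟨k3, hh3⟩ := hh3
  obtain ⟨k4, hh4⟩ := hh4
  obtain ⟨φ', h, _⟩ := extend hC S
    [((u, g), p), ((x, g), q), ((v, j), p'), ((y, j), r), ((u, e), h1), ((v, e), h2),
      ((u, f), h3), ((v, f), h4)]
    (by
      simp only [List.forall_mem_cons]
      refine ⟨⟨by simp [C], x, eg, hP hp⟩, ⟨by simp [C], u, eg', hq⟩,
        ⟨by simp [C], y, ej, hP' hp'⟩, ⟨by simp [C], v, ej', hr⟩,
        ⟨by simp [C], v, ee, k1⟩, ⟨by simp [C], u, ee', k2⟩,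
        ⟨by simp [C], v, ef, k3⟩, ⟨by simp [C], u, ef', k4⟩, by simp⟩)
    (by
      clear hC a1 a2 a3 a4 b1 b2 b3 b4 c1 c2 c3 c4 k1 k2 k3 k4 hq hr hp hp' hP hP' hPr hPr' hPq
        hPq' hPc hPc' hxy hx hy hu hv hL hdeg
      simp only [List.pairwise_cons, List.forall_mem_cons, Cmp, IncAdj, eg, ej, ee, ef,
        Sym2.eq_iff]
      simp
      grind)
    (by
      intro i hi
      by_cases hfe : i = e ∨ i = f ∨ i = g ∨ i = j
      · right
        intro w hw
        rcases hfe with rfl | rfl | rfl | rfl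
        · rw [ee, Sym2.mem_iff] at hw
          rcases hw with rfl | rfl
          · exact ⟨h1, by simp⟩
          · exact ⟨h2, by simp⟩
        · rw [ef, Sym2.mem_iff] at hw
          rcases hw with rfl | rfl
          · exact ⟨h3, by simp⟩
          · exact ⟨h4, by simp⟩
        · rw [eg, Sym2.mem_iff] at hw
          rcases hw with rfl | rfl
          · exact ⟨p, by simp⟩
          · exact ⟨q, by simp⟩
        · rw [ej, Sym2.mem_iff] at hw
          rcases hw with rfl | rfl
          · exact ⟨p', by simp⟩
          · exact ⟨r, by simp⟩
      · left; simpa [C, hi] using hfe)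
  exact ⟨φ', h⟩

end IncAux

namespace IncAux

open Multigraph

variable {V E : Type*}

theorem other (G : Multigraph V E) {v : V} {e : E} (h : v ∈ G.ends e) :
    ∃ w, G.ends e = s(v, w) ∧ v ≠ w := by
  obtain ⟨w, hw⟩ := h
  refine ⟨w, hw, ?_⟩
  rintro rfl
  exact G.loopless e (by rw [hw]; simp)

theorem third [DecidableEq E] {G : Multigraph V E} {S : Finset E} {u : V} {e : E}
    (h : (del G S u).card = 3) (he : e ∈ S) (hu : u ∈ G.ends e) :
    ∃ f k, f ∈ S ∧ k ∈ S ∧ u ∈ G.ends f ∧ u ∈ G.ends k ∧ e ≠ f ∧ e ≠ k ∧ f ≠ k ∧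
      ∀ i ∈ S, u ∈ G.ends i → i = e ∨ i = f ∨ i = k := by
  have hm : e ∈ del G S u := mem_del.mpr ⟨he, hu⟩
  have hc : ((del G S u).erase e).card = 2 := by rw [Finset.card_erase_of_mem hm, h]
  obtain ⟨f, k, hfk, heq⟩ := Finset.card_eq_two.mp hc
  have key : ∀ i, i ∈ (del G S u).erase e ↔ i = f ∨ i = k := by intro i; rw [heq]; simp
  simp only [Finset.mem_erase, mem_del] at key
  have kf := (key f).2 (Or.inl rfl)
  have kk := (key k).2 (Or.inr rfl)
  refine ⟨f, k, kf.2.1, kk.2.1, kf.2.2, kk.2.2, kf.1.symm, kk.1.symm, hfk, fun i hi hu => ?_⟩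
  by_cases hie : i = e
  · exact Or.inl hie
  · exact Or.inr ((key i).1 ⟨hie, hi, hu⟩)

theorem main {G : Multigraph V E} {L : V × E → Finset ℕ}
    (hL : ∀ v e, v ∈ G.ends e → (L (v, e)).card = 6)
    (hdeg : ∀ (S : Finset E) v, (del G S v).card ≤ 3) (S : Finset E) : ∃ φ, Col G L S φ := by
  classical
  induction S using Finset.strongInduction with
  | H S ih =>
  have rem : ∀ F : Finset E, (∃ e ∈ F, e ∈ S) → ∃ φ, Col G L (S \ F) φ := by
    rintro F ⟨e, heF, heS⟩
    apply ih
    refine Finset.ssubset_iff_subset_ne.mpr ⟨Finset.sdiff_subset, fun h => ?_⟩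
    rw [← h] at heS
    exact (Finset.mem_sdiff.mp heS).2 heF
  rcases S.eq_empty_or_nonempty with rfl | ⟨e0, he0⟩
  · exact ⟨fun _ => 0, by simp [Col]⟩
  -- degree three everywhere
  by_cases hlow : ∃ e ∈ S, ∃ u ∈ G.ends e, (del G S u).card ≤ 2
  · obtain ⟨e, he, u, hu, hc⟩ := hlow
    obtain ⟨v, hv, huv⟩ := other G hu
    obtain ⟨φ, hφ⟩ := rem {e} ⟨e, by simp, he⟩
    have d1 := delc (G := G) (S := S) (F0 := {e}) {e} (x := u) subset_rfl (by
      intro f hf; simp at hf; subst hf; exact ⟨he, hu⟩)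
    have d2 := delc (G := G) (S := S) (F0 := {e}) {e} (x := v) subset_rfl (by
      intro f hf; simp at hf; subst hf; exact ⟨he, by simp [hv]⟩)
    rw [Finset.card_singleton] at d1 d2
    have a1 := av_card G L (S \ {e}) φ u v e (hL _ _ hu)
    have a2 := av_card G L (S \ {e}) φ v u e (hL _ _ (by simp [hv]))
    have := hdeg S v
    exact case_one hφ hv huv (by omega) (by omega)
  have h3 : ∀ e ∈ S, ∀ u ∈ G.ends e, (del G S u).card = 3 := by
    intro e he u hu
    have := hdeg S u
    by_contra hne
    exact hlow ⟨e, he, u, hu, by omega⟩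
  -- no parallel edges
  by_cases hpar : ∃ e ∈ S, ∃ f ∈ S, e ≠ f ∧ G.ends e = G.ends f
  · obtain ⟨e, he, f, hf, hef, heq⟩ := hpar
    obtain ⟨u, hu⟩ : ∃ u, u ∈ G.ends e := ⟨_, Sym2.out_fst_mem _⟩
    obtain ⟨v, hv, huv⟩ := other G hu
    have hv' : v ∈ G.ends e := by simp [hv]
    obtain ⟨g, hg, hgu, hge, hgf, Au⟩ : ∃ g ∈ S, u ∈ G.ends g ∧ g ≠ e ∧ g ≠ f ∧
        ∀ i ∈ S, u ∈ G.ends i → i = e ∨ i = f ∨ i = g := by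
      obtain ⟨a, b, ha, hb, hua, hub, q1, q2, q3, A⟩ := third (h3 e he u hu) he hu
      rcases A f hf (heq ▸ hu) with h | h | h
      · exact absurd h.symm hef
      · subst h; exact ⟨b, hb, hub, q2.symm, q3.symm, A⟩
      · subst h; exact ⟨a, ha, hua, q1.symm, q3, fun i hi hui => by have := A i hi hui; tauto⟩
    obtain ⟨j, hj, hjv, hje, hjf, Av⟩ : ∃ g ∈ S, v ∈ G.ends g ∧ g ≠ e ∧ g ≠ f ∧
        ∀ i ∈ S, v ∈ G.ends i → i = e ∨ i = f ∨ i = g := by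
      obtain ⟨a, b, ha, hb, hua, hub, q1, q2, q3, A⟩ := third (h3 e he v hv') he hv'
      rcases A f hf (heq ▸ hv') with h | h | h
      · exact absurd h.symm hef
      · subst h; exact ⟨b, hb, hub, q2.symm, q3.symm, A⟩
      · subst h; exact ⟨a, ha, hua, q1.symm, q3, fun i hi hui => by have := A i hi hui; tauto⟩
    have hfv : G.ends f = s(u, v) := by rw [← heq, hv]
    by_cases hgj : g = j
    · -- triple edge
      subst hgj
      have hgv : G.ends g = s(u, v) := ((Sym2.mem_and_mem_iff huv).1 ⟨hgu, hjv⟩)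
      obtain ⟨φ, hφ⟩ := rem {e} ⟨e, by simp, he⟩
      have hN : ∀ a b, (a = u ∧ b = v) ∨ (a = v ∧ b = u) →
          N G (S \ {e}) φ a b ⊆ {φ (u, f), φ (v, f), φ (u, g), φ (v, g)} := by
        intro a b hab c hc
        have key : ∀ i ∈ S \ {e}, (u ∈ G.ends i ∨ v ∈ G.ends i) → i = f ∨ i = g := by
          intro i hi h
          rw [Finset.mem_sdiff, Finset.mem_singleton] at hi
          rcases h with h | h
          · exact (Au i hi.1 h).resolve_left hi.2
          · exact (Av i hi.1 h).resolve_left hi.2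
        rw [mem_N] at hc
        rcases hc with ⟨i, y, q1, q2, q3, q4⟩ | ⟨i, q1, q2, q3⟩
        · have := key i q1 (by rcases hab with ⟨rfl, rfl⟩ | ⟨rfl, rfl⟩ <;> tauto)
          rcases this with rfl | rfl
          · rw [hfv, Sym2.mem_iff] at q3
            rcases q3 with rfl | rfl <;> simp [← q4]
          · rw [hgv, Sym2.mem_iff] at q3
            rcases q3 with rfl | rfl <;> simp [← q4]
        · have := key i q1 (by rcases hab with ⟨rfl, rfl⟩ | ⟨rfl, rfl⟩ <;> tauto)
          rcases this with rfl | rfl <;> rcases hab with ⟨rfl, rfl⟩ | ⟨rfl, rfl⟩ <;> simp [← q3]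
      have hcard : ∀ a b, (a = u ∧ b = v) ∨ (a = v ∧ b = u) →
          2 ≤ (av G L (S \ {e}) φ a b e).card := by
        intro a b hab
        have h1 := (Finset.card_le_card (hN a b hab)).trans Finset.card_le_four
        have h2 := Finset.le_card_sdiff (N G (S \ {e}) φ a b) (L (a, e))
        rw [hL a e (by rcases hab with ⟨rfl, rfl⟩ | ⟨rfl, rfl⟩ <;> assumption)] at h2
        unfold av
        omega
      have c1 := hcard u v (by tauto)
      have c2 := hcard v u (by tauto)
      exact case_one hφ hv huv c1 (by omega)
    · obtain ⟨x, hx, hux⟩ := other G hgu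
      obtain ⟨y, hy, hvy⟩ := other G hjv
      obtain ⟨φ, hφ⟩ := rem {e, f, g, j} ⟨e, by simp, he⟩
      refine par_ext hL (hdeg S) he hf hg hj hef hge.symm hgf.symm hje.symm hjf.symm hgj
        hv hfv hx hy huv hux ?_ ?_ hvy hφ
      · rintro rfl
        have := Av g hg (by simp [hx])
        tauto
      · rintro rfl
        have := Au j hj (by simp [hy])
        tauto
  have hsimple : ∀ e ∈ S, ∀ f ∈ S, e ≠ f → G.ends e ≠ G.ends f := by
    intro e he f hf hne heq
    exact hpar ⟨e, he, f, hf, hne, heq⟩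
  obtain ⟨u, hu⟩ : ∃ u, u ∈ G.ends e0 := ⟨_, Sym2.out_fst_mem _⟩
  obtain ⟨v, hv, huv⟩ := other G hu
  have hv' : v ∈ G.ends e0 := by simp [hv]
  obtain ⟨f, k, hf, hk, huf, huk, nef, nek, nfk, Au⟩ := third (h3 e0 he0 u hu) he0 hu
  obtain ⟨g, j, hg, hj, hvg, hvj, neg, nej, ngj, Av⟩ := third (h3 e0 he0 v hv') he0 hv'
  obtain ⟨x, ex, ux⟩ := other G huf
  obtain ⟨y, ey, uy⟩ := other G huk
  obtain ⟨a, ea, va⟩ := other G hvg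
  obtain ⟨b, eb, vb⟩ := other G hvj
  have vx : v ≠ x := by
    rintro rfl; exact hsimple e0 he0 f hf nef (by rw [hv, ex])
  have vy : v ≠ y := by
    rintro rfl; exact hsimple e0 he0 k hk nek (by rw [hv, ey])
  have xy : x ≠ y := by
    rintro rfl; exact hsimple f hf k hk nfk (by rw [ex, ey])
  have ua : u ≠ a := by
    rintro rfl; exact hsimple e0 he0 g hg neg (by rw [hv, ea, Sym2.eq_swap])
  have ub : u ≠ b := by
    rintro rfl; exact hsimple e0 he0 j hj nej (by rw [hv, eb, Sym2.eq_swap])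
  have ab : a ≠ b := by
    rintro rfl; exact hsimple g hg j hj ngj (by rw [ea, eb])
  have out : ∀ i, u ∈ G.ends i → i ≠ g ∧ i ≠ j := by
    intro i hi
    constructor
    · rintro rfl; rw [ea, Sym2.mem_iff] at hi; tauto
    · rintro rfl; rw [eb, Sym2.mem_iff] at hi; tauto
  obtain ⟨nfg, nfj⟩ := out f huf
  obtain ⟨nkg, nkj⟩ := out k huk
  by_cases xa : x = a
  · subst xa
    obtain ⟨φ, hφ⟩ := rem {e0, f, k, g} ⟨e0, by simp, he0⟩
    exact tri_ext hL (hdeg S) he0 hf hk hg nef nek nfk neg nfg nkg hv ex ey ea huv ux uy vx vy xy hφ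
  by_cases xb : x = b
  · subst xb
    obtain ⟨φ, hφ⟩ := rem {e0, f, k, j} ⟨e0, by simp, he0⟩
    exact tri_ext hL (hdeg S) he0 hf hk hj nef nek nfk nej nfj nkj hv ex ey eb huv ux uy vx vy xy hφ
  obtain ⟨φ, hφ⟩ := rem {e0, f, k, g, j} ⟨e0, by simp, he0⟩
  exact gen_ext hL (hdeg S) he0 hf hk hg hj nef nek nfk neg nfg nkg nej nfj nkj ngj
    hv ex ey ea eb huv ux uy vx vy xy va vb ab ua ub xa xb hφ

end IncAux

/-- Every loopless multigraph with maximum degree at most 3 is incidence 6-choosable, i.e. its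
incidence choice number is at most 6. -/
theorem incChoiceNumber_le_six_of_subcubic {V E : Type*} [Fintype V] [Fintype E]
    (G : Multigraph V E) (hdeg : ∀ v, G.degree v ≤ 3) :
    G.incChoiceNumber ≤ 6 := by
  have hdegS : ∀ (S : Finset E) v, (IncAux.del G S v).card ≤ 3 := by
    intro S v
    refine le_trans ?_ (hdeg v)
    unfold Multigraph.degree
    rw [← Set.ncard_coe_finset]
    refine Set.ncard_le_ncard (fun e he => ?_) (Set.toFinite _)
    exact (IncAux.mem_del.mp (Finset.mem_coe.mp he)).2
  refine Nat.sInf_le ?_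
  intro L hL
  obtain ⟨φ, h1, h2⟩ := IncAux.main hL hdegS Finset.univ
  exact ⟨φ, fun v e hv => h1 v e (Finset.mem_univ _) hv,
    fun v e w f hv hw => h2 v e w f (Finset.mem_univ _) (Finset.mem_univ _) hv hw⟩
end

section
/- For every (2,3)-bipartite simple graph G, the list strong chromatic index satisfies ch'_s(G) ≤ 6. -/
/-- The degree of a vertex of a simple graph (number of neighbors). -/
noncomputable def vdeg {V : Type*} (G : SimpleGraph V) (v : V) : ℕ :=
  (G.neighborSet v).ncard

/-- Two edges `e` and `f` are "strongly adjacent" when they share an endpoint or some endpoint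
of `e` is adjacent in `G` to some endpoint of `f` (i.e. they are joined by an edge). A strong
edge coloring must give distinct colors to distinct edges that are strongly adjacent. -/
def StrongAdj {V : Type*} (G : SimpleGraph V) (e f : Sym2 V) : Prop :=
  (∃ v, v ∈ e ∧ v ∈ f) ∨ (∃ u v, u ∈ e ∧ v ∈ f ∧ G.Adj u v)

/-- `φ` is a strong edge coloring of `G` choosing colors from the list assignment `L`. -/
def IsStrongEdgeListColoring {V : Type*} (G : SimpleGraph V) (L : Sym2 V → Finset ℕ)
    (φ : Sym2 V → ℕ) : Prop :=
  (∀ e ∈ G.edgeSet, φ e ∈ L e) ∧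
  (∀ e f, e ∈ G.edgeSet → f ∈ G.edgeSet → e ≠ f → StrongAdj G e f → φ e ≠ φ f)

/-- The list strong chromatic index of `G`: the least `k` such that whenever every edge is
assigned a list of at least `k` colors, there is a strong edge coloring choosing colors from
the lists. -/
noncomputable def listStrongChromaticIndex {V : Type*} (G : SimpleGraph V) : ℕ :=
  sInf {k | ∀ L : Sym2 V → Finset ℕ, (∀ e ∈ G.edgeSet, k ≤ (L e).card) →
    ∃ φ, IsStrongEdgeListColoring G L φ}


open MvPolynomial in
/-- Coefficient of a product of differences of variables, computed recursively. -/
def atCf {n : ℕ} : List (Fin n × Fin n) → (Fin n → ℕ) → ℤ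
  | [], m => if m = 0 then 1 else 0
  | e :: es, m =>
    (if m e.1 = 0 then 0 else atCf es (Function.update m e.1 (m e.1 - 1))) -
    (if m e.2 = 0 then 0 else atCf es (Function.update m e.2 (m e.2 - 1)))

noncomputable def atPoly {n : ℕ} (es : List (Fin n × Fin n)) : MvPolynomial (Fin n) ℤ :=
  (es.map fun e => (MvPolynomial.X e.1 - MvPolynomial.X e.2)).prod

lemma atCf_eq {n : ℕ} (es : List (Fin n × Fin n)) : ∀ m : Fin n → ℕ,
    (atPoly es).coeff (Finsupp.equivFunOnFinite.symm m) = atCf es m := by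
  have key : ∀ (p : MvPolynomial (Fin n) ℤ) (i : Fin n) (m : Fin n → ℕ),
      (MvPolynomial.X i * p).coeff (Finsupp.equivFunOnFinite.symm m) =
      if m i = 0 then 0 else
        p.coeff (Finsupp.equivFunOnFinite.symm (Function.update m i (m i - 1))) := by
    intro p i m
    rw [MvPolynomial.coeff_X_mul']
    by_cases h : m i = 0
    · simp [h]
    · simp only [Finsupp.mem_support_iff, Finsupp.equivFunOnFinite_symm_apply_apply, ne_eq, h,
        not_false_eq_true, if_true, if_false]
      congr 1
      ext j
      by_cases hj : j = i
      · subst hj; simp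
      · simp [hj]
  induction es with
  | nil =>
    intro m
    simp only [atPoly, List.map_nil, List.prod_nil, MvPolynomial.coeff_one, atCf]
    congr 1
    rw [eq_iff_iff]
    constructor
    · intro h; funext j; have := DFunLike.congr_fun h j; simpa using this.symm
    · rintro rfl; ext j; simp
  | cons e es ih =>
    intro m
    have : atPoly (e :: es) = MvPolynomial.X e.1 * atPoly es - MvPolynomial.X e.2 * atPoly es := by
      simp [atPoly, sub_mul]
    rw [this, MvPolynomial.coeff_sub, key, key, atCf, ih, ih]

lemma atPoly_totalDegree {n : ℕ} (es : List (Fin n × Fin n)) :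
    (atPoly es).totalDegree ≤ es.length := by
  induction es with
  | nil => simp [atPoly]
  | cons e es ih =>
    have : atPoly (e :: es) = (MvPolynomial.X e.1 - MvPolynomial.X e.2) * atPoly es := by
      simp [atPoly]
    rw [this]
    refine (MvPolynomial.totalDegree_mul _ _).trans ?_
    have h2 : (MvPolynomial.X e.1 - MvPolynomial.X e.2 : MvPolynomial (Fin n) ℤ).totalDegree ≤ 1 :=
      (MvPolynomial.totalDegree_sub _ _).trans (by simp)
    simp only [List.length_cons]; omega

/-- Alon--Tarsi style list coloring lemma. -/
lemma at_color {n : ℕ} (es : List (Fin n × Fin n)) (m : Fin n → ℕ)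
    (hc : atCf es m ≠ 0) (hs : ∑ i, m i = es.length)
    (S : Fin n → Finset ℕ) (hS : ∀ i, m i < (S i).card) :
    ∃ φ : Fin n → ℕ, (∀ i, φ i ∈ S i) ∧ ∀ e ∈ es, φ e.1 ≠ φ e.2 := by
  have hdeg : (Finsupp.equivFunOnFinite.symm m).degree = es.length := by
    rw [← hs, Finsupp.degree_eq_sum]; simp
  have hc' : (atPoly es).coeff (Finsupp.equivFunOnFinite.symm m) ≠ 0 := by rwa [atCf_eq]
  obtain ⟨s, h1, h2⟩ := MvPolynomial.combinatorial_nullstellensatz_exists_eval_nonzero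
    (atPoly es) (Finsupp.equivFunOnFinite.symm m) hc'
    (le_antisymm ((atPoly_totalDegree es).trans hdeg.ge)
      (MvPolynomial.le_totalDegree (MvPolynomial.mem_support_iff.2 hc')))
    (fun i => (S i).map Nat.castEmbedding) (by simpa using hS)
  simp only [Finset.mem_map, Nat.castEmbedding_apply] at h1
  choose φ h3 h4 using h1
  refine ⟨φ, h3, fun e he heq => h2 ?_⟩
  rw [atPoly, map_list_prod, List.prod_eq_zero_iff]
  simp only [List.map_map, List.mem_map, Function.comp]
  exact ⟨e, he, by simp [← h4, heq]⟩

def dcE : List (Fin 10 × Fin 10) := [(0, 1), (0, 3), (0, 4), (1, 2), (1, 3), (1, 4), (1, 5), (2, 3), (2, 4), (3, 4), (3, 5), (4, 5), (4, 6), (4, 8), (5, 6), (5, 7), (5, 8), (5, 9), (6, 7), (6, 8), (6, 9), (7, 8), (8, 9)]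
def trE : List (Fin 6 × Fin 6) := [(0, 1), (0, 3), (0, 4), (0, 5), (1, 2), (1, 3), (1, 5), (2, 3), (2, 4), (2, 5), (3, 4), (4, 5)]
def dgE : List (Fin 6 × Fin 6) := [(0, 2), (0, 3), (0, 4), (0, 5), (1, 2), (1, 3), (1, 4), (1, 5), (2, 3), (2, 4), (2, 5), (3, 4), (3, 5), (4, 5)]

lemma dgC : atCf dgE ![2,2,1,2,3,4] = 1 := by decide +kernel
lemma trC : atCf trE ![2,2,2,2,2,2] = 6 := by decide +kernel
lemma dcC : atCf dcE ![0, 2, 1, 3, 5, 5, 2, 1, 3, 1] = 1 := by decide +kernel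

/-- `U` can be properly list coloured. -/
def ColU {α : Type*} (conf : α → α → Prop) (L : α → Finset ℕ) (U : Finset α) : Prop :=
  ∃ φ : α → ℕ, (∀ e ∈ U, φ e ∈ L e) ∧ ∀ e ∈ U, ∀ f ∈ U, conf e f → φ e ≠ φ f

open Classical in
lemma col_core {α : Type*} {conf : α → α → Prop} (hsym : ∀ e f, conf e f → conf f e)
    {L : α → Finset ℕ} {n : ℕ} (es : List (Fin n × Fin n)) (m : Fin n → ℕ)
    (hc : atCf es m ≠ 0) (hs : ∑ i, m i = es.length)
    (y : Fin n → α) (hy : Function.Injective y) (U : Finset α) (hU : ∀ i, y i ∉ U)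
    (hconf : ∀ i j, conf (y i) (y j) → (i, j) ∈ es ∨ (j, i) ∈ es)
    (hcard : ∀ i, m i + (U.filter (conf (y i))).card < (L (y i)).card)
    (h : ColU conf L U) : ColU conf L (U ∪ Finset.univ.image y) := by
  obtain ⟨φ, h1, h2⟩ := h
  obtain ⟨ψ, h3, h4⟩ := at_color es m hc hs
    (fun i => L (y i) \ (U.filter (conf (y i))).image φ) (by
      intro i
      have a1 := Finset.le_card_sdiff ((U.filter (conf (y i))).image φ) (L (y i))
      have a2 : ((U.filter (conf (y i))).image φ).card ≤ _ := Finset.card_image_le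
      have := hcard i
      omega)
  let χ : α → ℕ := fun e => if h : ∃ i, y i = e then ψ h.choose else φ e
  have c1 : ∀ i, χ (y i) = ψ i := by
    intro i
    have hx : ∃ j, y j = y i := ⟨i, rfl⟩
    have : hx.choose = i := hy hx.choose_spec
    simp only [χ, dif_pos hx, this]
  have c2 : ∀ e ∈ U, χ e = φ e := by
    intro e he
    have hx : ¬ ∃ j, y j = e := by rintro ⟨j, rfl⟩; exact hU j he
    simp only [χ, dif_neg hx]
  have c3 : ∀ i, ∀ e ∈ U, conf (y i) e → ψ i ≠ φ e := by
    intro i e he hce heq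
    have := (Finset.mem_sdiff.1 (h3 i)).2
    exact this (Finset.mem_image.2 ⟨e, Finset.mem_filter.2 ⟨he, hce⟩, heq.symm⟩)
  refine ⟨χ, ?_, ?_⟩
  · intro e he
    rcases Finset.mem_union.1 he with he | he
    · rw [c2 e he]; exact h1 e he
    · obtain ⟨i, -, rfl⟩ := Finset.mem_image.1 he
      rw [c1]; exact (Finset.mem_sdiff.1 (h3 i)).1
  · intro e he f hf hef
    rcases Finset.mem_union.1 he with he | he <;> rcases Finset.mem_union.1 hf with hf | hf
    · rw [c2 e he, c2 f hf]; exact h2 e he f hf hef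
    · obtain ⟨i, -, rfl⟩ := Finset.mem_image.1 hf
      rw [c1, c2 e he]; exact (c3 i e he (hsym _ _ hef)).symm
    · obtain ⟨i, -, rfl⟩ := Finset.mem_image.1 he
      rw [c1, c2 f hf]; exact c3 i f hf hef
    · obtain ⟨i, -, rfl⟩ := Finset.mem_image.1 he
      obtain ⟨j, -, rfl⟩ := Finset.mem_image.1 hf
      rw [c1, c1]
      rcases hconf i j hef with h | h
      · exact h4 _ h
      · exact (h4 _ h).symm

open Classical in
lemma exists_min_col {α : Type*} {conf : α → α → Prop} (hsym : ∀ e f, conf e f → conf f e)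
    (hirr : ∀ e, ¬ conf e e)
    {L : α → Finset ℕ} (W : Finset α) : (∀ e ∈ W, 6 ≤ (L e).card) → ¬ ColU conf L W →
    ∃ U ⊆ W, ¬ ColU conf L U ∧ ∀ d ∈ U, 6 ≤ (U.filter (conf d)).card := by
  induction W using Finset.strongInduction with
  | H W ih =>
    intro hL hW
    by_cases hd : ∀ d ∈ W, 6 ≤ (W.filter (conf d)).card
    · exact ⟨W, Finset.Subset.refl _, hW, hd⟩
    · push Not at hd
      obtain ⟨d, hdW, hd⟩ := hd
      have hne : ¬ ColU conf L (W.erase d) := by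
        intro hcol
        apply hW
        have := col_core hsym (n := 1) [] (fun _ => 0) (by simp [atCf]; rfl) (by simp)
          (fun _ => d) (fun i j _ => Subsingleton.elim _ _) (W.erase d) (by simp)
          (fun i j h => absurd h (hirr d)) (by
            intro i
            have h1 := Finset.card_le_card
              (Finset.filter_subset_filter (conf d) (Finset.erase_subset d W))
            have := hL d hdW
            omega) hcol
        have e : W.erase d ∪ Finset.univ.image (fun _ : Fin 1 => d) = W := by
          ext x; simp; by_cases hx : x = d
          · subst hx; simp [hdW]
          · simp [hx]
        rwa [e] at this
      obtain ⟨U, hU, h1, h2⟩ := ih _ (Finset.erase_ssubset hdW)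
        (fun e he => hL e (Finset.mem_of_mem_erase he)) hne
      exact ⟨U, hU.trans (Finset.erase_subset _ _), h1, h2⟩

/-! Graph part. -/

/-- Conflict of two edges, given as pairs `(b, a)`. -/
def conf23 {V : Type*} (G : SimpleGraph V) (e f : V × V) : Prop :=
  e ≠ f ∧ (G.Adj e.1 f.2 ∨ G.Adj f.1 e.2)

lemma conf23_symm {V : Type*} (G : SimpleGraph V) (e f : V × V) (h : conf23 G e f) :
    conf23 G f e := ⟨h.1.symm, h.2.symm⟩

lemma conf23_irr {V : Type*} (G : SimpleGraph V) (e : V × V) : ¬ conf23 G e e := fun h => h.1 rfl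

open Classical in
noncomputable def nbf {V : Type*} [Fintype V] (G : SimpleGraph V) (v : V) : Finset V :=
  Finset.univ.filter (G.Adj v)

lemma mem_nbf {V : Type*} [Fintype V] {G : SimpleGraph V} {v w : V} :
    w ∈ nbf G v ↔ G.Adj v w := by simp [nbf]

open Classical in
noncomputable def ed23 {V : Type*} [Fintype V] (G : SimpleGraph V) (B : Set V) : Finset (V × V) :=
  Finset.univ.filter fun e => e.1 ∈ B ∧ G.Adj e.1 e.2

lemma mem_ed23 {V : Type*} [Fintype V] {G : SimpleGraph V} {B : Set V} {b a : V} :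
    (b, a) ∈ ed23 G B ↔ b ∈ B ∧ G.Adj b a := by simp [ed23]

/-- The standing hypotheses. -/
structure Hyp23 {V : Type*} [Fintype V] (G : SimpleGraph V) (A B : Set V) : Prop where
  ba : ∀ b a, b ∈ B → G.Adj b a → a ∈ A
  ab : ∀ a b, a ∈ A → G.Adj a b → b ∈ B
  dis : ∀ v, v ∈ A → v ∈ B → False
  dA : ∀ a ∈ A, (nbf G a).card ≤ 2
  dB : ∀ b ∈ B, (nbf G b).card ≤ 3

open Classical in
lemma nb_card {V : Type*} [Fintype V] {G : SimpleGraph V} {A B : Set V} (H : Hyp23 G A B)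
    {b a : V} (hb : b ∈ B) (hab : G.Adj b a) :
    ((ed23 G B).filter (conf23 G (b, a))).card + 1 ≤
      ∑ a' ∈ nbf G b, (nbf G a').card + ∑ b' ∈ (nbf G a).erase b, (nbf G b' \ nbf G b).card := by
  have hnot : (b, a) ∉ (ed23 G B).filter (conf23 G (b, a)) := by simp [conf23]
  rw [← Finset.card_insert_of_notMem hnot]
  have hsub : insert (b, a) ((ed23 G B).filter (conf23 G (b, a))) ⊆
      (nbf G b).biUnion (fun a' => (nbf G a').image (fun x => (x, a'))) ∪
      ((nbf G a).erase b).biUnion (fun b' => (nbf G b' \ nbf G b).image (fun x => (b', x))) := by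
    rintro ⟨b', a'⟩ h
    simp only [Finset.mem_insert, Finset.mem_filter, mem_ed23, Finset.mem_union,
      Finset.mem_biUnion, Finset.mem_image, mem_nbf, Finset.mem_erase, Finset.mem_sdiff,
      Prod.mk.injEq, conf23] at h ⊢
    by_cases h1 : G.Adj b a'
    · left
      refine ⟨a', h1, b', ?_, rfl, rfl⟩
      rcases h with ⟨rfl, rfl⟩ | h
      · exact hab.symm
      · exact h.1.2.symm
    · right
      rcases h with ⟨rfl, rfl⟩ | h
      · exact absurd hab h1
      · have h2 : G.Adj b' a := by tauto
        refine ⟨b', ⟨?_, h2.symm⟩, a', ⟨h.1.2, h1⟩, rfl, rfl⟩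
        rintro rfl; exact h1 h.1.2
  refine (Finset.card_le_card hsub).trans ((Finset.card_union_le _ _).trans ?_)
  refine Nat.add_le_add ?_ ?_
  · exact Finset.card_biUnion_le.trans (Finset.sum_le_sum fun i _ => Finset.card_image_le)
  · exact Finset.card_biUnion_le.trans (Finset.sum_le_sum fun i _ => Finset.card_image_le)

open Classical in
/-- A convenient form: `k` bounds the first sum, `l` the number of private edges of the
other endpoint. -/
lemma nb_card' {V : Type*} [Fintype V] {G : SimpleGraph V} {A B : Set V} (H : Hyp23 G A B)
    {b a : V} (hb : b ∈ B) (hab : G.Adj b a) (k l : ℕ)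
    (hk : ∑ a' ∈ nbf G b, (nbf G a').card ≤ k)
    (hl : ∀ b', G.Adj b' a → b' ≠ b → (nbf G b' \ nbf G b).card ≤ l) :
    ((ed23 G B).filter (conf23 G (b, a))).card + 1 ≤ k + l := by
  refine (nb_card H hb hab).trans (Nat.add_le_add hk ?_)
  have ha := H.ba b a hb hab
  have h1 : ((nbf G a).erase b).card ≤ 1 := by
    have := H.dA a ha
    rw [Finset.card_erase_of_mem (mem_nbf.2 hab.symm)]; omega
  calc _ ≤ ∑ b' ∈ (nbf G a).erase b, l := by
        refine Finset.sum_le_sum fun b' hb' => ?_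
        rw [Finset.mem_erase, mem_nbf] at hb'
        exact hl b' hb'.2.symm hb'.1
    _ = ((nbf G a).erase b).card * l := by simp
    _ ≤ 1 * l := Nat.mul_le_mul_right _ h1
    _ = l := one_mul l

open Classical in
lemma sum_nbf_le {V : Type*} [Fintype V] {G : SimpleGraph V} {A B : Set V} (H : Hyp23 G A B)
    {b : V} (hb : b ∈ B) : ∑ a' ∈ nbf G b, (nbf G a').card ≤ (nbf G b).card * 2 := by
  calc _ ≤ ∑ a' ∈ nbf G b, 2 :=
        Finset.sum_le_sum fun a' h => H.dA a' (H.ba b a' hb (mem_nbf.1 h))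
    _ = _ := by simp

open Classical in
lemma sdiff_le_of_sub {V : Type*} [Fintype V] {G : SimpleGraph V} {A B : Set V} (H : Hyp23 G A B)
    {b b' : V} (hb' : b' ∈ B) (S : Finset V) (h1 : S ⊆ nbf G b) (h2 : S ⊆ nbf G b') :
    (nbf G b' \ nbf G b).card + S.card ≤ 3 := by
  refine le_trans ?_ (H.dB b' hb')
  rw [← Finset.card_union_of_disjoint]
  · exact Finset.card_le_card (Finset.union_subset Finset.sdiff_subset h2)
  · rw [Finset.disjoint_left]; intro x hx hs
    exact (Finset.mem_sdiff.1 hx).2 (h1 hs)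

open Classical in
lemma nb_le_seven {V : Type*} [Fintype V] {G : SimpleGraph V} {A B : Set V} (H : Hyp23 G A B)
    (e : V × V) (he : e ∈ ed23 G B) :
    ((ed23 G B).filter (conf23 G e)).card ≤ 7 := by
  obtain ⟨b, a⟩ := e
  obtain ⟨hb, hab⟩ := mem_ed23.1 he
  have h3 := H.dB b hb
  have := nb_card' H hb hab 6 2 ((sum_nbf_le H hb).trans (by omega)) (by
    intro b' h hne
    have := sdiff_le_of_sub (b := b) H (H.ab a b' (H.ba b a hb hab) h.symm) {a}
      (by simpa [mem_nbf] using hab) (by simpa [mem_nbf] using h)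
    simp at this; omega)
  omega

open Classical in
/-- Every element of `U` has many conflicts inside `U`. -/
def Dense6 {V : Type*} (G : SimpleGraph V) (U : Finset (V × V)) : Prop :=
  ∀ d ∈ U, 6 ≤ (U.filter (conf23 G d)).card

/-- All edges at neighbours of `v` lie outside `U`. -/
def Full23 {V : Type*} (G : SimpleGraph V) (U : Finset (V × V)) (v : V) : Prop :=
  ∀ a, G.Adj v a → ∀ b, G.Adj b a → (b, a) ∉ U

open Classical in
lemma drop_gen {V : Type*} [Fintype V] {G : SimpleGraph V} {B : Set V}
    {U : Finset (V × V)} (hU : U ⊆ ed23 G B) (hD : Dense6 G U) (e : V × V) (S : Finset (V × V))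
    (hS : ∀ f ∈ S, f ∈ ed23 G B ∧ conf23 G e f ∧ f ∉ U)
    (hc : ((ed23 G B).filter (conf23 G e)).card ≤ 5 + S.card) : e ∉ U := by
  intro he
  have h1 := hD e he
  have h2 : (U.filter (conf23 G e) ∪ S).card ≤ ((ed23 G B).filter (conf23 G e)).card := by
    apply Finset.card_le_card
    intro f hf
    rcases Finset.mem_union.1 hf with hf | hf
    · rw [Finset.mem_filter] at hf ⊢; exact ⟨hU hf.1, hf.2⟩
    · rw [Finset.mem_filter]; exact ⟨(hS f hf).1, (hS f hf).2.1⟩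
  rw [Finset.card_union_of_disjoint] at h2
  · omega
  · rw [Finset.disjoint_left]; intro f hf hs
    exact (hS f hs).2.2 (Finset.mem_filter.1 hf).1

open Classical in
lemma drop_two {V : Type*} [Fintype V] {G : SimpleGraph V} {A B : Set V} (H : Hyp23 G A B)
    {U : Finset (V × V)} (hU : U ⊆ ed23 G B) (hD : Dense6 G U) (e f g : V × V)
    (hfg : f ≠ g) (hf : f ∈ ed23 G B) (hg : g ∈ ed23 G B) (hef : conf23 G e f)
    (heg : conf23 G e g) (hfU : f ∉ U) (hgU : g ∉ U) : e ∉ U := by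
  intro he
  refine drop_gen hU hD e {f, g} ?_ ?_ he
  · intro x hx
    simp only [Finset.mem_insert, Finset.mem_singleton] at hx
    rcases hx with rfl | rfl
    · exact ⟨hf, hef, hfU⟩
    · exact ⟨hg, heg, hgU⟩
  · rw [Finset.card_pair hfg]; exact nb_le_seven H e (hU he)

lemma nbr_two {V : Type*} [Fintype V] {G : SimpleGraph V} {a z t : V}
    (h : (nbf G a).card ≤ 2) (hz : G.Adj z a) (ht : G.Adj t a) (hzt : z ≠ t) (x : V)
    (hx : G.Adj x a) : x = z ∨ x = t := by
  classical
  by_contra hcon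
  push Not at hcon
  have : ({x, z, t} : Finset V) ⊆ nbf G a := by
    intro y hy
    simp only [Finset.mem_insert, Finset.mem_singleton] at hy
    rw [mem_nbf]
    rcases hy with rfl | rfl | rfl
    · exact hx.symm
    · exact hz.symm
    · exact ht.symm
  have h2 := Finset.card_le_card this
  rw [Finset.card_eq_three.2 ⟨x, z, t, hcon.1, hcon.2, hzt, rfl⟩] at h2
  omega

/-- If two edges at a common `A`-vertex are outside `U` then everything around is. -/
lemma full_of_pair {V : Type*} [Fintype V] {G : SimpleGraph V} {A B : Set V} (H : Hyp23 G A B)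
    {U : Finset (V × V)} (hU : U ⊆ ed23 G B) (hD : Dense6 G U) {z t a : V}
    (hz : z ∈ B) (hza : G.Adj z a) (hta : G.Adj t a) (hzt : z ≠ t)
    (h1 : (z, a) ∉ U) (h2 : (t, a) ∉ U) : Full23 G U z := by
  have haA := H.ba z a hz hza
  have ht : t ∈ B := H.ab a t haA hta.symm
  have hz' : ∀ a', G.Adj z a' → (z, a') ∉ U := by
    intro a' ha'
    by_cases e : a' = a
    · rw [e]; exact h1
    · exact drop_two H hU hD (z, a') (z, a) (t, a) (by simp [hzt]) (mem_ed23.2 ⟨hz, hza⟩)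
        (mem_ed23.2 ⟨ht, hta⟩) ⟨by simp [e], Or.inl hza⟩ ⟨by simp [e], Or.inl hza⟩ h1 h2
  intro a' ha' b hb
  by_cases e : a' = a
  · subst e
    rcases nbr_two (H.dA a' haA) hza hta hzt b hb with rfl | rfl
    · exact h1
    · exact h2
  · by_cases e2 : b = z
    · subst e2; exact hz' a' ha'
    · exact drop_two H hU hD (b, a') (z, a') (z, a) (by simp [e]) (mem_ed23.2 ⟨hz, ha'⟩)
        (mem_ed23.2 ⟨hz, hza⟩) ⟨by simp [e2], Or.inr ha'⟩
        ⟨by simp [e2], Or.inr ha'⟩ (hz' a' ha') h1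

lemma full_prop {V : Type*} [Fintype V] {G : SimpleGraph V} {A B : Set V} (H : Hyp23 G A B)
    {U : Finset (V × V)} (hU : U ⊆ ed23 G B) (hD : Dense6 G U) {z t a : V}
    (hz : z ∈ B) (hza : G.Adj z a) (hta : G.Adj t a) (hF : Full23 G U z) : Full23 G U t := by
  by_cases e : t = z
  · rw [e]; exact hF
  · exact full_of_pair H hU hD (H.ab a t (H.ba z a hz hza) hta.symm) hta hza e
      (hF a hza t hta) (hF a hza z hza)

/-- Closed under conflicts. -/
def Closed23 {V : Type*} [Fintype V] (G : SimpleGraph V) (B : Set V) (W : Finset (V × V)) : Prop :=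
  W ⊆ ed23 G B ∧ ∀ e ∈ W, ∀ f ∈ ed23 G B, conf23 G e f → f ∈ W

/-- What a starting configuration provides. -/
def Start23 {V : Type*} (G : SimpleGraph V) (L : V × V → Finset ℕ) (W : Finset (V × V)) : Prop :=
  ∃ U ⊆ W, ¬ ColU (conf23 G) L U ∧ Dense6 G U ∧ ∃ v a, (v, a) ∈ W ∧ Full23 G U v

lemma col_of_start {V : Type*} [Fintype V] {G : SimpleGraph V} {A B : Set V} (H : Hyp23 G A B)
    {L : V × V → Finset ℕ}
    (hstart : ∀ W, Closed23 G B W → ¬ ColU (conf23 G) L W → Start23 G L W)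
    (W : Finset (V × V)) : Closed23 G B W → ColU (conf23 G) L W := by
  classical
  induction W using Finset.strongInduction with
  | H W ih =>
    intro hW
    by_contra hcol
    obtain ⟨U, hUW, hUc, hD, v, a, hva, hF⟩ := hstart W hW hcol
    have hUE := hUW.trans hW.1
    let Z := W.filter fun e => ¬ Full23 G U e.1
    have hZW : Z ⊂ W := by
      refine Finset.filter_ssubset.2 ⟨(v, a), hva, ?_⟩
      simpa using hF
    have hZ : Closed23 G B Z := by
      refine ⟨hZW.1.trans hW.1, ?_⟩
      rintro ⟨b, c⟩ he ⟨b', c'⟩ hf hef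
      obtain ⟨heW, heF⟩ := Finset.mem_filter.1 he
      refine Finset.mem_filter.2 ⟨hW.2 _ heW _ hf hef, fun hF' => heF ?_⟩
      have h1 := mem_ed23.1 (hW.1 heW)
      have h2 := mem_ed23.1 hf
      rcases hef.2 with h | h
      · exact full_prop H hUE hD h2.1 h2.2 h hF'
      · exact full_prop H hUE hD h2.1 h h1.2 hF'
    obtain ⟨φ, p1, p2⟩ := ih Z hZW hZ
    have hUZ : U ⊆ Z := by
      rintro ⟨b, c⟩ he
      refine Finset.mem_filter.2 ⟨hUW he, fun hF' => ?_⟩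
      have h1 := mem_ed23.1 (hUE he)
      exact hF' c h1.2 b h1.2 he
    exact hUc ⟨φ, fun e he => p1 e (hUZ he), fun e he f hf => p2 e (hUZ he) f (hUZ hf)⟩

open Classical in
/-- Starting from a core configuration. -/
lemma start_core {V : Type*} [Fintype V] {G : SimpleGraph V} {A B : Set V} (H : Hyp23 G A B)
    {L : V × V → Finset ℕ} (hL : ∀ e ∈ ed23 G B, 6 ≤ (L e).card)
    {W : Finset (V × V)} (hW : Closed23 G B W) (hcol : ¬ ColU (conf23 G) L W)
    {p q n : ℕ} (T : Fin p → Fin q → Bool) (bs : Fin p → V) (as : Fin q → V)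
    (hbs : Function.Injective bs) (has : Function.Injective as)
    (hT : ∀ i j, G.Adj (bs i) (as j) ↔ T i j = true)
    (y : Fin n → Fin p × Fin q) (hy : ∀ i j, y i = y j → i = j)
    (hyW : ∀ i, (bs (y i).1, as (y i).2) ∈ W)
    (es : List (Fin n × Fin n))
    (hes : ∀ i j, (i ≠ j ∧ (T (y i).1 (y j).2 = true ∨ T (y j).1 (y i).2 = true)) ↔
      ((i, j) ∈ es ∨ (j, i) ∈ es))
    (m : Fin n → ℕ) (hc : atCf es m ≠ 0) (hs : ∑ i, m i = es.length)
    (κ : Fin n → ℕ)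
    (hκ : ∀ i, ((ed23 G B).filter (conf23 G (bs (y i).1, as (y i).2))).card ≤ κ i)
    (hm : ∀ i, m i + κ i < 6 + (Finset.univ.filter fun j => (i, j) ∈ es ∨ (j, i) ∈ es).card)
    (i₀ i₁ : Fin n) (h01 : (y i₀).2 = (y i₁).2) (h01' : (y i₀).1 ≠ (y i₁).1) :
    Start23 G L W := by
  let Y : Fin n → V × V := fun i => (bs (y i).1, as (y i).2)
  have hYinj : Function.Injective Y := by
    intro i j h
    simp only [Y, Prod.mk.injEq] at h
    exact hy i j (Prod.ext (hbs h.1) (has h.2))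
  have hYc : ∀ i j, conf23 G (Y i) (Y j) ↔ ((i, j) ∈ es ∨ (j, i) ∈ es) := by
    intro i j
    rw [← hes i j, ← hT, ← hT]
    exact and_congr hYinj.ne_iff Iff.rfl
  let W' := W \ Finset.univ.image Y
  have hW'W : W' ⊆ W := Finset.sdiff_subset
  have hYW' : ∀ i, Y i ∉ W' := by intro i; simp [W']
  have hW' : ¬ ColU (conf23 G) L W' := by
    intro h
    apply hcol
    have := col_core (conf23_symm G) es m hc hs Y hYinj W' hYW'
      (fun i j h => (hYc i j).1 h) (by
        intro i
        have h1 : (W'.filter (conf23 G (Y i)) ∪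
            (Finset.univ.filter fun j => (i, j) ∈ es ∨ (j, i) ∈ es).image Y).card ≤ κ i := by
          refine le_trans (Finset.card_le_card ?_) (hκ i)
          intro f hf
          rw [Finset.mem_filter]
          rcases Finset.mem_union.1 hf with hf | hf
          · rw [Finset.mem_filter] at hf
            exact ⟨hW.1 (hW'W hf.1), hf.2⟩
          · obtain ⟨j, hj, rfl⟩ := Finset.mem_image.1 hf
            exact ⟨hW.1 (hyW j), (hYc i j).2 (Finset.mem_filter.1 hj).2⟩
        rw [Finset.card_union_of_disjoint, Finset.card_image_of_injective _ hYinj] at h1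
        · have h2 := hm i
          have h3 := hL (Y i) (hW.1 (hyW i))
          omega
        · rw [Finset.disjoint_left]
          intro f hf hf2
          obtain ⟨j, hj, rfl⟩ := Finset.mem_image.1 hf2
          exact hYW' j (Finset.mem_filter.1 hf).1) h
    have e : W' ∪ Finset.univ.image Y = W := by
      refine Finset.sdiff_union_of_subset ?_
      intro f hf
      obtain ⟨j, hj, rfl⟩ := Finset.mem_image.1 hf
      exact hyW j
    refine (congrArg (ColU (conf23 G) L) ?_).mp this
    ext x
    have h5 := Finset.ext_iff.1 e x
    simpa only [Finset.mem_union, Finset.mem_image] using h5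
  obtain ⟨U, hU, h1, h2⟩ := exists_min_col (conf23_symm G) (conf23_irr G) W'
    (fun e he => hL e (hW.1 (hW'W he))) hW'
  have e0 := mem_ed23.1 (hW.1 (hyW i₀))
  have e1 := mem_ed23.1 (hW.1 (hyW i₁))
  refine ⟨U, hU.trans hW'W, h1, h2, bs (y i₀).1, as (y i₀).2, hyW i₀, ?_⟩
  refine full_of_pair H ((hU.trans hW'W).trans hW.1) h2 (t := bs (y i₁).1) e0.1 e0.2
    (by rw [h01]; exact e1.2) (fun h => h01' (hbs h)) (fun h => hYW' i₀ (hU h)) ?_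
  rw [h01]; exact fun h => hYW' i₁ (hU h)

lemma start_deficient {V : Type*} [Fintype V] {G : SimpleGraph V} {A B : Set V} (H : Hyp23 G A B)
    {L : V × V → Finset ℕ} (hL : ∀ e ∈ ed23 G B, 6 ≤ (L e).card)
    {W : Finset (V × V)} (hW : Closed23 G B W) (hcol : ¬ ColU (conf23 G) L W)
    {b a : V} (hba : (b, a) ∈ W) (hdef : (nbf G b).card ≠ 3 ∨ (nbf G a).card ≠ 2) :
    Start23 G L W := by
  classical
  obtain ⟨U, hUW, h1, hD⟩ := exists_min_col (conf23_symm G) (conf23_irr G) W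
    (fun e he => hL e (hW.1 he)) hcol
  have hU := hUW.trans hW.1
  refine ⟨U, hUW, h1, hD, b, a, hba, ?_⟩
  obtain ⟨hb, hab⟩ := mem_ed23.1 (hW.1 hba)
  have hd : ∀ a' b', G.Adj b a' → G.Adj b' a' → (nbf G b' \ nbf G b).card ≤ 2 := by
    intro a' b' h h'
    have := sdiff_le_of_sub (b := b) H (H.ab a' b' (H.ba b a' hb h) h'.symm) {a'}
      (by simpa [mem_nbf] using h) (by simpa [mem_nbf] using h')
    simp at this; omega
  have h3 := H.dB b hb
  have hsum := sum_nbf_le H hb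
  by_cases hb2 : (nbf G b).card ≤ 2
  · have hout : ∀ a', G.Adj b a' → (b, a') ∉ U := by
      intro a' ha'
      have := nb_card' H hb ha' 4 2 (by omega) (fun b' h _ => hd a' b' ha' h)
      exact drop_gen hU hD _ ∅ (by simp) (by simp; omega)
    intro a' ha' b' hb'
    by_cases e : b' = b
    · subst e; exact hout a' ha'
    have hb'B : b' ∈ B := H.ab a' b' (H.ba b a' hb ha') hb'.symm
    by_cases hex : ∃ a'', G.Adj b a'' ∧ a'' ≠ a'
    · obtain ⟨a'', h4, h5⟩ := hex
      exact drop_two H hU hD (b', a') (b, a') (b, a'') (by simp [h5.symm]) (mem_ed23.2 ⟨hb, ha'⟩)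
        (mem_ed23.2 ⟨hb, h4⟩) ⟨by simp [e], Or.inr ha'⟩ ⟨by simp [e], Or.inr ha'⟩
        (hout _ ha') (hout _ h4)
    · push Not at hex
      have := nb_card' H hb'B hb' 6 0 ((sum_nbf_le H hb'B).trans (by have := H.dB b' hb'B; omega))
        (by
          intro x hx hxb
          rcases nbr_two (H.dA a' (H.ba b a' hb ha')) ha' hb' (Ne.symm e) x hx with rfl | rfl
          · rw [Nat.le_zero, Finset.card_eq_zero, Finset.sdiff_eq_empty_iff_subset]
            intro w hw
            rw [mem_nbf] at hw ⊢
            rw [hex w hw]; exact hb'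
          · exact absurd rfl hxb)
      exact drop_gen hU hD _ ∅ (by simp) (by simp; omega)
  · have ha1 : (nbf G a).card ≤ 1 := by
      have := H.dA a (H.ba b a hb hab)
      omega
    have hNa : ∀ x, G.Adj x a → x = b := by
      intro x hx
      exact Finset.card_le_one.1 ha1 x (mem_nbf.2 hx.symm) b (mem_nbf.2 hab.symm)
    have hs5 : ∑ a' ∈ nbf G b, (nbf G a').card ≤ 5 := by
      rw [← Finset.add_sum_erase _ _ (mem_nbf.2 hab)]
      have h6 : ∑ a' ∈ (nbf G b).erase a, (nbf G a').card ≤ ∑ a' ∈ (nbf G b).erase a, 2 :=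
        Finset.sum_le_sum fun a' h =>
          H.dA a' (H.ba b a' hb (mem_nbf.1 (Finset.mem_of_mem_erase h)))
      simp only [Finset.sum_const, smul_eq_mul] at h6
      rw [Finset.card_erase_of_mem (mem_nbf.2 hab)] at h6
      omega
    have h0 : (b, a) ∉ U := by
      have := nb_card' H hb hab 5 0 hs5 (fun b' h hne => absurd (hNa b' h) hne)
      exact drop_gen hU hD _ ∅ (by simp) (by simp; omega)
    have hout : ∀ a', G.Adj b a' → (b, a') ∉ U := by
      intro a' ha'
      by_cases e : a' = a
      · rw [e]; exact h0
      have := nb_card' H hb ha' 5 2 hs5 (fun b' h _ => hd a' b' ha' h)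
      refine drop_gen hU hD _ {(b, a)} ?_ (by simp; omega)
      intro f hf
      rw [Finset.mem_singleton] at hf
      subst hf
      exact ⟨mem_ed23.2 ⟨hb, hab⟩, ⟨by simp [e], Or.inl hab⟩, h0⟩
    intro a' ha' b' hb'
    by_cases e : b' = b
    · subst e; exact hout a' ha'
    by_cases e2 : a' = a
    · subst e2; exact absurd (hNa b' hb') e
    exact drop_two H hU hD (b', a') (b, a') (b, a) (by simp [e2]) (mem_ed23.2 ⟨hb, ha'⟩)
        (mem_ed23.2 ⟨hb, hab⟩) ⟨by simp [e], Or.inr ha'⟩ ⟨by simp [e], Or.inr ha'⟩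
        (hout _ ha') h0

lemma third {V : Type*} [Fintype V] {G : SimpleGraph V} {v a a' : V} (h : (nbf G v).card = 3)
    (ha : G.Adj v a) (ha' : G.Adj v a') (hne : a ≠ a') :
    ∃ c, c ≠ a ∧ c ≠ a' ∧ G.Adj v c ∧ ∀ x, G.Adj v x ↔ x = a ∨ x = a' ∨ x = c := by
  classical
  have h1 : (((nbf G v).erase a).erase a').card = 1 := by
    rw [Finset.card_erase_of_mem, Finset.card_erase_of_mem (mem_nbf.2 ha), h]
    exact Finset.mem_erase.2 ⟨hne.symm, mem_nbf.2 ha'⟩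
  obtain ⟨c, hc⟩ := Finset.card_eq_one.1 h1
  have hx : ∀ x, (x ≠ a' ∧ x ≠ a ∧ G.Adj v x) ↔ x = c := by
    intro x
    have := Finset.ext_iff.1 hc x
    simpa [mem_nbf] using this
  obtain ⟨c1, c2, c3⟩ := (hx c).2 rfl
  refine ⟨c, c2, c1, c3, fun x => ⟨fun h => ?_, ?_⟩⟩
  · by_cases e1 : x = a
    · exact Or.inl e1
    by_cases e2 : x = a'
    · exact Or.inr (Or.inl e2)
    exact Or.inr (Or.inr ((hx x).1 ⟨e2, e1, h⟩))
  · rintro (rfl | rfl | rfl) <;> assumption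

lemma other {V : Type*} [Fintype V] {G : SimpleGraph V} {v a : V} (h : (nbf G a).card = 2)
    (ha : G.Adj v a) : ∃ w, w ≠ v ∧ G.Adj w a ∧ ∀ x, G.Adj x a ↔ x = v ∨ x = w := by
  classical
  have h1 : ((nbf G a).erase v).card = 1 := by
    rw [Finset.card_erase_of_mem (mem_nbf.2 ha.symm), h]
  obtain ⟨w, hw⟩ := Finset.card_eq_one.1 h1
  have : w ∈ (nbf G a).erase v := by rw [hw]; simp
  rw [Finset.mem_erase, mem_nbf] at this
  refine ⟨w, this.1, this.2.symm, fun x => ⟨nbr_two h.le ha this.2.symm this.1.symm x, ?_⟩⟩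
  rintro (rfl | rfl)
  · exact ha
  · exact this.2.symm

lemma inj_of_pairwise {V : Type*} {n : ℕ} (f : Fin n → V) (h : ∀ i j, i < j → f i ≠ f j) :
    Function.Injective f := by
  intro i j hij
  rcases lt_trichotomy i j with h1 | h1 | h1
  · exact absurd hij (h i j h1)
  · exact h1
  · exact absurd hij.symm (h j i h1)

def dgT : Fin 2 → Fin 4 → Bool := ![![true, true, true, false], ![true, true, false, true]]
def dgY : Fin 6 → Fin 2 × Fin 4 := ![(0,2),(1,3),(0,0),(0,1),(1,0),(1,1)]
def trT : Fin 3 → Fin 3 → Bool := fun i j => decide (i ≠ j)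
def trY : Fin 6 → Fin 3 × Fin 3 := ![(0,1),(0,2),(1,0),(1,2),(2,0),(2,1)]
def dcT : Fin 6 → Fin 5 → Bool := ![![true, true, true, false, false],
  ![true, false, false, true, true], ![false, true, false, false, false],
  ![false, false, true, false, false], ![false, false, false, true, false],
  ![false, false, false, false, true]]
def dcY : Fin 10 → Fin 6 × Fin 5 :=
  ![(2,1),(0,1),(3,2),(0,2),(0,0),(1,0),(1,3),(4,3),(1,4),(5,4)]

section cores
variable {V : Type*} [Fintype V] {G : SimpleGraph V} {A B : Set V}

lemma start_digon (H : Hyp23 G A B)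
    {L : V × V → Finset ℕ} (hL : ∀ e ∈ ed23 G B, 6 ≤ (L e).card)
    {W : Finset (V × V)} (hW : Closed23 G B W) (hcol : ¬ ColU (conf23 G) L W)
    (hmove : ∀ b a b', (b, a) ∈ W → G.Adj b' a → (b', a) ∈ W)
    (hmove' : ∀ b a a', (b, a) ∈ W → G.Adj b a' → (b, a') ∈ W)
    (hreg : ∀ b a, (b, a) ∈ W → (nbf G b).card = 3 ∧ (nbf G a).card = 2)
    {v w a a' : V} (hva : (v, a) ∈ W) (hwa : G.Adj w a) (hva' : G.Adj v a') (hwa' : G.Adj w a')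
    (hvw : v ≠ w) (haa : a ≠ a') : Start23 G L W := by
  classical
  have hwaW := hmove _ _ _ hva hwa
  obtain ⟨hv, hva2⟩ := mem_ed23.1 (hW.1 hva)
  obtain ⟨hw, -⟩ := mem_ed23.1 (hW.1 hwaW)
  obtain ⟨c, c1, c2, c3, c4⟩ := third (hreg _ _ hva).1 hva2 hva' haa
  obtain ⟨d, d1, d2, d3, d4⟩ := third (hreg _ _ hwaW).1 hwa hwa' haa
  have s1 := sum_nbf_le H hv
  have s2 := sum_nbf_le H hw
  rw [(hreg _ _ hva).1] at s1
  rw [(hreg _ _ hwaW).1] at s2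
  have hA1 := H.dA a (H.ba v a hv hva2)
  have hA2 := H.dA a' (H.ba v a' hv hva')
  by_cases hcd : c = d
  · subst hcd
    obtain ⟨U, hUW, h1, hD⟩ := exists_min_col (conf23_symm G) (conf23_irr G) W
      (fun e he => hL e (hW.1 he)) hcol
    have hU := hUW.trans hW.1
    have hE : nbf G v = nbf G w := by
      ext x; rw [mem_nbf, mem_nbf, c4, d4]
    have e1 : (v, a) ∉ U := by
      have := nb_card' H hv hva2 6 0 s1 (by
        intro x hx hxv
        rcases nbr_two hA1 hva2 hwa hvw x hx with rfl | rfl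
        · exact absurd rfl hxv
        · simp [hE])
      exact drop_gen hU hD _ ∅ (by simp) (by simp; omega)
    have e2 : (w, a) ∉ U := by
      have := nb_card' H hw hwa 6 0 s2 (by
        intro x hx hxv
        rcases nbr_two hA1 hva2 hwa hvw x hx with rfl | rfl
        · simp [hE]
        · exact absurd rfl hxv)
      exact drop_gen hU hD _ ∅ (by simp) (by simp; omega)
    exact ⟨U, hUW, h1, hD, v, a, hva, full_of_pair H hU hD hv hva2 hwa hvw e1 e2⟩
  · have six : ∀ x y z, x ∈ B → y ∈ B → G.Adj x z → (nbf G z).card ≤ 2 →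
        G.Adj y z → x ≠ y → G.Adj x a → G.Adj x a' → G.Adj y a → G.Adj y a' →
        ((ed23 G B).filter (conf23 G (x, z))).card ≤ 6 := by
      intro x y z hx hy hxz hz hyz hxy xa xa' ya ya'
      have := nb_card' H hx hxz 6 1 ((sum_nbf_le H hx).trans (by have := H.dB x hx; omega)) (by
        intro u hu hux
        rcases nbr_two hz hxz hyz hxy u hu with rfl | rfl
        · exact absurd rfl hux
        · have := sdiff_le_of_sub (b := x) H hy {a, a'}
            (by intro t ht; simp at ht; rw [mem_nbf]; rcases ht with rfl | rfl <;> assumption)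
            (by intro t ht; simp at ht; rw [mem_nbf]; rcases ht with rfl | rfl <;> assumption)
          rw [Finset.card_pair haa] at this
          omega)
      omega
    have hwaW' := hmove' _ _ _ hwaW hwa'
    have hva'W := hmove' _ _ _ hva hva'
    have hvcW := hmove' _ _ _ hva c3
    have hwdW := hmove' _ _ _ hwaW d3
    refine start_core H hL hW hcol dgT ![v, w] ![a, a', c, d] ?_ ?_ ?_ dgY (by decide) ?_ dgE
      (by decide +kernel) ![2,2,1,2,3,4] (by rw [dgC]; decide) (by decide) ![7,7,6,6,6,6] ?_
      (by decide +kernel) 2 4 (by decide) (by decide)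
    · apply inj_of_pairwise
      intro i j hij
      fin_cases i <;> fin_cases j <;> first | (exact absurd hij (by decide)) | simpa using hvw
    · apply inj_of_pairwise
      intro i j hij
      fin_cases i <;> fin_cases j <;> first
        | (exact absurd hij (by decide))
        | (simp; first | assumption | (apply Ne.symm; assumption))
    · intro i j
      fin_cases i <;> fin_cases j <;> simp [dgT, c4, d4] <;>
        tauto
    · intro i
      fin_cases i <;> simpa [dgY]
    · intro i
      fin_cases i
      · exact nb_le_seven H _ (hW.1 hvcW)
      · exact nb_le_seven H _ (hW.1 hwdW)
      · exact six v w a hv hw hva2 hA1 hwa hvw hva2 hva' hwa hwa'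
      · exact six v w a' hv hw hva' hA2 hwa' hvw hva2 hva' hwa hwa'
      · exact six w v a hw hv hwa hA1 hva2 hvw.symm hwa hwa' hva2 hva'
      · exact six w v a' hw hv hwa' hA2 hva' hvw.symm hwa hwa' hva2 hva'

lemma start_triangle (H : Hyp23 G A B)
    {L : V × V → Finset ℕ} (hL : ∀ e ∈ ed23 G B, 6 ≤ (L e).card)
    {W : Finset (V × V)} (hW : Closed23 G B W) (hcol : ¬ ColU (conf23 G) L W)
    {u v w a b c : V} (huv : u ≠ v) (huw : u ≠ w) (hvw : v ≠ w)
    (ha : ∀ x, G.Adj x a ↔ x = v ∨ x = w)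
    (hb : ∀ x, G.Adj x b ↔ x = u ∨ x = w)
    (hc : ∀ x, G.Adj x c ↔ x = u ∨ x = v)
    (hyW : ∀ x y, G.Adj x y → (x = u ∨ x = v ∨ x = w) → (x, y) ∈ W) : Start23 G L W := by
  have hab : a ≠ b := by
    rintro rfl; have := (ha v).2 (Or.inl rfl); rw [hb] at this; grind
  have hac : a ≠ c := by
    rintro rfl; have := (ha w).2 (Or.inr rfl); rw [hc] at this; grind
  have hbc : b ≠ c := by
    rintro rfl; have := (hb w).2 (Or.inr rfl); rw [hc] at this; grind
  have hyW' : ∀ i, (![u, v, w] (trY i).1, ![a, b, c] (trY i).2) ∈ W := by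
    intro i
    fin_cases i <;> simp [trY] <;> apply hyW <;> simp [ha, hb, hc]
  refine start_core H hL hW hcol trT ![u, v, w] ![a, b, c] ?_ ?_ ?_ trY (by decide) hyW' trE
    (by decide +kernel) ![2,2,2,2,2,2] (by rw [trC]; decide) (by decide) (fun _ => 7)
    (fun i => nb_le_seven H _ (hW.1 (hyW' i)))
    (by decide +kernel) 0 5 (by decide) (by decide)
  · apply inj_of_pairwise
    intro i j hij
    fin_cases i <;> fin_cases j <;> first | (exact absurd hij (by decide)) | (simp; assumption)
  · apply inj_of_pairwise
    intro i j hij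
    fin_cases i <;> fin_cases j <;> first | (exact absurd hij (by decide)) | (simp; assumption)
  · intro i j
    fin_cases i <;> fin_cases j <;> simp [trT, ha, hb, hc] <;> grind

lemma start_claw (H : Hyp23 G A B)
    {L : V × V → Finset ℕ} (hL : ∀ e ∈ ed23 G B, 6 ≤ (L e).card)
    {W : Finset (V × V)} (hW : Closed23 G B W) (hcol : ¬ ColU (conf23 G) L W)
    (bs : Fin 6 → V) (as : Fin 5 → V) (hbs : Function.Injective bs)
    (has : Function.Injective as)
    (h0 : ∀ x, G.Adj x (as 0) ↔ x = bs 0 ∨ x = bs 1)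
    (h1 : ∀ x, G.Adj x (as 1) ↔ x = bs 0 ∨ x = bs 2)
    (h2 : ∀ x, G.Adj x (as 2) ↔ x = bs 0 ∨ x = bs 3)
    (h3 : ∀ x, G.Adj x (as 3) ↔ x = bs 1 ∨ x = bs 4)
    (h4 : ∀ x, G.Adj x (as 4) ↔ x = bs 1 ∨ x = bs 5)
    (hyW : ∀ x j, G.Adj x (as j) → (x, as j) ∈ W) : Start23 G L W := by
  have hyW' : ∀ i, (bs (dcY i).1, as (dcY i).2) ∈ W := by
    intro i
    apply hyW
    fin_cases i <;> simp [dcY, h0, h1, h2, h3, h4]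
  refine start_core H hL hW hcol dcT bs as hbs has ?_ dcY (by decide) hyW' dcE
    (by decide +kernel) ![0, 2, 1, 3, 5, 5, 2, 1, 3, 1] (by rw [dcC]; decide) (by decide)
    (fun _ => 7) (fun i => nb_le_seven H _ (hW.1 (hyW' i)))
    (by decide +kernel) 4 5 (by decide) (by decide)
  intro i j
  fin_cases j <;> simp only [Fin.reduceFinMk, Fin.zero_eta, Fin.mk_one, Fin.isValue, h0, h1, h2, h3, h4, hbs.eq_iff] <;> revert i <;> decide

end cores

lemma two_more {V : Type*} [Fintype V] {G : SimpleGraph V} {v a : V} (h : (nbf G v).card = 3)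
    (ha : G.Adj v a) : ∃ c d, c ≠ a ∧ d ≠ a ∧ c ≠ d ∧ G.Adj v c ∧ G.Adj v d := by
  classical
  have h1 : ((nbf G v).erase a).card = 2 := by
    rw [Finset.card_erase_of_mem (mem_nbf.2 ha), h]
  obtain ⟨c, d, hcd, hE⟩ := Finset.card_eq_two.1 h1
  have hc : c ∈ (nbf G v).erase a := by rw [hE]; simp
  have hd : d ∈ (nbf G v).erase a := by rw [hE]; simp
  rw [Finset.mem_erase, mem_nbf] at hc hd
  exact ⟨c, d, hc.1, hd.1, hcd, hc.2, hd.2⟩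

lemma start_all {V : Type*} [Fintype V] {G : SimpleGraph V} {A B : Set V} (H : Hyp23 G A B)
    {L : V × V → Finset ℕ} (hL : ∀ e ∈ ed23 G B, 6 ≤ (L e).card)
    (W : Finset (V × V)) (hW : Closed23 G B W) (hcol : ¬ ColU (conf23 G) L W) :
    Start23 G L W := by
  by_cases hreg : ∀ b a, (b, a) ∈ W → (nbf G b).card = 3 ∧ (nbf G a).card = 2
  swap
  · push Not at hreg
    obtain ⟨b, a, hba, h⟩ := hreg
    refine start_deficient H hL hW hcol hba ?_
    by_cases h3 : (nbf G b).card = 3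
    · exact Or.inr (h h3)
    · exact Or.inl h3
  have hmove : ∀ b a b', (b, a) ∈ W → G.Adj b' a → (b', a) ∈ W := by
    intro b a b' h h'
    by_cases e : b' = b
    · rw [e]; exact h
    obtain ⟨hb, hab⟩ := mem_ed23.1 (hW.1 h)
    exact hW.2 _ h _ (mem_ed23.2 ⟨H.ab a b' (H.ba b a hb hab) h'.symm, h'⟩)
      ⟨by simp [Ne.symm e], Or.inl hab⟩
  have hmove' : ∀ b a a', (b, a) ∈ W → G.Adj b a' → (b, a') ∈ W := by
    intro b a a' h h'
    by_cases e : a' = a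
    · rw [e]; exact h
    obtain ⟨hb, hab⟩ := mem_ed23.1 (hW.1 h)
    exact hW.2 _ h _ (mem_ed23.2 ⟨hb, h'⟩) ⟨by simp [Ne.symm e], Or.inl h'⟩
  by_cases hdig : ∃ v w a a', (v, a) ∈ W ∧ G.Adj w a ∧ G.Adj v a' ∧ G.Adj w a' ∧ v ≠ w ∧ a ≠ a'
  · obtain ⟨v, w, a, a', h1, h2, h3, h4, h5, h6⟩ := hdig
    exact start_digon H hL hW hcol hmove hmove' hreg h1 h2 h3 h4 h5 h6
  have nodig : ∀ v w a a', (v, a) ∈ W → G.Adj w a → G.Adj v a' → G.Adj w a' → v ≠ w →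
      a ≠ a' → False := fun v w a a' h1 h2 h3 h4 h5 h6 =>
    hdig ⟨v, w, a, a', h1, h2, h3, h4, h5, h6⟩
  have hne : W.Nonempty := by
    by_contra h
    rw [Finset.not_nonempty_iff_eq_empty] at h
    subst h
    exact hcol ⟨fun _ => 0, by simp, by simp⟩
  obtain ⟨⟨z, a0⟩, hz⟩ := hne
  have za0 := (mem_ed23.1 (hW.1 hz)).2
  obtain ⟨t, htz, ta0, N0⟩ := other (hreg _ _ hz).2 za0
  have ht := hmove _ _ _ hz ta0
  obtain ⟨a1, a2, n10, n20, n12, za1, za2⟩ := two_more (hreg _ _ hz).1 za0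
  obtain ⟨a3, a4, n30, n40, n34, ta3, ta4⟩ := two_more (hreg _ _ ht).1 ta0
  have hz1 := hmove' _ _ _ hz za1
  have hz2 := hmove' _ _ _ hz za2
  have ht3 := hmove' _ _ _ ht ta3
  have ht4 := hmove' _ _ _ ht ta4
  obtain ⟨w1, w1z, w1a, N1⟩ := other (hreg _ _ hz1).2 za1
  obtain ⟨w2, w2z, w2a, N2⟩ := other (hreg _ _ hz2).2 za2
  obtain ⟨w3, w3t, w3a, N3⟩ := other (hreg _ _ ht3).2 ta3
  obtain ⟨w4, w4t, w4a, N4⟩ := other (hreg _ _ ht4).2 ta4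
  have hz1' := hmove _ _ _ hz1 w1a
  have hz2' := hmove _ _ _ hz2 w2a
  -- generic exclusions
  have zt : ∀ a, a ≠ a0 → G.Adj z a → G.Adj t a → False := fun a h h1 h2 =>
    nodig z t a0 a hz ta0 h1 h2 htz.symm h.symm
  have w1t : w1 ≠ t := by rintro rfl; exact zt a1 n10 za1 w1a
  have w2t : w2 ≠ t := by rintro rfl; exact zt a2 n20 za2 w2a
  have w3z : w3 ≠ z := by rintro rfl; exact zt a3 n30 w3a ta3
  have w4z : w4 ≠ z := by rintro rfl; exact zt a4 n40 w4a ta4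
  have w12 : w1 ≠ w2 := by
    rintro rfl; exact nodig z w1 a1 a2 hz1 w1a za2 w2a w1z.symm n12
  have w34 : w3 ≠ w4 := by
    rintro rfl; exact nodig t w3 a3 a4 ht3 w3a ta4 w4a w3t.symm n34
  have tri : ∀ a b w, w ≠ z → w ≠ t → (w, b) ∈ W → (∀ x, G.Adj x a ↔ x = t ∨ x = w) →
      (∀ x, G.Adj x b ↔ x = z ∨ x = w) → Start23 G L W := by
    intro a b w hwz hwt hwW ha hb
    refine start_triangle H hL hW hcol htz.symm hwz.symm hwt.symm ha hb N0 ?_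
    rintro x y hxy (rfl | rfl | rfl)
    · exact hmove' _ _ _ hz hxy
    · exact hmove' _ _ _ ht hxy
    · exact hmove' _ _ _ hwW hxy
  by_cases w13 : w1 = w3
  · subst w13; exact tri a3 a1 w1 w1z w1t hz1' N3 N1
  by_cases w14 : w1 = w4
  · subst w14; exact tri a4 a1 w1 w1z w1t hz1' N4 N1
  by_cases w23 : w2 = w3
  · subst w23; exact tri a3 a2 w2 w2z w2t hz2' N3 N2
  by_cases w24 : w2 = w4
  · subst w24; exact tri a4 a2 w2 w2z w2t hz2' N4 N2
  have n13 : a1 ≠ a3 := by rintro rfl; exact zt a1 n10 za1 ta3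
  have n14 : a1 ≠ a4 := by rintro rfl; exact zt a1 n10 za1 ta4
  have n23 : a2 ≠ a3 := by rintro rfl; exact zt a2 n20 za2 ta3
  have n24 : a2 ≠ a4 := by rintro rfl; exact zt a2 n20 za2 ta4
  refine start_claw H hL hW hcol ![z, t, w1, w2, w3, w4] ![a0, a1, a2, a3, a4] ?_ ?_
    N0 N1 N2 N3 N4 ?_
  · apply inj_of_pairwise
    intro i j hij
    fin_cases i <;> fin_cases j <;> first
      | (exact absurd hij (by decide))
      | (simp; first | assumption | (apply Ne.symm; assumption))
  · apply inj_of_pairwise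
    intro i j hij
    fin_cases i <;> fin_cases j <;> first
      | (exact absurd hij (by decide))
      | (simp; first | assumption | (apply Ne.symm; assumption))
  · intro x j
    fin_cases j
    · exact fun h => hmove _ _ _ hz h
    · exact fun h => hmove _ _ _ hz1 h
    · exact fun h => hmove _ _ _ hz2 h
    · exact fun h => hmove _ _ _ ht3 h
    · exact fun h => hmove _ _ _ ht4 h

/-- Every (2,3)-bipartite simple graph has list strong chromatic index at most 6. Here a
(2,3)-bipartite graph is a bipartite graph with bipartition `(A, B)` where every vertex of `A`
has degree at most 2 and every vertex of `B` has degree at most 3. -/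
theorem listStrongChromaticIndex_le_six_of_two_three_bipartite {V : Type*} [Fintype V]
    (G : SimpleGraph V) (A B : Set V)
    (hcover : A ∪ B = Set.univ) (hdisj : Disjoint A B)
    (hbip : ∀ u v, G.Adj u v → (u ∈ A ∧ v ∈ B) ∨ (u ∈ B ∧ v ∈ A))
    (hA : ∀ v ∈ A, vdeg G v ≤ 2) (hB : ∀ v ∈ B, vdeg G v ≤ 3) :
    listStrongChromaticIndex G ≤ 6 := by
  classical
  have hdis : ∀ v, v ∈ A → v ∈ B → False := fun v h1 h2 => Set.disjoint_left.1 hdisj h1 h2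
  have hdeg : ∀ v, (nbf G v).card = vdeg G v := by
    intro v
    rw [vdeg, ← Set.ncard_coe_finset]
    congr 1
    ext w
    simp [mem_nbf]
  have H : Hyp23 G A B := by
    refine ⟨?_, ?_, hdis, fun a ha => (hdeg a).trans_le (hA a ha),
      fun b hb => (hdeg b).trans_le (hB b hb)⟩
    · intro b a hb h
      rcases hbip b a h with h | h
      · exact (hdis b h.1 hb).elim
      · exact h.2
    · intro a b ha h
      rcases hbip a b h with h | h
      · exact h.2
      · exact (hdis a ha h.1).elim
  apply Nat.sInf_le
  intro L hL
  obtain ⟨φ, h1, h2⟩ := col_of_start (L := fun e => L s(e.1, e.2)) H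
    (start_all H (by
      rintro ⟨b, a⟩ he
      exact hL _ (mem_ed23.1 he).2)) (ed23 G B) ⟨Finset.Subset.refl _, fun _ _ f hf _ => hf⟩
  have hrep : ∀ e ∈ G.edgeSet, ∃ p : V × V, p ∈ ed23 G B ∧ s(p.1, p.2) = e := by
    intro e
    induction e using Sym2.ind with
    | _ x y =>
      intro he
      have hxy : G.Adj x y := he
      rcases hbip x y hxy with h | h
      · exact ⟨(y, x), mem_ed23.2 ⟨h.2, hxy.symm⟩, Sym2.eq_swap⟩
      · exact ⟨(x, y), mem_ed23.2 ⟨h.1, hxy⟩, rfl⟩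
  have hrep' : ∀ e : Sym2 V, ∃ p : V × V, e ∈ G.edgeSet → p ∈ ed23 G B ∧ s(p.1, p.2) = e := by
    intro e
    by_cases he : e ∈ G.edgeSet
    · obtain ⟨p, hp⟩ := hrep e he
      exact ⟨p, fun _ => hp⟩
    · induction e using Sym2.ind with
      | _ x y => exact ⟨(x, y), fun h => (he h).elim⟩
  choose r hr using hrep'
  have hr1 := fun e he => (hr e he).1
  have hr2 := fun e he => (hr e he).2
  refine ⟨fun e => φ (r e), ?_, ?_⟩
  · intro e he
    have := h1 (r e) (hr1 e he)
    simp only [hr2 e he] at this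
    exact this
  · intro e f he hf hef hs
    refine h2 _ (hr1 e he) _ (hr1 f hf) ?_
    refine ⟨fun h => hef (by rw [← hr2 e he, ← hr2 f hf, h]), ?_⟩
    have p1 := hr1 e he
    have p2 := hr1 f hf
    rw [← hr2 e he, ← hr2 f hf] at hs
    generalize r e = p at *
    generalize r f = q at *
    obtain ⟨b, a⟩ := p
    obtain ⟨b', a'⟩ := q
    rw [mem_ed23] at p1 p2
    have ha := H.ba _ _ p1.1 p1.2
    have ha' := H.ba _ _ p2.1 p2.2
    simp only
    rcases hs with ⟨v, hv1, hv2⟩ | ⟨u, v, hu, hv, huv⟩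
    · simp only [Sym2.mem_iff] at hv1 hv2
      rcases hv1 with rfl | rfl <;> rcases hv2 with rfl | rfl
      · exact Or.inl p2.2
      · exact (hdis _ ha' p1.1).elim
      · exact (hdis _ ha p2.1).elim
      · exact Or.inl p1.2
    · simp only [Sym2.mem_iff] at hu hv
      rcases hu with rfl | rfl <;> rcases hv with rfl | rfl
      · exact (hdis _ (H.ba _ _ p1.1 huv) p2.1).elim
      · exact Or.inl huv
      · exact Or.inr huv.symm
      · exact (hdis _ ha' (H.ab _ _ ha huv)).elim
end

section
/- For every 2-connected cubic simple graph G, the incidence choice number satisfies ch_i(G) ≤ 6. -/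
/-- `(v, e)` is an incidence of the simple graph `G` when `e` is an edge of `G` and `v` is an
endpoint of `e`. -/
def IsIncidence {V : Type*} (G : SimpleGraph V) (v : V) (e : Sym2 V) : Prop :=
  e ∈ G.edgeSet ∧ v ∈ e

/-- Two incidences `(v, e)` and `(w, f)` are adjacent if `v = w`, or `e = f`, or the edge
joining `v` and `w` is `e` or `f`. -/
def IncAdj {V : Type*} (v : V) (e : Sym2 V) (w : V) (f : Sym2 V) : Prop :=
  v = w ∨ e = f ∨ s(v, w) = e ∨ s(v, w) = f

/-- `φ` is an incidence coloring of `G` choosing colors from the list assignment `L`. -/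
def IsIncListColoring {V : Type*} (G : SimpleGraph V) (L : V × Sym2 V → Finset ℕ)
    (φ : V × Sym2 V → ℕ) : Prop :=
  (∀ v e, IsIncidence G v e → φ (v, e) ∈ L (v, e)) ∧
  (∀ v e w f, IsIncidence G v e → IsIncidence G w f → (v, e) ≠ (w, f) → IncAdj v e w f →
    φ (v, e) ≠ φ (w, f))

/-- `G` is incidence `k`-choosable: for every assignment of lists of `k` colors to the
incidences of `G` there is an incidence coloring choosing colors from the lists. -/
def IncChoosable {V : Type*} (G : SimpleGraph V) (k : ℕ) : Prop :=
  ∀ L : V × Sym2 V → Finset ℕ, (∀ v e, IsIncidence G v e → (L (v, e)).card = k) →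
    ∃ φ, IsIncListColoring G L φ

/-- The incidence choice number of `G`: the least `k` such that `G` is incidence
`k`-choosable. -/
noncomputable def incChoiceNumber {V : Type*} (G : SimpleGraph V) : ℕ :=
  sInf {k | IncChoosable G k}

/-- A graph is 2-connected if it has at least 3 vertices, is connected, and deleting any
single vertex leaves it connected. -/
def TwoConnected {W : Type*} (H : SimpleGraph W) : Prop :=
  H.Connected ∧ 3 ≤ Nat.card W ∧ ∀ w : W, (H.induce {x | x ≠ w}).Connected

def SideOK (A A' B B' : Finset ℕ) (p q : ℕ) : Prop :=
  ∃ i ∈ A, ∃ i' ∈ A', ∃ o ∈ B, ∃ o' ∈ B', o ≠ o' ∧ i ≠ o ∧ i ≠ o' ∧ i' ≠ o ∧ i' ≠ o' ∧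
    i ≠ p ∧ i' ≠ p ∧ o ≠ p ∧ o' ≠ p ∧ o ≠ q ∧ o' ≠ q

def BadPair (A A' B B' : Finset ℕ) (p q : ℕ) : Prop :=
  B = B' ∧ (B \ {p, q} = A ∨ B \ {p, q} = A')

theorem pick_color (S T : Finset ℕ) (h : T.card < S.card) : ∃ x ∈ S, x ∉ T :=
  Finset.exists_mem_notMem_of_card_lt_card h

theorem sub_two (B : Finset ℕ) (p q : ℕ) (h : B.card = 4) : 2 ≤ (B \ {p, q}).card := by
  have := Finset.le_card_sdiff {p, q} B
  have := Finset.card_le_two (a := p) (b := q)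
  omega

theorem pair_eq_imp {a b c d : ℕ} (h : ({a, b} : Finset ℕ) = {c, d}) :
    (a = c ∧ b = d) ∨ (a = d ∧ b = c) := by
  have h1 : a ∈ ({c, d} : Finset ℕ) := h ▸ by simp
  have h2 : b ∈ ({c, d} : Finset ℕ) := h ▸ by simp
  have h3 : c ∈ ({a, b} : Finset ℕ) := h ▸ by simp
  have h4 : d ∈ ({a, b} : Finset ℕ) := h ▸ by simp
  simp only [Finset.mem_insert, Finset.mem_singleton] at h1 h2 h3 h4
  grind

theorem pair_or {o o' a1 a2 a3 a4 : ℕ} (h : ({o, o'} : Finset ℕ) ≠ {a1, a2} →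
    ({o, o'} : Finset ℕ) = {a3, a4}) : ((o = a1 ∧ o' = a2) ∨ (o = a2 ∧ o' = a1)) ∨
    ((o = a3 ∧ o' = a4) ∨ (o = a4 ∧ o' = a3)) := by
  by_cases hc : ({o, o'} : Finset ℕ) = {a1, a2}
  · exact Or.inl (pair_eq_imp hc)
  · exact Or.inr (pair_eq_imp (h hc))

/-- two representatives avoiding two given pairs -/
theorem pair_exists (A A' B B' : Finset ℕ) (hA : A.card = 2) (hA' : A'.card = 2)
    (hB : 2 ≤ B.card) (hB' : 2 ≤ B'.card) (h : ¬ (B = B' ∧ (B = A ∨ B = A'))) :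
    ∃ o ∈ B, ∃ o' ∈ B', o ≠ o' ∧ ({o, o'} : Finset ℕ) ≠ A ∧ ({o, o'} : Finset ℕ) ≠ A' := by
  obtain ⟨a1, a2, ha, rfl⟩ := Finset.card_eq_two.1 hA
  obtain ⟨a3, a4, ha', rfl⟩ := Finset.card_eq_two.1 hA'
  by_cases hBB : B = B'
  · subst hBB
    by_cases h3 : B.card = 2
    · obtain ⟨b1, b2, hb, rfl⟩ := Finset.card_eq_two.1 h3
      refine ⟨b1, by simp, b2, by simp, hb, ?_, ?_⟩ <;> tauto
    · obtain ⟨x, y, z, hx, hy, hz, h1, h2, h3⟩ := Finset.two_lt_card_iff.1 (show 2 < B.card by omega)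
      by_contra hc
      push Not at hc
      have e1 := pair_or (hc x hx y hy h1)
      have e2 := pair_or (hc x hx z hz h2)
      have e3 := pair_or (hc y hy z hz h3)
      clear hc h hA hA' hB hB'
      grind
  · have key : ∀ B B' : Finset ℕ, 2 ≤ B.card → 2 ≤ B'.card → (∃ x ∈ B, x ∉ B') →
        ∃ o ∈ B, ∃ o' ∈ B', o ≠ o' ∧ ({o, o'} : Finset ℕ) ≠ {a1, a2} ∧
          ({o, o'} : Finset ℕ) ≠ {a3, a4} := by
      rintro B B' h1 h2 ⟨x, hx, hx'⟩
      obtain ⟨y, hy, hxy⟩ := Finset.exists_mem_ne (show 1 < B.card by omega) x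
      obtain ⟨z, w, hz, hw, hzw⟩ := Finset.one_lt_card_iff.1 (show 1 < B'.card by omega)
      by_contra hc
      push Not at hc
      have e1 := fun hn => pair_or (hc x hx z hz hn)
      have e2 := fun hn => pair_or (hc x hx w hw hn)
      have e3 := fun hn => pair_or (hc y hy z hz hn)
      have e4 := fun hn => pair_or (hc y hy w hw hn)
      have : x ≠ z := by rintro rfl; exact hx' hz
      have : x ≠ w := by rintro rfl; exact hx' hw
      clear hc h hA hA' hB hB' h1 h2 hBB
      grind
    by_cases hs : B ⊆ B'
    · have : ∃ x ∈ B', x ∉ B := by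
        by_contra hc; push Not at hc; exact hBB (Finset.Subset.antisymm hs hc)
      obtain ⟨o, ho, o', ho', h1, h2, h3⟩ := key B' B hB' hB this
      exact ⟨o', ho', o, ho, h1.symm, by rwa [Finset.pair_comm], by rwa [Finset.pair_comm]⟩
    · exact key B B' hB hB' (Finset.not_subset.1 hs)

theorem side_ok (A A' B B' : Finset ℕ) (p q : ℕ) (hA : A.card = 2) (hA' : A'.card = 2)
    (hB : B.card = 4) (hB' : B'.card = 4) (hp : p ∉ A) (hp' : p ∉ A')
    (h : ¬ BadPair A A' B B' p q) : SideOK A A' B B' p q := by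
  have hne : ¬ (B \ {p, q} = B' \ {p, q} ∧ (B \ {p, q} = A ∨ B \ {p, q} = A')) := by
    rintro ⟨h1, h2⟩
    refine h ⟨?_, h2⟩
    have hc : (B \ {p, q}).card = 2 := by rcases h2 with h2 | h2 <;> rw [h2] <;> assumption
    have aux : ∀ E : Finset ℕ, E.card = 4 → (E \ {p, q}).card = 2 → ({p, q} : Finset ℕ) ⊆ E := by
      intro E h4 h2
      have e1 := Finset.card_sdiff_add_card_inter E {p, q}
      have e2 := Finset.card_le_two (a := p) (b := q)
      have e3 : E ∩ {p, q} = {p, q} :=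
        Finset.eq_of_subset_of_card_le Finset.inter_subset_right (by omega)
      exact Finset.inter_eq_right.1 e3
    have s1 := aux B hB hc
    have s2 := aux B' hB' (h1 ▸ hc)
    rw [← Finset.sdiff_union_of_subset s1, h1, Finset.sdiff_union_of_subset s2]
  obtain ⟨o, ho, o', ho', hoo, n1, n2⟩ := pair_exists A A' _ _ hA hA' (sub_two B p q hB)
    (sub_two B' p q hB') hne
  have aux : ∀ E : Finset ℕ, E.card = 2 → ({o, o'} : Finset ℕ) ≠ E → ∃ i ∈ E, i ≠ o ∧ i ≠ o' := by
    intro E hE hn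
    by_contra hc
    push Not at hc
    apply hn
    symm
    apply Finset.eq_of_subset_of_card_le
    · intro x hx
      have := hc x hx
      simp only [Finset.mem_insert, Finset.mem_singleton]; tauto
    · rw [hE]; exact Finset.card_le_two
  obtain ⟨i, hi, i1, i2⟩ := aux A hA n1
  obtain ⟨i', hi', i1', i2'⟩ := aux A' hA' n2
  simp only [Finset.mem_sdiff, Finset.mem_insert, Finset.mem_singleton, not_or] at ho ho'
  refine ⟨i, hi, i', hi', o, ho.1, o', ho'.1, hoo, i1, i2, i1', i2', ?_, ?_, ho.2.1, ho'.2.1,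
    ho.2.2, ho'.2.2⟩
  · rintro rfl; exact hp hi
  · rintro rfl; exact hp' hi'

theorem bad_eq (A B : Finset ℕ) (p q : ℕ) (hA : A.card = 2) (hB : B.card = 4)
    (h : B \ {p, q} = A) : A ⊆ B ∧ {p, q} = B \ A := by
  have e1 := Finset.card_sdiff_add_card_inter B {p, q}
  have e2 := Finset.card_le_two (a := p) (b := q)
  rw [h] at e1
  have e3 : B ∩ {p, q} = {p, q} :=
    Finset.eq_of_subset_of_card_le Finset.inter_subset_right (by omega)
  have e4 := Finset.inter_eq_right.1 e3
  subst h
  exact ⟨Finset.sdiff_subset, by rw [sdiff_sdiff_right_self]; exact e3.symm⟩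

/-- exceptional data -/
def Exc (P A A' B B' X : Finset ℕ) : Prop :=
  Disjoint A A' ∧ A ∪ A' ⊆ P ∧ B = B' ∧ (B = A ∪ X ∨ B = A' ∪ X)

theorem half (P A A' B B' : Finset ℕ) (hP : P.card = 6) (hA : A.card = 2) (hA' : A'.card = 2)
    (hB : B.card = 4) :
    ∃ T X : Finset ℕ, T ⊆ P \ (A ∪ A') ∧ 2 ≤ T.card ∧ X.card ≤ 2 ∧
      (∀ α ∈ T, ∀ β, BadPair A A' B B' α β → {α, β} = X) ∧
      (T = X → Exc P A A' B B' X) := by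
  have hu : (A ∪ A').card ≤ 4 := (Finset.card_union_le _ _).trans (by omega)
  have hT : 2 ≤ (P \ (A ∪ A')).card := by
    have := Finset.le_card_sdiff (A ∪ A') P
    omega
  have hempty : ∀ T : Finset ℕ, 2 ≤ T.card → T = ∅ → Exc P A A' B B' ∅ := by
    rintro T h rfl; simp at h
  by_cases hBB : B = B'
  swap
  · exact ⟨_, ∅, subset_rfl, hT, by simp, fun α _ β h => absurd h.1 hBB, hempty _ hT⟩
  by_cases h1 : A ⊆ B <;> by_cases h2 : A' ⊆ B
  · have hc : 2 ≤ (P \ B).card := by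
      have := Finset.le_card_sdiff B P
      omega
    refine ⟨P \ B, ∅, Finset.sdiff_subset_sdiff subset_rfl (Finset.union_subset h1 h2), hc,
      by simp, ?_, hempty _ hc⟩
    rintro α hα β ⟨-, h⟩
    have : {α, β} ⊆ B := by
      rcases h with h | h
      · rw [(bad_eq A B α β hA hB h).2]; exact Finset.sdiff_subset
      · rw [(bad_eq A' B α β hA' hB h).2]; exact Finset.sdiff_subset
    exact absurd (this (by simp)) (Finset.mem_sdiff.1 hα).2
  · refine ⟨_, B \ A, subset_rfl, hT, ?_, ?_, ?_⟩
    · rw [Finset.card_sdiff_of_subset h1]; omega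
    · rintro α hα β ⟨-, h | h⟩
      · exact (bad_eq A B α β hA hB h).2
      · exact absurd (bad_eq A' B α β hA' hB h).1 h2
    · intro h
      have h4 : 4 ≤ (A ∪ A').card := by
        have := Finset.le_card_sdiff (A ∪ A') P
        rw [h, Finset.card_sdiff_of_subset h1] at this; omega
      refine ⟨?_, ?_, hBB, Or.inl (Finset.union_sdiff_of_subset h1).symm⟩
      · have := Finset.card_union_add_card_inter A A'
        exact Finset.disjoint_iff_inter_eq_empty.2 (Finset.card_eq_zero.1 (by omega))
      · have e1 := Finset.card_sdiff_add_card_inter P (A ∪ A')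
        rw [h, Finset.card_sdiff_of_subset h1] at e1
        exact Finset.inter_eq_right.1
          (Finset.eq_of_subset_of_card_le Finset.inter_subset_right (by omega))
  · refine ⟨_, B \ A', subset_rfl, hT, ?_, ?_, ?_⟩
    · rw [Finset.card_sdiff_of_subset h2]; omega
    · rintro α hα β ⟨-, h | h⟩
      · exact absurd (bad_eq A B α β hA hB h).1 h1
      · exact (bad_eq A' B α β hA' hB h).2
    · intro h
      have h4 : 4 ≤ (A ∪ A').card := by
        have := Finset.le_card_sdiff (A ∪ A') P
        rw [h, Finset.card_sdiff_of_subset h2] at this; omega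
      refine ⟨?_, ?_, hBB, Or.inr (Finset.union_sdiff_of_subset h2).symm⟩
      · have := Finset.card_union_add_card_inter A A'
        exact Finset.disjoint_iff_inter_eq_empty.2 (Finset.card_eq_zero.1 (by omega))
      · have e1 := Finset.card_sdiff_add_card_inter P (A ∪ A')
        rw [h, Finset.card_sdiff_of_subset h2] at e1
        exact Finset.inter_eq_right.1
          (Finset.eq_of_subset_of_card_le Finset.inter_subset_right (by omega))
  · refine ⟨_, ∅, subset_rfl, hT, by simp, ?_, hempty _ hT⟩
    rintro α hα β ⟨-, h | h⟩
    · exact absurd (bad_eq A B α β hA hB h).1 h1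
    · exact absurd (bad_eq A' B α β hA' hB h).1 h2

theorem select (T1 T2 X1 X2 : Finset ℕ) (h1 : 2 ≤ T1.card) (h2 : 2 ≤ T2.card)
    (hX1 : X1.card ≤ 2) (hX2 : X2.card ≤ 2) :
    (∃ α ∈ T1, ∃ β ∈ T2, α ≠ β ∧ ({α, β} : Finset ℕ) ≠ X1 ∧ ({α, β} : Finset ℕ) ≠ X2) ∨
      (T1 = T2 ∧ (T1 = X1 ∨ T1 = X2)) := by
  have fin : ∀ X : Finset ℕ, X.card ≤ 2 → ∃ Y : Finset ℕ, Y.card = 2 ∧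
      (∀ α β : ℕ, α ≠ β → {α, β} = X → {α, β} = Y) ∧ (X.card = 2 → X = Y) := by
    intro X hX
    by_cases h : X.card = 2
    · exact ⟨X, h, fun _ _ _ h => h, fun _ => rfl⟩
    · refine ⟨{0, 1}, by simp, fun α β hab he => ?_, fun h' => absurd h' h⟩
      rw [← he, Finset.card_pair hab] at h; exact absurd rfl h
  by_cases h : T1 = T2 ∧ (T1 = X1 ∨ T1 = X2)
  · exact Or.inr h
  left
  obtain ⟨Y1, c1, d1, e1⟩ := fin X1 hX1
  obtain ⟨Y2, c2, d2, e2⟩ := fin X2 hX2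
  by_cases h' : T1 = T2 ∧ (T1 = Y1 ∨ T1 = Y2)
  · obtain ⟨rfl, h'⟩ := h'
    have h2 : T1.card = 2 := by rcases h' with h' | h' <;> rw [h'] <;> assumption
    obtain ⟨u, v, huv, rfl⟩ := Finset.card_eq_two.1 h2
    simp only [true_and, not_or] at h
    exact ⟨u, by simp, v, by simp, huv, h.1, h.2⟩
  · obtain ⟨α, ha, β, hb, hab, n1, n2⟩ := pair_exists Y1 Y2 T1 T2 c1 c2 h1 h2 h'
    exact ⟨α, ha, β, hb, hab, fun he => n1 (d1 _ _ hab he), fun he => n2 (d2 _ _ hab he)⟩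

theorem exc_one (P Q A A' B B' C C' D D' X : Finset ℕ)
    (hA : A.card = 2) (hA' : A'.card = 2)
    (hC : C.card = 2) (hC' : C'.card = 2) (hD : D.card = 4) (hD' : D'.card = 4)
    (hX : 2 ≤ X.card)
    (hXP : X ⊆ P \ (A ∪ A')) (hXQ : X ⊆ Q \ (C ∪ C'))
    (hdis : Disjoint A A') (hsub : A ∪ A' ⊆ P) (hBB : B = B') (hBX : B = A ∪ X) :
    ∃ p ∈ P, ∃ q ∈ Q, p ≠ q ∧ SideOK A A' B B' p q ∧ SideOK C C' D D' q p := by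
  obtain ⟨a1, a2, ha, rfl⟩ := Finset.card_eq_two.1 hA
  obtain ⟨c, d, hcd, rfl⟩ := Finset.card_eq_two.1 hA'
  obtain ⟨u, v, hu, hv, huv⟩ := Finset.one_lt_card_iff.1 (show 1 < X.card by omega)
  have key : ∀ β γ, β ∈ X → γ ∈ X → β ≠ γ → ¬ BadPair C C' D D' β c →
      ∃ p ∈ P, ∃ q ∈ Q, p ≠ q ∧ SideOK {a1, a2} {c, d} B B' p q ∧ SideOK C C' D D' q p := by
    intro β γ hβ hγ hne hbad
    have q1 := hXP hβ
    have q2 := hXP hγ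
    have q3 := hXQ hβ
    have q4 := hXQ hγ
    simp only [Finset.mem_sdiff, Finset.mem_union, Finset.mem_insert, Finset.mem_singleton,
      not_or] at q1 q2 q3 q4
    simp only [Finset.disjoint_insert_left, Finset.disjoint_singleton_left, Finset.mem_insert,
      Finset.mem_singleton, not_or] at hdis
    refine ⟨c, hsub (by simp), β, q3.1, by tauto, ?_,
      side_ok C C' D D' β c hC hC' hD hD' q3.2.1 q3.2.2 hbad⟩
    subst hBB
    refine ⟨a1, by simp, d, by simp, γ, by simp [hBX, hγ], a2, by simp [hBX], ?_⟩
    grind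
  by_cases hb : BadPair C C' D D' u c
  · refine key v u hv hu huv.symm ?_
    intro hb'
    have m1 : ∀ β, BadPair C C' D D' β c → {β, c} ⊆ D ∧ (∀ x ∈ D, x = β ∨ x = c ∨ x ∈ C ∪ C') := by
      rintro β ⟨-, h | h⟩
      · have := (bad_eq C D β c hC hD h).2
        refine ⟨this ▸ Finset.sdiff_subset, fun x hx => ?_⟩
        rw [← h]; grind
      · have := (bad_eq C' D β c hC' hD h).2
        refine ⟨this ▸ Finset.sdiff_subset, fun x hx => ?_⟩
        rw [← h]; grind
    have := (m1 u hb).2 v ((m1 v hb').1 (by simp))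
    have q1 := hXP hv
    have q3 := hXQ hv
    simp only [Finset.mem_sdiff, Finset.mem_insert, Finset.mem_singleton, Finset.mem_union,
      not_or] at q1 q3 this
    grind
  · exact key u v hu hv huv hb

theorem SideOK.swap {A A' B B' : Finset ℕ} {p q : ℕ} (h : SideOK A' A B B' p q) :
    SideOK A A' B B' p q := by
  obtain ⟨i, hi, i', hi', o, ho, o', ho', h⟩ := h
  exact ⟨i', hi', i, hi, o, ho, o', ho', by tauto⟩

theorem exc_two (P Q A A' B B' C C' D D' X : Finset ℕ)
    (hA : A.card = 2) (hA' : A'.card = 2)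
    (hC : C.card = 2) (hC' : C'.card = 2) (hD : D.card = 4) (hD' : D'.card = 4)
    (hX : 2 ≤ X.card)
    (hXP : X ⊆ P \ (A ∪ A')) (hXQ : X ⊆ Q \ (C ∪ C')) (h : Exc P A A' B B' X) :
    ∃ p ∈ P, ∃ q ∈ Q, p ≠ q ∧ SideOK A A' B B' p q ∧ SideOK C C' D D' q p := by
  obtain ⟨h1, h2, h3, h4 | h4⟩ := h
  · exact exc_one P Q A A' B B' C C' D D' X hA hA' hC hC' hD hD' hX hXP hXQ h1 h2 h3 h4
  · obtain ⟨p, hp, q, hq, hne, s1, s2⟩ := exc_one P Q A' A B B' C C' D D' X hA' hA hC hC' hD hD'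
      hX (by rwa [Finset.union_comm]) hXQ h1.symm (by rwa [Finset.union_comm]) h3 h4
    exact ⟨p, hp, q, hq, hne, s1.swap, s2⟩

theorem double_star (P Q A A' B B' C C' D D' : Finset ℕ)
    (hP : P.card = 6) (hQ : Q.card = 6)
    (hA : A.card = 2) (hA' : A'.card = 2) (hB : B.card = 4) (hB' : B'.card = 4)
    (hC : C.card = 2) (hC' : C'.card = 2) (hD : D.card = 4) (hD' : D'.card = 4) :
    ∃ p ∈ P, ∃ q ∈ Q, p ≠ q ∧ SideOK A A' B B' p q ∧ SideOK C C' D D' q p := by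
  obtain ⟨T1, X1, t1, k1, x1, b1, e1⟩ := half P A A' B B' hP hA hA' hB
  obtain ⟨T2, X2, t2, k2, x2, b2, e2⟩ := half Q C C' D D' hQ hC hC' hD
  rcases select T1 T2 X1 X2 k1 k2 x1 x2 with ⟨α, ha, β, hb, hne, n1, n2⟩ | ⟨rfl, rfl | rfl⟩
  · have m1 := t1 ha
    have m2 := t2 hb
    simp only [Finset.mem_sdiff, Finset.mem_union, not_or] at m1 m2
    refine ⟨α, m1.1, β, m2.1, hne,
      side_ok _ _ _ _ _ _ hA hA' hB hB' m1.2.1 m1.2.2 fun h => n1 (b1 α ha β h),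
      side_ok _ _ _ _ _ _ hC hC' hD hD' m2.2.1 m2.2.2 fun h => n2 ?_⟩
    rw [Finset.pair_comm]; exact b2 β hb α h
  · exact exc_two P Q A A' B B' C C' D D' T1 hA hA' hC hC' hD hD' k1 t1 t2 (e1 rfl)
  · obtain ⟨p, hp, q, hq, hne, s1, s2⟩ :=
      exc_two Q P C C' D D' A A' B B' T1 hC hC' hA hA' hB hB' k1 t2 t1 (e2 rfl)
    exact ⟨q, hq, p, hp, hne.symm, s2, s1⟩

theorem double_star' (P Q A A' B B' C C' D D' : Finset ℕ)
    (hP : 6 ≤ P.card) (hQ : 6 ≤ Q.card)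
    (hA : 2 ≤ A.card) (hA' : 2 ≤ A'.card) (hB : 4 ≤ B.card) (hB' : 4 ≤ B'.card)
    (hC : 2 ≤ C.card) (hC' : 2 ≤ C'.card) (hD : 4 ≤ D.card) (hD' : 4 ≤ D'.card) :
    ∃ p ∈ P, ∃ q ∈ Q, p ≠ q ∧ SideOK A A' B B' p q ∧ SideOK C C' D D' q p := by
  have mono : ∀ {A A' B B' : Finset ℕ} {A1 A1' B1 B1' : Finset ℕ} {p q : ℕ}, A1 ⊆ A → A1' ⊆ A' →
      B1 ⊆ B → B1' ⊆ B' → SideOK A1 A1' B1 B1' p q → SideOK A A' B B' p q := by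
    rintro A A' B B' A1 A1' B1 B1' p q s1 s2 s3 s4 ⟨i, hi, i', hi', o, ho, o', ho', h⟩
    exact ⟨i, s1 hi, i', s2 hi', o, s3 ho, o', s4 ho', h⟩
  obtain ⟨P1, sP, cP⟩ := Finset.exists_subset_card_eq hP
  obtain ⟨Q1, sQ, cQ⟩ := Finset.exists_subset_card_eq hQ
  obtain ⟨A1, sA, cA⟩ := Finset.exists_subset_card_eq hA
  obtain ⟨A2, sA', cA'⟩ := Finset.exists_subset_card_eq hA'
  obtain ⟨B1, sB, cB⟩ := Finset.exists_subset_card_eq hB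
  obtain ⟨B2, sB', cB'⟩ := Finset.exists_subset_card_eq hB'
  obtain ⟨C1, sC, cC⟩ := Finset.exists_subset_card_eq hC
  obtain ⟨C2, sC', cC'⟩ := Finset.exists_subset_card_eq hC'
  obtain ⟨D1, sD, cD⟩ := Finset.exists_subset_card_eq hD
  obtain ⟨D2, sD', cD'⟩ := Finset.exists_subset_card_eq hD'
  obtain ⟨p, hp, q, hq, hne, s1, s2⟩ :=
    double_star P1 Q1 A1 A2 B1 B2 C1 C2 D1 D2 cP cQ cA cA' cB cB' cC cC' cD cD'
  exact ⟨p, sP hp, q, sQ hq, hne, mono sA sA' sB sB' s1, mono sC sC' sD sD' s2⟩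

theorem four_cycle (W X Y Z : Finset ℕ) (hW : 2 ≤ W.card) (hX : 2 ≤ X.card) (hY : 2 ≤ Y.card)
    (hZ : 2 ≤ Z.card) : ∃ w ∈ W, ∃ x ∈ X, ∃ y ∈ Y, ∃ z ∈ Z, w ≠ x ∧ x ≠ y ∧ y ≠ z ∧ z ≠ w := by
  by_cases h : ∃ c ∈ X, c ∈ Z
  · obtain ⟨c, hc, hc'⟩ := h
    obtain ⟨w, hw, hwc⟩ := Finset.exists_mem_ne (show 1 < W.card by omega) c
    obtain ⟨y, hy, hyc⟩ := Finset.exists_mem_ne (show 1 < Y.card by omega) c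
    exact ⟨w, hw, c, hc, y, hy, c, hc', hwc, hyc.symm, hyc, hwc.symm⟩
  · push Not at h
    obtain ⟨W1, sW, cW⟩ := Finset.exists_subset_card_eq hW
    obtain ⟨Y1, sY, cY⟩ := Finset.exists_subset_card_eq hY
    have hne : ¬ (X = Z ∧ (X = W1 ∨ X = Y1)) := by
      rintro ⟨rfl, -⟩
      obtain ⟨x, hx⟩ := Finset.card_pos.1 (show 0 < X.card by omega)
      exact h x hx hx
    obtain ⟨x, hx, z, hz, hxz, n1, n2⟩ := pair_exists W1 Y1 X Z cW cY hX hZ hne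
    have aux : ∀ E : Finset ℕ, E.card = 2 → ({x, z} : Finset ℕ) ≠ E → ∃ i ∈ E, i ≠ x ∧ i ≠ z := by
      intro E hE hn
      by_contra hc
      push Not at hc
      apply hn
      symm
      apply Finset.eq_of_subset_of_card_le
      · intro x hx
        have := hc x hx
        simp only [Finset.mem_insert, Finset.mem_singleton]; tauto
      · rw [hE]; exact Finset.card_le_two
    obtain ⟨w, hw, w1, w2⟩ := aux W1 cW n1
    obtain ⟨y, hy, y1, y2⟩ := aux Y1 cY n2
    exact ⟨w, sW hw, x, hx, y, sY hy, z, hz, w1, y1.symm, y2, w2.symm⟩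

/-- The list problem written on arcs. -/
def ArcCol {V : Type*} (E : V → V → Prop) (L : V → V → Finset ℕ) : Prop :=
  ∃ col : V → V → ℕ, (∀ u x, E u x → col u x ∈ L u x) ∧
    ∀ u x v y, E u x → E v y → ¬ (u = v ∧ x = y) → (u = v ∨ x = v ∨ y = u) → col u x ≠ col v y

theorem sub_four (S : Finset ℕ) (a b c d : ℕ) (h : S.card = 6) :
    2 ≤ (S \ {a, b, c, d}).card := by
  have := Finset.le_card_sdiff {a, b, c, d} S
  have := Finset.card_le_four (a := a) (b := b) (c := c) (d := d)
  omega

theorem k4_shared {V : Type*} (L : V → V → Finset ℕ) (hL : ∀ u x, u ≠ x → (L u x).card = 6)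
    (v1 v2 v3 v4 : V) (h12 : v1 ≠ v2) (h13 : v1 ≠ v3) (h14 : v1 ≠ v4) (h23 : v2 ≠ v3)
    (h24 : v2 ≠ v4) (h34 : v3 ≠ v4) (hall : ∀ x, x = v1 ∨ x = v2 ∨ x = v3 ∨ x = v4)
    (c : ℕ) (hc1 : c ∈ L v1 v4) (hc2 : c ∈ L v2 v4) : ArcCol (fun u x : V => u ≠ x) L := by
  classical
  have pk : ∀ (S : Finset ℕ) (a b d e g : ℕ), S.card = 6 →
      ∃ x ∈ S, x ≠ a ∧ x ≠ b ∧ x ≠ d ∧ x ≠ e ∧ x ≠ g := by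
    intro S a b d e g hS
    obtain ⟨x, hx, hx'⟩ := pick_color S {a, b, d, e, g}
      (by have := Finset.card_le_five (a := a) (b := b) (c := d) (d := e) (e := g); omega)
    exact ⟨x, hx, by simpa using hx'⟩
  obtain ⟨c34, m34, p34⟩ := pk (L v3 v4) c c c c c (hL _ _ h34)
  obtain ⟨c13, m13, p13⟩ := pk (L v1 v3) c c c c c34 (hL _ _ h13)
  obtain ⟨c23, m23, p23⟩ := pk (L v2 v3) c c c c c34 (hL _ _ h23)
  obtain ⟨c31, m31, p31⟩ := pk (L v3 v1) c34 c13 c23 c c (hL _ _ h13.symm)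
  obtain ⟨c32, m32, p32⟩ := pk (L v3 v2) c34 c31 c13 c23 c (hL _ _ h23.symm)
  obtain ⟨c43, m43, p43⟩ := pk (L v4 v3) c31 c32 c34 c c (hL _ _ h34.symm)
  obtain ⟨c12, m12, c21, m21, c42, m42, c41, m41, q1, q2, q3, q4⟩ := four_cycle
    (L v1 v2 \ {c13, c, c23, c31}) (L v2 v1 \ {c23, c, c13, c32})
    (L v4 v2 \ {c43, c23, c34, c}) (L v4 v1 \ {c43, c13, c34, c})
    (sub_four _ _ _ _ _ (hL _ _ h12)) (sub_four _ _ _ _ _ (hL _ _ h12.symm))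
    (sub_four _ _ _ _ _ (hL _ _ h24.symm)) (sub_four _ _ _ _ _ (hL _ _ h14.symm))
  simp only [Finset.mem_sdiff, Finset.mem_insert, Finset.mem_singleton, not_or] at m12 m21 m42 m41
  have ex : ∃ col : V → V → ℕ, col v1 v2 = c12 ∧ col v1 v3 = c13 ∧ col v1 v4 = c ∧
      col v2 v1 = c21 ∧ col v2 v3 = c23 ∧ col v2 v4 = c ∧ col v3 v1 = c31 ∧ col v3 v2 = c32 ∧
      col v3 v4 = c34 ∧ col v4 v1 = c41 ∧ col v4 v2 = c42 ∧ col v4 v3 = c43 := by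
    refine ⟨fun u x => if u = v1 then (if x = v2 then c12 else if x = v3 then c13 else c) else
      if u = v2 then (if x = v1 then c21 else if x = v3 then c23 else c) else
      if u = v3 then (if x = v1 then c31 else if x = v2 then c32 else c34) else
      (if x = v1 then c41 else if x = v2 then c42 else c43), ?_⟩
    simp [h12.symm, h13.symm, h14.symm, h23.symm, h24.symm, h34.symm]
  obtain ⟨r1, -, -, -, -⟩ := p34
  obtain ⟨r2, -, -, -, r3⟩ := p13
  obtain ⟨r4, -, -, -, r5⟩ := p23
  obtain ⟨r6, r7, r8, r9, -⟩ := p31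
  obtain ⟨r10, r11, r12, r13, r14⟩ := p32
  obtain ⟨r15, r16, r17, r18, -⟩ := p43
  obtain ⟨m12, s1, s2, s3, s4⟩ := m12
  obtain ⟨m21, s5, s6, s7, s8⟩ := m21
  obtain ⟨m42, s9, s10, s11, s12⟩ := m42
  obtain ⟨m41, s13, s14, s15, s16⟩ := m41
  obtain ⟨col, e12, e13, e14, e21, e23, e24, e31, e32, e34, e41, e42, e43⟩ := ex
  refine ⟨col, ?_, ?_⟩
  · intro u x hux
    rcases hall u with rfl | rfl | rfl | rfl <;> rcases hall x with rfl | rfl | rfl | rfl <;>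
      first | exact absurd rfl hux | simp only [*]
  · have outs : ∀ u x y, u ≠ x → u ≠ y → x ≠ y → col u x ≠ col u y := by
      intro u x y h1 h2 h3
      rcases hall u with rfl | rfl | rfl | rfl <;> rcases hall x with rfl | rfl | rfl | rfl <;>
      rcases hall y with rfl | rfl | rfl | rfl <;>
      first | exact absurd rfl h1 | exact absurd rfl h2 | exact absurd rfl h3 | skip
      all_goals simp only [*, ne_eq, not_false_eq_true]; (first | done | (apply Ne.symm; assumption))
    have thr : ∀ u x y, u ≠ x → x ≠ y → col u x ≠ col x y := by
      intro u x y h1 h2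
      rcases hall u with rfl | rfl | rfl | rfl <;> rcases hall x with rfl | rfl | rfl | rfl <;>
      rcases hall y with rfl | rfl | rfl | rfl <;>
      first | exact absurd rfl h1 | exact absurd rfl h2 | skip
      all_goals simp only [*, ne_eq, not_false_eq_true]; (first | done | (apply Ne.symm; assumption))
    rintro u x v y h1 h2 h3 (rfl | rfl | rfl)
    · exact outs u x y h1 h2 (fun h => h3 ⟨rfl, h⟩)
    · exact thr u x y h1 h2
    · exact (thr v y x h2 h1).symm

theorem k4_case {V : Type*} (L : V → V → Finset ℕ) (hL : ∀ u x, u ≠ x → (L u x).card = 6)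
    (v1 v2 v3 v4 : V) (h12 : v1 ≠ v2) (h13 : v1 ≠ v3) (h14 : v1 ≠ v4) (h23 : v2 ≠ v3)
    (h24 : v2 ≠ v4) (h34 : v3 ≠ v4) (hall : ∀ x, x = v1 ∨ x = v2 ∨ x = v3 ∨ x = v4) :
    ArcCol (fun u x : V => u ≠ x) L := by
  classical
  by_cases hs : ∃ u w h c, u ≠ h ∧ w ≠ h ∧ u ≠ w ∧ c ∈ L u h ∧ c ∈ L w h
  · obtain ⟨u, w, h, c, a1, a2, a3, a4, a5⟩ := hs
    have : ∃ z, z ≠ u ∧ z ≠ w ∧ z ≠ h ∧ ∀ x, x = u ∨ x = w ∨ x = z ∨ x = h := by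
      have hT : ∀ x, x ∈ ({v1, v2, v3, v4} : Finset V) := fun x => by simpa using hall x
      have cT : ({v1, v2, v3, v4} : Finset V).card = 4 := by
        simp [h12, h13, h14, h23, h24, h34]
      obtain ⟨z, hz, hz'⟩ := Finset.exists_mem_notMem_of_card_lt_card
        (show ({u, w, h} : Finset V).card < ({v1, v2, v3, v4} : Finset V).card by
          have := Finset.card_le_three (a := u) (b := w) (c := h); omega)
      simp only [Finset.mem_insert, Finset.mem_singleton, not_or] at hz'
      refine ⟨z, hz'.1, hz'.2.1, hz'.2.2, fun x => ?_⟩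
      have c4 : ({u, w, z, h} : Finset V).card = 4 := by
        simp [a1, a2, a3, hz'.2.2, Ne.symm hz'.1, Ne.symm hz'.2.1]
      have := Finset.eq_of_subset_of_card_le (s := ({u, w, z, h} : Finset V))
        (t := {v1, v2, v3, v4}) (fun x _ => hT x) (by omega)
      have hx := hT x
      rw [← this] at hx
      simpa using hx
    obtain ⟨z, z1, z2, z3, z4⟩ := this
    exact k4_shared L hL u w z h a3 z1.symm a1 z2.symm a2 z3 z4 c a4 a5
  · push Not at hs
    let t : {a : V × V // a.1 ≠ a.2} → Finset ℕ := fun a => L a.1.1 a.1.2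
    have hcol : ∀ s : Finset {a : V × V // a.1 ≠ a.2}, s.card ≤ (s.biUnion t).card := by
      intro s
      have key := Finset.card_mul_le_card_mul (s := s) (t := s.biUnion t) (m := 6) (n := 4)
        (fun a c => c ∈ t a) ?_ ?_
      · omega
      · intro a ha
        have : Finset.bipartiteAbove (fun a c => c ∈ t a) (s.biUnion t) a = t a := by
          ext c
          simp only [Finset.mem_bipartiteAbove, Finset.mem_biUnion]
          exact ⟨fun h => h.2, fun h => ⟨⟨a, ha, h⟩, h⟩⟩
        rw [this, hL _ _ a.2]
      · intro c hc
        have h4 : ({v1, v2, v3, v4} : Finset V).card ≤ 4 := Finset.card_le_four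
        refine le_trans (Finset.card_le_card_of_injOn (fun a => a.1.2) ?_ ?_) h4
        · intro a _
          have := hall a.1.2
          simpa using this
        · intro a ha b hb hab
          simp only [Finset.mem_coe, Finset.mem_bipartiteBelow] at ha hb
          by_contra hne
          have hab' : a.1.2 = b.1.2 := hab
          have n1 : a.1.1 ≠ b.1.1 := fun h => hne (Subtype.ext (Prod.ext h hab'))
          refine hs a.1.1 b.1.1 a.1.2 c a.2 (hab' ▸ b.2) n1 ha.2 ?_
          rw [hab']; exact hb.2
    obtain ⟨f, hf, hm⟩ := (Finset.all_card_le_biUnion_card_iff_exists_injective t).1 hcol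
    refine ⟨fun u x => if h : u ≠ x then f ⟨(u, x), h⟩ else 0, ?_, ?_⟩
    · intro u x h
      simp only [dif_pos h]
      exact hm ⟨(u, x), h⟩
    · intro u x v y h1 h2 h3 _
      simp only [dif_pos h1, dif_pos h2]
      intro he
      have := hf he
      simp only [Subtype.mk.injEq, Prod.mk.injEq] at this
      exact h3 this

theorem greedy_color {α : Type*} [DecidableEq α] (R : α → α → Prop) (hR : ∀ a b, R a b → R b a)
    (L : α → Finset ℕ) (r : α → ℕ) (N : α → Finset α) (S : Finset α)
    (hN : ∀ a ∈ S, (N a).card < (L a).card)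
    (hc : ∀ a ∈ S, ∀ b ∈ S, b ≠ a → R a b → r a ≤ r b → b ∈ N a) :
    ∃ f : α → ℕ, (∀ a ∈ S, f a ∈ L a) ∧ ∀ a ∈ S, ∀ b ∈ S, a ≠ b → R a b → f a ≠ f b := by
  induction S using Finset.strongInduction with
  | H S ih =>
    rcases S.eq_empty_or_nonempty with rfl | hne
    · exact ⟨fun _ => 0, by simp, by simp⟩
    obtain ⟨a, ha, hmin⟩ := Finset.exists_min_image S r hne
    obtain ⟨f, f1, f2⟩ := ih (S.erase a) (Finset.erase_ssubset ha)
      (fun b hb => hN b (Finset.mem_of_mem_erase hb))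
      (fun b hb d hd => hc b (Finset.mem_of_mem_erase hb) d (Finset.mem_of_mem_erase hd))
    obtain ⟨x, hx, hx'⟩ := pick_color (L a) ((N a).image f)
      (lt_of_le_of_lt Finset.card_image_le (hN a ha))
    have hxa : ∀ b ∈ S, b ≠ a → R a b → x ≠ f b := by
      rintro b hb hba hab rfl
      exact hx' (Finset.mem_image_of_mem f (hc a ha b hb hba hab (hmin b hb)))
    refine ⟨Function.update f a x, ?_, ?_⟩
    · intro b hb
      by_cases h : b = a
      · subst h; simpa using hx
      · rw [Function.update_of_ne h]; exact f1 b (Finset.mem_erase.2 ⟨h, hb⟩)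
    · intro b hb d hd hbd hRbd
      by_cases h : b = a
      · subst h
        rw [Function.update_self, Function.update_of_ne hbd.symm]
        exact hxa d hd hbd.symm hRbd
      · by_cases h' : d = a
        · subst h'
          rw [Function.update_self, Function.update_of_ne h]
          exact (hxa b hb h (hR _ _ hRbd)).symm
        · rw [Function.update_of_ne h, Function.update_of_ne h']
          exact f2 b (Finset.mem_erase.2 ⟨h, hb⟩) d (Finset.mem_erase.2 ⟨h', hd⟩) hbd hRbd

theorem exists_parent {V : Type*} (G : SimpleGraph V) (hG : G.Connected) (s u : V) (h : u ≠ s) :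
    ∃ w, G.Adj u w ∧ G.dist w s < G.dist u s := by
  obtain ⟨p, hp⟩ := (hG u s).exists_walk_length_eq_dist
  cases p with
  | nil => exact absurd rfl h
  | cons hadj q =>
    refine ⟨_, hadj, ?_⟩
    have := SimpleGraph.dist_le q
    rw [SimpleGraph.Walk.length_cons] at hp
    omega

theorem outside {V : Type*} [Fintype V] (G : SimpleGraph V) (hG : G.Connected)
    (hN : ∀ v w, G.Adj v w → ∃ a b, a ≠ b ∧ a ≠ w ∧ b ≠ w ∧ ∀ x, G.Adj v x ↔ x = w ∨ x = a ∨ x = b)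
    (L : V → V → Finset ℕ) (hL : ∀ u x, G.Adj u x → (L u x).card = 6) (s t : V) :
    ArcCol (fun u x => G.Adj u x ∧ u ≠ s ∧ u ≠ t ∧ x ≠ s ∧ x ≠ t) L := by
  classical
  let S : Finset (V × V) :=
    Finset.univ.filter fun a => G.Adj a.1 a.2 ∧ a.1 ≠ s ∧ a.1 ≠ t ∧ a.2 ≠ s ∧ a.2 ≠ t
  let r : V × V → ℕ := fun a =>
    2 * G.dist a.1 s + if G.dist a.2 s < G.dist a.1 s then 0 else 1
  let R : V × V → V × V → Prop := fun a b => a.1 = b.1 ∨ a.2 = b.1 ∨ b.2 = a.1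
  have hex : ∀ a : V × V, ∃ N : Finset (V × V), a ∈ S → N.card ≤ 5 ∧
      ∀ b ∈ S, b ≠ a → R a b → r a ≤ r b → b ∈ N := by
    rintro ⟨u, x⟩
    by_cases ha : (u, x) ∈ S
    swap
    · exact ⟨∅, fun h => absurd h ha⟩
    simp only [S, Finset.mem_filter, Finset.mem_univ, true_and] at ha
    obtain ⟨hux, hus, hut, hxs, hxt⟩ := ha
    obtain ⟨w, huw, hdw⟩ := exists_parent G hG s u hus
    obtain ⟨x1, x2, -, -, -, hx⟩ := hN x u hux.symm
    by_cases hd : G.dist x s < G.dist u s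
    · obtain ⟨u1, u2, -, -, -, hu⟩ := hN u x hux
      refine ⟨{(u, u1), (u, u2), (u1, u), (u2, u)}, fun _ => ⟨Finset.card_le_four.trans (by omega), ?_⟩⟩
      rintro ⟨v, y⟩ hb hne hR hr
      simp only [S, Finset.mem_filter, Finset.mem_univ, true_and] at hb
      simp only [r, hd, if_true] at hr
      simp only [R] at hR
      simp only [Finset.mem_insert, Finset.mem_singleton, Prod.mk.injEq]
      have hb1 := hb.1
      rcases hR with rfl | rfl | rfl
      · rcases (hu y).1 hb1 with rfl | rfl | rfl
        · exact absurd rfl hne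
        · simp
        · simp
      · exfalso; split_ifs at hr <;> omega
      · rcases (hu v).1 hb1.symm with rfl | rfl | rfl
        · exfalso; split_ifs at hr <;> omega
        · simp
        · simp
    · have hwx : x ≠ w := by rintro rfl; exact hd hdw
      obtain ⟨u1, hu⟩ : ∃ u1, ∀ y, G.Adj u y ↔ y = x ∨ y = w ∨ y = u1 := by
        obtain ⟨u1, u2, -, -, -, hu⟩ := hN u x hux
        rcases (hu w).1 huw with rfl | rfl | rfl
        · exact absurd rfl hwx
        · exact ⟨u2, hu⟩
        · exact ⟨u1, fun y => by rw [hu]; tauto⟩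
      refine ⟨{(u, u1), (u1, u), (x, u), (x, x1), (x, x2)}, fun _ => ⟨Finset.card_le_five, ?_⟩⟩
      rintro ⟨v, y⟩ hb hne hR hr
      simp only [S, Finset.mem_filter, Finset.mem_univ, true_and] at hb
      simp only [r, hd, if_false] at hr
      simp only [R] at hR
      simp only [Finset.mem_insert, Finset.mem_singleton, Prod.mk.injEq]
      have hb1 := hb.1
      rcases hR with rfl | rfl | rfl
      · rcases (hu y).1 hb1 with rfl | rfl | rfl
        · exact absurd rfl hne
        · exfalso; rw [if_pos hdw] at hr; omega
        · simp
      · rcases (hx y).1 hb1 with rfl | rfl | rfl <;> simp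
      · rcases (hu v).1 hb1.symm with rfl | rfl | rfl
        · simp
        · exfalso; split_ifs at hr <;> omega
        · simp
  choose N hNN using hex
  obtain ⟨f, f1, f2⟩ := greedy_color R (by simp only [R]; tauto) (fun a => L a.1 a.2) r N S
    (fun a ha => by
      have h1 := (hNN a ha).1
      simp only [S, Finset.mem_filter, Finset.mem_univ, true_and] at ha
      rw [hL _ _ ha.1]; omega)
    (fun a ha => (hNN a ha).2)
  refine ⟨fun u x => f (u, x), fun u x h => f1 (u, x) (by simpa [S] using h), ?_⟩
  intro u x v y h1 h2 h3 h4
  exact f2 (u, x) (by simpa [S] using h1) (v, y) (by simpa [S] using h2)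
    (fun h => h3 (by simpa using h)) h4

set_option maxHeartbeats 1000000 in
theorem no_tri_case {V : Type*} [Fintype V] (G : SimpleGraph V) (hG : G.Connected)
    (hN : ∀ v w, G.Adj v w → ∃ a b, a ≠ b ∧ a ≠ w ∧ b ≠ w ∧ ∀ x, G.Adj v x ↔ x = w ∨ x = a ∨ x = b)
    (L : V → V → Finset ℕ) (hL : ∀ u x, G.Adj u x → (L u x).card = 6) (s t : V) (hst : G.Adj s t)
    (htri : ∀ x, G.Adj s x → ¬ G.Adj t x) : ArcCol G.Adj L := by
  classical
  obtain ⟨f, f1, f2⟩ := outside G hG hN L hL s t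
  obtain ⟨a, b, hab, hat, hbt, hs⟩ := hN s t hst
  obtain ⟨c, d, hcd, hcs, hds, ht⟩ := hN t s hst.symm
  have sa : G.Adj s a := (hs a).2 (by simp)
  have sb : G.Adj s b := (hs b).2 (by simp)
  have tc : G.Adj t c := (ht c).2 (by simp)
  have td : G.Adj t d := (ht d).2 (by simp)
  have hres : ∀ v w, G.Adj v w → ∃ I O : Finset ℕ, I ⊆ L w v ∧ O ⊆ L v w ∧
      2 ≤ I.card ∧ 4 ≤ O.card ∧ ∀ y, G.Adj w y → y ≠ v →
        (∀ z ∈ I, z ≠ f w y ∧ z ≠ f y w) ∧ (∀ z ∈ O, z ≠ f w y) := by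
    intro v w hvw
    obtain ⟨y1, y2, -, -, -, hw⟩ := hN w v hvw.symm
    refine ⟨L w v \ {f w y1, f y1 w, f w y2, f y2 w}, L v w \ {f w y1, f w y2},
      Finset.sdiff_subset, Finset.sdiff_subset, sub_four _ _ _ _ _ (hL _ _ hvw.symm), ?_, ?_⟩
    · have h1 := Finset.le_card_sdiff {f w y1, f w y2} (L v w)
      have h2 := Finset.card_le_two (a := f w y1) (b := f w y2)
      rw [hL _ _ hvw] at h1
      omega
    · intro y hy hyv
      simp only [Finset.mem_sdiff, Finset.mem_insert, Finset.mem_singleton, not_or]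
      rcases (hw y).1 hy with rfl | rfl | rfl
      · exact absurd rfl hyv
      · tauto
      · tauto
  obtain ⟨A, B, sA, sB, cA, cB, nA⟩ := hres s a sa
  obtain ⟨A', B', sA', sB', cA', cB', nA'⟩ := hres s b sb
  obtain ⟨C, D, sC, sD, cC, cD, nC⟩ := hres t c tc
  obtain ⟨C', D', sC', sD', cC', cD', nC'⟩ := hres t d td
  obtain ⟨p, hp, q, hq, hpq, ⟨i, hi, i', hi', o, ho, o', ho', h1⟩,
    ⟨j, hj, j', hj', k, hk, k', hk', h2⟩⟩ :=
    double_star' (L s t) (L t s) A A' B B' C C' D D' (hL _ _ hst).ge (hL _ _ hst.symm).ge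
      cA cA' cB cB' cC cC' cD cD'
  have hne : s ≠ t := hst.ne
  have nas : a ≠ s := sa.ne.symm
  have nbs : b ≠ s := sb.ne.symm
  have nct : c ≠ t := tc.ne.symm
  have ndt : d ≠ t := td.ne.symm
  have nac : a ≠ c := by rintro rfl; exact htri _ sa tc
  have nad : a ≠ d := by rintro rfl; exact htri _ sa td
  have nbc : b ≠ c := by rintro rfl; exact htri _ sb tc
  have nbd : b ≠ d := by rintro rfl; exact htri _ sb td
  -- the colouring
  obtain ⟨col, e1, e2, e3, e4, e5, e6, e7, e8, e9, e10, e11⟩ : ∃ col : V → V → ℕ,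
      col s t = p ∧ col t s = q ∧ col s a = o ∧ col s b = o' ∧ col a s = i ∧ col b s = i' ∧
      col t c = k ∧ col t d = k' ∧ col c t = j ∧ col d t = j' ∧
      ∀ u x, u ≠ s → u ≠ t → x ≠ s → x ≠ t → col u x = f u x := by
    refine ⟨fun u x => if u = s then (if x = t then p else if x = a then o else o') else
      if u = t then (if x = s then q else if x = c then k else k') else
      if x = s then (if u = a then i else i') else
      if x = t then (if u = c then j else j') else f u x, ?_⟩
    simp [hne.symm, hab.symm, hcd.symm, hat, hbt, hcs, hds, nas, nbs, nct, ndt]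
    intro u x h1 h2 h3 h4
    simp [h1, h2, h3, h4]
  have hsf : ∀ w y, G.Adj s w → w ≠ t → G.Adj w y → y ≠ s →
      col w s ≠ col w y ∧ col w s ≠ col y w ∧ col s w ≠ col w y := by
    intro w y hw hwt hy hys
    have hyt : y ≠ t := by rintro rfl; exact htri _ hw hy.symm
    have hws : w ≠ s := hw.ne.symm
    rw [e11 w y hws hwt hys hyt, e11 y w hys hyt hws hwt]
    rcases (hs w).1 hw with h | h | h
    · exact absurd h hwt
    · rw [h] at hy ⊢
      rw [e5, e3]
      have hh := nA y hy hys
      exact ⟨(hh.1 i hi).1, (hh.1 i hi).2, hh.2 o ho⟩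
    · rw [h] at hy ⊢
      rw [e6, e4]
      have hh := nA' y hy hys
      exact ⟨(hh.1 i' hi').1, (hh.1 i' hi').2, hh.2 o' ho'⟩
  have htf : ∀ w y, G.Adj t w → w ≠ s → G.Adj w y → y ≠ t →
      col w t ≠ col w y ∧ col w t ≠ col y w ∧ col t w ≠ col w y := by
    intro w y hw hws hy hyt
    have hys : y ≠ s := by rintro rfl; exact htri _ hy.symm hw
    have hwt : w ≠ t := hw.ne.symm
    rw [e11 w y hws hwt hys hyt, e11 y w hys hyt hws hwt]
    rcases (ht w).1 hw with h | h | h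
    · exact absurd h hws
    · rw [h] at hy ⊢
      rw [e9, e7]
      have hh := nC y hy hyt
      exact ⟨(hh.1 j hj).1, (hh.1 j hj).2, hh.2 k hk⟩
    · rw [h] at hy ⊢
      rw [e10, e8]
      have hh := nC' y hy hyt
      exact ⟨(hh.1 j' hj').1, (hh.1 j' hj').2, hh.2 k' hk'⟩
  obtain ⟨m1, m2, m3, m4, m5, m6, m7, m8, m9, m10, m11⟩ := h1
  obtain ⟨l1, l2, l3, l4, l5, l6, l7, l8, l9, l10, l11⟩ := h2
  have ss1 : ∀ x y, G.Adj s x → G.Adj s y → x ≠ y → col s x ≠ col s y := by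
    intro x y hx hy hxy
    rcases (hs x).1 hx with h | h | h <;> rcases (hs y).1 hy with h' | h' | h' <;>
      rw [h, h'] at hxy <;> rw [h, h'] <;>
      first | exact absurd rfl hxy | (simp only [e1, e3, e4]; first | assumption | (symm; assumption))
  have ss2 : ∀ x y, G.Adj s x → G.Adj s y → col x s ≠ col s y := by
    intro x y hx hy
    rcases (hs x).1 hx with h | h | h <;> rcases (hs y).1 hy with h' | h' | h' <;>
      rw [h, h'] <;> simp only [e1, e2, e3, e4, e5, e6] <;> first | assumption | (symm; assumption)
  have tt1 : ∀ x y, G.Adj t x → G.Adj t y → x ≠ y → col t x ≠ col t y := by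
    intro x y hx hy hxy
    rcases (ht x).1 hx with h | h | h <;> rcases (ht y).1 hy with h' | h' | h' <;>
      rw [h, h'] at hxy <;> rw [h, h'] <;>
      first | exact absurd rfl hxy | (simp only [e2, e7, e8]; first | assumption | (symm; assumption))
  have tt2 : ∀ x y, G.Adj t x → G.Adj t y → col x t ≠ col t y := by
    intro x y hx hy
    rcases (ht x).1 hx with h | h | h <;> rcases (ht y).1 hy with h' | h' | h' <;>
      rw [h, h'] <;> simp only [e1, e2, e7, e8, e9, e10] <;> first | assumption | (symm; assumption)
  have outs : ∀ u x y, G.Adj u x → G.Adj u y → x ≠ y → col u x ≠ col u y := by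
    intro u x y hx hy hxy
    by_cases u1 : u = s
    · rw [u1] at hx hy ⊢; exact ss1 x y hx hy hxy
    by_cases u2 : u = t
    · rw [u2] at hx hy ⊢; exact tt1 x y hx hy hxy
    by_cases x1 : x = s
    · rw [x1] at hx hxy ⊢; exact (hsf u y hx.symm u2 hy hxy.symm).1
    by_cases x2 : x = t
    · rw [x2] at hx hxy ⊢; exact (htf u y hx.symm u1 hy hxy.symm).1
    by_cases y1 : y = s
    · rw [y1] at hy hxy ⊢; exact (hsf u x hy.symm u2 hx hxy).1.symm
    by_cases y2 : y = t
    · rw [y2] at hy hxy ⊢; exact (htf u x hy.symm u1 hx hxy).1.symm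
    rw [e11 u x u1 u2 x1 x2, e11 u y u1 u2 y1 y2]
    exact f2 u x u y ⟨hx, u1, u2, x1, x2⟩ ⟨hy, u1, u2, y1, y2⟩ (fun h => hxy h.2) (Or.inl rfl)
  have thr : ∀ u x y, G.Adj u x → G.Adj x y → col u x ≠ col x y := by
    intro u x y hx hy
    by_cases x1 : x = s
    · rw [x1] at hx hy ⊢; exact ss2 u y hx.symm hy
    by_cases x2 : x = t
    · rw [x2] at hx hy ⊢; exact tt2 u y hx.symm hy
    by_cases u1 : u = s
    · rw [u1] at hx ⊢
      by_cases y1 : y = s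
      · rw [y1]; exact (ss2 x x hx hx).symm
      · exact (hsf x y hx x2 hy y1).2.2
    by_cases u2 : u = t
    · rw [u2] at hx ⊢
      by_cases y1 : y = t
      · rw [y1]; exact (tt2 x x hx hx).symm
      · exact (htf x y hx x1 hy y1).2.2
    by_cases y1 : y = s
    · rw [y1] at hy ⊢; exact (hsf x u hy.symm x2 hx.symm u1).2.1.symm
    by_cases y2 : y = t
    · rw [y2] at hy ⊢; exact (htf x u hy.symm x1 hx.symm u2).2.1.symm
    rw [e11 u x u1 u2 x1 x2, e11 x y x1 x2 y1 y2]
    exact f2 u x x y ⟨hx, u1, u2, x1, x2⟩ ⟨hy, x1, x2, y1, y2⟩ (fun h => hx.ne h.1) (Or.inr (Or.inl rfl))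
  refine ⟨col, ?_, ?_⟩
  · intro u x hux
    by_cases u1 : u = s
    · rw [u1] at hux ⊢
      rcases (hs x).1 hux with h | h | h
      · rw [h, e1]; exact hp
      · rw [h, e3]; exact sB ho
      · rw [h, e4]; exact sB' ho'
    by_cases u2 : u = t
    · rw [u2] at hux ⊢
      rcases (ht x).1 hux with h | h | h
      · rw [h, e2]; exact hq
      · rw [h, e7]; exact sD hk
      · rw [h, e8]; exact sD' hk'
    by_cases x1 : x = s
    · rw [x1] at hux ⊢
      rcases (hs u).1 hux.symm with h | h | h
      · exact absurd h u2
      · rw [h, e5]; exact sA hi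
      · rw [h, e6]; exact sA' hi'
    by_cases x2 : x = t
    · rw [x2] at hux ⊢
      rcases (ht u).1 hux.symm with h | h | h
      · exact absurd h u1
      · rw [h, e9]; exact sC hj
      · rw [h, e10]; exact sC' hj'
    rw [e11 _ _ u1 u2 x1 x2]; exact f1 _ _ ⟨hux, u1, u2, x1, x2⟩
  · rintro u x v y h1 h2 h3 (rfl | rfl | rfl)
    · exact outs u x y h1 h2 (fun h => h3 ⟨rfl, h⟩)
    · exact thr u x y h1 h2
    · exact (thr v y x h2 h1).symm

theorem main_arcs {V : Type*} [Fintype V] (G : SimpleGraph V) (hG : G.Connected)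
    (hN : ∀ v w, G.Adj v w → ∃ a b, a ≠ b ∧ a ≠ w ∧ b ≠ w ∧ ∀ x, G.Adj v x ↔ x = w ∨ x = a ∨ x = b)
    (v0 w0 : V) (h0 : G.Adj v0 w0)
    (L : V → V → Finset ℕ) (hL : ∀ u x, G.Adj u x → (L u x).card = 6) : ArcCol G.Adj L := by
  by_cases htri : ∃ s t, G.Adj s t ∧ ∀ x, G.Adj s x → ¬ G.Adj t x
  · obtain ⟨s, t, hst, h⟩ := htri
    exact no_tri_case G hG hN L hL s t hst h
  push Not at htri
  have step : ∀ v a b c, a ≠ b → a ≠ c → b ≠ c → (∀ x, G.Adj v x ↔ x = a ∨ x = b ∨ x = c) →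
      G.Adj a b → G.Adj b c → G.Adj a c := by
    intro v a b c hab hac hbc hv h1 h2
    have va : G.Adj v a := (hv a).2 (by simp)
    have vb : G.Adj v b := (hv b).2 (by simp)
    have vc : G.Adj v c := (hv c).2 (by simp)
    have hb : ∀ x, G.Adj b x → x = v ∨ x = a ∨ x = c := by
      obtain ⟨y, z, hyz, hy, hz, h⟩ := hN b v vb.symm
      have k1 := (h a).1 h1.symm
      have k2 := (h c).1 h2
      have n1 := va.ne
      have n2 := vc.ne
      intro x hx
      have := (h x).1 hx
      grind
    obtain ⟨y, z, hyz, hy, hz, h⟩ := hN a v va.symm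
    have : ∃ d, G.Adj a d ∧ d ≠ v ∧ d ≠ b ∧ ∀ x, G.Adj a x → x = v ∨ x = b ∨ x = d := by
      rcases (h b).1 h1 with rfl | rfl | rfl
      · exact absurd vb (G.irrefl)
      · exact ⟨z, (h z).2 (by simp), hz, hyz.symm, fun x => (h x).1⟩
      · exact ⟨y, (h y).2 (by simp), hy, hyz, fun x hx => by have := (h x).1 hx; tauto⟩
    obtain ⟨d, had, d1, d2, hd⟩ := this
    have d3 : d ≠ a := had.ne.symm
    obtain ⟨x, hx1, hx2⟩ := htri a d had
    rcases hd x hx1 with rfl | rfl | rfl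
    · rcases (hv d).1 hx2.symm with rfl | rfl | rfl
      · exact absurd rfl d3
      · exact absurd rfl d2
      · exact had
    · rcases hb d hx2.symm with rfl | rfl | rfl
      · exact absurd rfl d1
      · exact absurd rfl d3
      · exact had
    · exact absurd hx2 (G.irrefl)
  obtain ⟨a, b, hab, haw, hbw, hv⟩ := hN v0 w0 h0
  have va : G.Adj v0 a := (hv a).2 (by simp)
  have vb : G.Adj v0 b := (hv b).2 (by simp)
  have tri : G.Adj w0 a ∧ G.Adj w0 b ∧ G.Adj a b := by
    obtain ⟨x, x1, x2⟩ := htri _ _ h0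
    obtain ⟨y, y1, y2⟩ := htri _ _ va
    obtain ⟨z, z1, z2⟩ := htri _ _ vb
    have irr : ∀ x, ¬ G.Adj x x := fun x => G.irrefl
    have c1 : G.Adj w0 a ∨ G.Adj w0 b := by
      rcases (hv x).1 x1 with rfl | rfl | rfl
      · exact absurd x2 (irr _)
      · exact Or.inl x2
      · exact Or.inr x2
    have c2 : G.Adj w0 a ∨ G.Adj a b := by
      rcases (hv y).1 y1 with rfl | rfl | rfl
      · exact Or.inl y2.symm
      · exact absurd y2 (irr _)
      · exact Or.inr y2
    have c3 : G.Adj w0 b ∨ G.Adj a b := by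
      rcases (hv z).1 z1 with rfl | rfl | rfl
      · exact Or.inl z2.symm
      · exact Or.inr z2.symm
      · exact absurd z2 (irr _)
    have s1 : G.Adj w0 a → G.Adj a b → G.Adj w0 b :=
      step v0 w0 a b haw.symm hbw.symm hab hv
    have s2 : G.Adj a w0 → G.Adj w0 b → G.Adj a b :=
      step v0 a w0 b haw hab hbw.symm (fun x => by rw [hv x]; clear * -; tauto)
    have s3 : G.Adj w0 b → G.Adj b a → G.Adj w0 a :=
      step v0 w0 b a hbw.symm haw.symm hab.symm (fun x => by rw [hv x]; clear * -; tauto)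
    rcases c1 with h | h
    · rcases c3 with h' | h'
      · exact ⟨h, h', s2 h.symm h'⟩
      · exact ⟨h, s1 h h', h'⟩
    · rcases c2 with h' | h'
      · exact ⟨h', h, s2 h'.symm h⟩
      · exact ⟨s3 h h'.symm, h, h'⟩
  obtain ⟨wa, wb, ab⟩ := tri
  have closed : ∀ x y, G.Adj x y → (x = v0 ∨ x = w0 ∨ x = a ∨ x = b) →
      (y = v0 ∨ y = w0 ∨ y = a ∨ y = b) := by
    have three : ∀ v p q r y, G.Adj v p → G.Adj v q → G.Adj v r → p ≠ q → p ≠ r → q ≠ r →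
        G.Adj v y → y = p ∨ y = q ∨ y = r := by
      intro v p q r y hp hq hr n1 n2 n3 hy
      obtain ⟨m, n, -, -, -, h⟩ := hN v p hp
      have k1 := (h q).1 hq
      have k2 := (h r).1 hr
      have k3 := (h y).1 hy
      grind
    rintro x y hxy (rfl | rfl | rfl | rfl)
    · have := three _ _ _ _ y h0 va vb haw.symm hbw.symm hab hxy; clear * - this; tauto
    · have := three _ _ _ _ y h0.symm wa wb va.ne vb.ne hab hxy; clear * - this; tauto
    · have := three _ _ _ _ y va.symm wa.symm ab h0.ne vb.ne hbw.symm hxy; clear * - this; tauto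
    · have := three _ _ _ _ y vb.symm wb.symm ab.symm h0.ne va.ne haw.symm hxy; clear * - this; tauto
  have walk : ∀ x y, G.Walk x y → (x = v0 ∨ x = w0 ∨ x = a ∨ x = b) →
      (y = v0 ∨ y = w0 ∨ y = a ∨ y = b) := by
    intro x y p
    induction p with
    | nil => exact id
    | cons h _ ih => exact fun hx => ih (closed _ _ h hx)
  have hall : ∀ x, x = v0 ∨ x = w0 ∨ x = a ∨ x = b := by
    intro x
    obtain ⟨p⟩ := hG v0 x
    exact walk _ _ p (Or.inl rfl)
  have hadj : ∀ x y, x ≠ y → G.Adj x y := by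
    have := h0.symm
    have := va.symm
    have := vb.symm
    have := wa.symm
    have := wb.symm
    have := ab.symm
    intro x y hxy
    rcases hall x with rfl | rfl | rfl | rfl <;> rcases hall y with rfl | rfl | rfl | rfl <;>
      first | exact absurd rfl hxy | assumption
  obtain ⟨col, g1, g2⟩ := k4_case L (fun u x h => hL u x (hadj u x h)) v0 w0 a b h0.ne va.ne vb.ne
    haw.symm hbw.symm hab hall
  exact ⟨col, fun u x h => g1 u x h.ne, fun u x v y h1 h2 => g2 u x v y h1.ne h2.ne⟩

theorem choosable_six {V : Type*} [Fintype V]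
    (G : SimpleGraph V) (hcubic : ∀ v, vdeg G v = 3) (hG : G.Connected) : IncChoosable G 6 := by
  classical
  intro L hL
  have hN : ∀ v w, G.Adj v w →
      ∃ a b, a ≠ b ∧ a ≠ w ∧ b ≠ w ∧ ∀ x, G.Adj v x ↔ x = w ∨ x = a ∨ x = b := by
    intro v w hvw
    obtain ⟨x, y, z, hxy, hxz, hyz, h⟩ := Set.ncard_eq_three.1 (hcubic v)
    have h' : ∀ u, G.Adj v u ↔ u = x ∨ u = y ∨ u = z := by
      intro u
      rw [← SimpleGraph.mem_neighborSet, h]; simp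
    rcases (h' w).1 hvw with rfl | rfl | rfl
    · exact ⟨y, z, hyz, hxy.symm, hxz.symm, h'⟩
    · exact ⟨x, z, hxz, hxy, hyz.symm, fun u => by rw [h']; tauto⟩
    · exact ⟨x, y, hxy, hxz, hyz, fun u => by rw [h']; tauto⟩
  obtain ⟨v0⟩ := hG.nonempty
  obtain ⟨w0, h0⟩ : ∃ w, G.Adj v0 w := by
    obtain ⟨x, y, z, -, -, -, h⟩ := Set.ncard_eq_three.1 (hcubic v0)
    exact ⟨x, by rw [← SimpleGraph.mem_neighborSet, h]; simp⟩
  obtain ⟨col, c1, c2⟩ := main_arcs G hG hN v0 w0 h0 (fun u x => L (u, s(u, x)))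
    (fun u x h => hL u _ ⟨h, by simp⟩)
  have hform : ∀ v e, IsIncidence G v e → ∃ w, e = s(v, w) ∧ G.Adj v w := by
    rintro v e ⟨he, hv⟩
    obtain ⟨w, rfl⟩ := Sym2.mem_iff_exists.1 hv
    exact ⟨w, rfl, he⟩
  let φ : V × Sym2 V → ℕ := fun a => if h : ∃ w, a.2 = s(a.1, w) then col a.1 h.choose else 0
  have hφ : ∀ v w, φ (v, s(v, w)) = col v w := by
    intro v w
    have h : ∃ w', s(v, w) = s(v, w') := ⟨w, rfl⟩
    have hc : h.choose = w := (Sym2.congr_right.1 h.choose_spec).symm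
    simp only [φ]
    rw [dif_pos h, hc]
  refine ⟨φ, ?_, ?_⟩
  · intro v e h
    obtain ⟨w, rfl, hw⟩ := hform v e h
    rw [hφ]; exact c1 v w hw
  · intro u e v f h1 h2 hne hadj
    obtain ⟨x, rfl, hx⟩ := hform u e h1
    obtain ⟨y, rfl, hy⟩ := hform v f h2
    rw [hφ, hφ]
    refine c2 u x v y hx hy ?_ ?_
    · rintro ⟨rfl, rfl⟩; exact hne rfl
    · rcases hadj with h | h | h | h
      · exact Or.inl h
      · rcases Sym2.eq_iff.1 h with ⟨h, -⟩ | ⟨h, h'⟩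
        · exact Or.inl h
        · exact Or.inr (Or.inl h')
      · exact Or.inr (Or.inl (Sym2.congr_right.1 h).symm)
      · rw [Sym2.eq_swap] at h
        exact Or.inr (Or.inr (Sym2.congr_right.1 h).symm)

/-- Every 2-connected cubic simple graph has incidence choice number at most 6. -/
theorem incChoiceNumber_le_six_of_twoConnected_cubic {V : Type*} [Fintype V]
    (G : SimpleGraph V) (hcubic : ∀ v, vdeg G v = 3) (h2 : TwoConnected G) :
    incChoiceNumber G ≤ 6 :=
  Nat.sInf_le (choosable_six G hcubic h2.1)
end
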